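/- Let A be a nowhere scattered C*-algebra of nuclear dimension at most k. Then for every class [a] ∈ Cu(A) one has wdiv_{4(k+1)}(2(k+1)·[a]) ≤ 8(k+1)². In particular, every element of the Cuntz semigroup of a nowhere scattered C*-algebra of finite nuclear dimension has a multiple with finite weak divisibility. -/

import Mathlib

/-!
Common definitions: abstract Cuntz semigroups, divisibility, and C*-algebra notions
(nowhere scatteredness, σ-unitality, etc.) used to formalize the statements.
-/

open scoped MultiplierAlgebra ENNReal
open Filter Topology

noncomputable section

universe uu vv

/-- The (sequential) way-below relation `x ≪ y` (compact containment) in a partially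
ordered set: whenever an increasing sequence has a supremum lying above `y`, some term
of the sequence already lies above `x`. -/
def WayBelow {S : Type*} [PartialOrder S] (x y : S) : Prop :=
  ∀ f : ℕ → S, Monotone f → ∀ s : S, IsLUB (Set.range f) s → y ≤ s → ∃ n, x ≤ f n

/-- An abstract Cuntz semigroup (`Cu`-semigroup): a positively ordered abelian monoid in
which every increasing sequence has a supremum, every element is the supremum of a
`≪`-increasing sequence, addition preserves `≪`, and which satisfies the standard
axioms (O5) (almost algebraic order) and (O6) (almost Riesz decomposition), as well as
the existence of infima with idempotents `∞y = sup_n n•y` (all of these hold in the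
Cuntz semigroup of any C*-algebra). -/
class CuSemigroup (S : Type*) extends AddCommMonoid S, PartialOrder S where
  add_le_add' : ∀ a b : S, a ≤ b → ∀ c : S, c + a ≤ c + b
  zero_le' : ∀ x : S, 0 ≤ x
  exists_isLUB : ∀ f : ℕ → S, Monotone f → ∃ s : S, IsLUB (Set.range f) s
  exists_waybelow_seq : ∀ x : S, ∃ f : ℕ → S, Monotone f ∧
    (∀ n, WayBelow (f n) (f (n + 1))) ∧ IsLUB (Set.range f) x
  waybelow_add : ∀ {x y z w : S}, WayBelow x y → WayBelow z w → WayBelow (x + z) (y + w)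
  /-- axiom (O5) -/
  almost_algebraic : ∀ x' x y' y z : S, WayBelow x' x → WayBelow y' y → x + y ≤ z →
    ∃ c : S, y' ≤ c ∧ x' + c ≤ z ∧ z ≤ x + c
  /-- axiom (O6) -/
  almost_riesz : ∀ x' x y z : S, WayBelow x' x → x ≤ y + z →
    ∃ v w : S, v ≤ x ∧ v ≤ y ∧ w ≤ x ∧ w ≤ z ∧ x' ≤ v + w
  /-- `infty y = ∞·y = sup_n n•y` -/
  infty : S → S
  isLUB_infty : ∀ y : S, IsLUB (Set.range fun n : ℕ => n • y) (infty y)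
  /-- the infimum `x ⊓ ∞y`, which exists in the Cuntz semigroup of any C*-algebra -/
  meetInfty : S → S → S
  isGLB_meetInfty : ∀ x y : S, IsGLB {x, infty y} (meetInfty x y)

namespace CuDiv

variable {S : Type*} [CuSemigroup S]

/-- `x` is weakly `(m, n)`-divisible. -/
def IsWeaklyDivisible (m n : ℕ) (x : S) : Prop :=
  ∀ x' : S, WayBelow x' x → ∃ y : Fin n → S, x' ≤ ∑ j, y j ∧ ∀ j, m • y j ≤ x

/-- `x` is `(m, n)`-divisible. -/
def IsDivisible (m n : ℕ) (x : S) : Prop :=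
  ∀ x' : S, WayBelow x' x → ∃ y : S, x' ≤ n • y ∧ m • y ≤ x

/-- `x` is weakly `(m, ω)`-divisible. -/
def IsWeaklyOmegaDivisible (m : ℕ) (x : S) : Prop :=
  ∀ x' : S, WayBelow x' x → ∃ (n : ℕ) (y : Fin n → S), x' ≤ ∑ j, y j ∧ ∀ j, m • y j ≤ x

/-- `x` is `(m, ω)`-divisible. -/
def IsOmegaDivisible (m : ℕ) (x : S) : Prop :=
  ∀ x' : S, WayBelow x' x → ∃ (y : S) (n : ℕ), x' ≤ n • y ∧ m • y ≤ x

/-- `wdiv m x` is the least positive integer `n` such that `x` is weakly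
`(m,n)`-divisible, and `∞` if there is no such `n`. -/
def wdiv (m : ℕ) (x : S) : ℕ∞ :=
  sInf {N : ℕ∞ | ∃ n : ℕ, 1 ≤ n ∧ N = n ∧ IsWeaklyDivisible m n x}

/-- `Div m x` is the least positive integer `n` such that `x` is `(m,n)`-divisible,
and `∞` if there is no such `n`. -/
def Div (m : ℕ) (x : S) : ℕ∞ :=
  sInf {N : ℕ∞ | ∃ n : ℕ, 1 ≤ n ∧ N = n ∧ IsDivisible m n x}

/-- An element `x` is strongly soft if for every `x' ≪ x` there is `t` with
`x' + t ≤ x ≤ ∞t`. -/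
def StronglySoft (x : S) : Prop :=
  ∀ x' : S, WayBelow x' x → ∃ t : S, x' + t ≤ x ∧ x ≤ CuSemigroup.infty t

/-- The Cuntz semigroup characterization of the Global Glimm Property: every element is
`(m, ω)`-divisible for every `m`. -/
def GlobalGlimm (S : Type*) [CuSemigroup S] : Prop :=
  ∀ (m : ℕ) (x : S), IsOmegaDivisible m x

/-- `Cu(A)` is left-soft separative. -/
def LeftSoftSeparative (S : Type*) [CuSemigroup S] : Prop :=
  ∀ x y t : S, StronglySoft x → WayBelow (x + t) (y + t) →
    WayBelow t (CuSemigroup.infty y) → WayBelow t (CuSemigroup.infty x) → WayBelow x y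

/-- `Cu(A)` is weakly cancellative. -/
def WeaklyCancellative (S : Type*) [CuSemigroup S] : Prop :=
  ∀ x y z : S, WayBelow (x + z) (y + z) → WayBelow x y

/-- `Cu(A)` has covering dimension zero. -/
def CoveringDimZero (S : Type*) [CuSemigroup S] : Prop :=
  ∀ x' x y₁ y₂ : S, WayBelow x' x → WayBelow x (y₁ + y₂) →
    ∃ z₁ z₂ : S, z₁ ≤ y₁ ∧ z₂ ≤ y₂ ∧ x' ≤ z₁ + z₂ ∧ z₁ + z₂ ≤ x

end CuDiv

/-- A functional on a Cuntz semigroup: an additive, order preserving map to `ℝ≥0∞`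
preserving suprema of increasing sequences.  (By Elliott–Robert–Santiago, the
functionals on `Cu(A)` are exactly those induced by the lower semicontinuous
2-quasitraces on `A ⊗ K`.) -/
structure CuFunctional (S : Type*) [CuSemigroup S] where
  toFun : S → ℝ≥0∞
  map_zero' : toFun 0 = 0
  map_add' : ∀ x y : S, toFun (x + y) = toFun x + toFun y
  mono' : ∀ x y : S, x ≤ y → toFun x ≤ toFun y
  sup' : ∀ f : ℕ → S, Monotone f → ∀ s : S, IsLUB (Set.range f) s →
    toFun s = ⨆ n, toFun (f n)

instance {S : Type*} [CuSemigroup S] : CoeFun (CuFunctional S) fun _ => S → ℝ≥0∞ :=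
  ⟨CuFunctional.toFun⟩

namespace CuDiv

variable {S : Type*} [CuSemigroup S]

/-- `x <ₛ y` : there is `γ < 1` with `λ(x) ≤ γ·λ(y)` for every functional `λ`. -/
def FunctionalLT (x y : S) : Prop :=
  ∃ γ : ℝ≥0∞, γ < 1 ∧ ∀ lam : CuFunctional S, lam x ≤ γ * lam y

/-- `A` has `k`-comparison (stated on `Cu(A)`). -/
def KComparison (S : Type*) [CuSemigroup S] (k : ℕ) : Prop :=
  ∀ (x : S) (b : Fin (k + 1) → S), (∀ i, FunctionalLT x (b i)) → x ≤ ∑ i, b i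

/-- `A` has strict comparison (stated on `Cu(A)`, via functionals, which correspond to
the lower semicontinuous 2-quasitraces). -/
def StrictComparison (S : Type*) [CuSemigroup S] : Prop :=
  ∀ x y : S, FunctionalLT x y → x ≤ y

/-- The natural topology on the cone `F(Cu(A))` of functionals. -/
def functionalTopology (S : Type*) [CuSemigroup S] : TopologicalSpace (CuFunctional S) :=
  TopologicalSpace.generateFrom
    ({U | ∃ (x : S) (r : ℝ≥0∞), U = {lam : CuFunctional S | r < lam x}} ∪
      {U | ∃ (x' x : S) (r : ℝ≥0∞), WayBelow x' x ∧ U = {lam : CuFunctional S | lam x' < r}})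

/-- A lower semicontinuous affine function on the cone of functionals of `Cu(A)`,
i.e. an element of `L(F(Cu(A)))`. -/
def IsLscAffine (F : CuFunctional S → ℝ≥0∞) : Prop :=
  (letI := functionalTopology S; LowerSemicontinuous F) ∧
    (∀ lam mu nu : CuFunctional S, (∀ x, nu x = lam x + mu x) → F nu = F lam + F mu) ∧
    (∀ (r : ℝ≥0∞) (lam nu : CuFunctional S), (∀ x, nu x = r * lam x) → F nu = r * F lam)

/-- The rank map of `Cu(A)` is surjective: every lower semicontinuous affine function on
the cone of functionals is realized as the rank function `λ ↦ λ(x)` of an element. -/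
def SurjectiveRankMap (S : Type*) [CuSemigroup S] : Prop :=
  ∀ F : CuFunctional S → ℝ≥0∞, IsLscAffine F → ∃ y : S, ∀ lam : CuFunctional S, lam y = F lam

end CuDiv

/-! ### C*-algebra notions -/

section CStar

variable {B : Type*} [NonUnitalCStarAlgebra B]

/-- Positivity in a C*-algebra: `a` is positive iff it is of the form `star b * b`. -/
def CStarNonneg (a : B) : Prop := ∃ b : B, a = star b * b

/-- Cuntz subequivalence `a ≼ b` : `a = lim_n rₙ b rₙ*`. -/
def CuntzBelow (a b : B) : Prop :=
  ∃ r : ℕ → B, Tendsto (fun n => r n * b * star (r n)) atTop (𝓝 a)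

/-- Cuntz equivalence. -/
def CuntzEquiv (a b : B) : Prop := CuntzBelow a b ∧ CuntzBelow b a

/-- `A` is σ-unital: it has a countable (norm-bounded, positive) approximate unit. -/
def SigmaUnital (A : Type*) [NonUnitalCStarAlgebra A] : Prop :=
  ∃ e : ℕ → A, (∀ n, CStarNonneg (e n) ∧ ‖e n‖ ≤ 1) ∧
    ∀ a : A, Tendsto (fun n => e n * a) atTop (𝓝 a) ∧ Tendsto (fun n => a * e n) atTop (𝓝 a)

end CStar

/-- A closed two-sided (automatically star-closed) ideal of a C*-algebra. -/
structure ClosedTwoSidedIdealC (A : Type*) [NonUnitalCStarAlgebra A] where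
  carrier : NonUnitalStarSubalgebra ℂ A
  isClosed : IsClosed (carrier : Set A)
  mul_mem_left : ∀ a : A, ∀ x ∈ carrier, a * x ∈ carrier
  mul_mem_right : ∀ a : A, ∀ x ∈ carrier, x * a ∈ carrier

section Reps

variable {A : Type*} [NonUnitalCStarAlgebra A]
variable {H : Type*} [NormedAddCommGroup H] [InnerProductSpace ℂ H] [CompleteSpace H]

/-- A (topologically) irreducible representation of `A` on a Hilbert space `H`. -/
def IsIrreducibleRep (π : A →⋆ₙₐ[ℂ] (H →L[ℂ] H)) : Prop :=
  (∃ a : A, π a ≠ 0) ∧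
    ∀ K : Submodule ℂ H, IsClosed (K : Set H) → (∀ a : A, ∀ v ∈ K, π a v ∈ K) →
      K = ⊥ ∨ K = ⊤

end Reps

/-- `A` has a nonzero elementary ideal-quotient `J/I`, expressed via a surjection of a
closed two-sided ideal `J` of `A` onto the algebra of compact operators on a Hilbert
space (the kernel `I` of such a `*`-homomorphism is automatically a closed two-sided
ideal of `A`, and conversely any nonzero elementary ideal-quotient arises this way). -/
def HasNonzeroElementaryIdealQuotient (A : Type*) [NonUnitalCStarAlgebra A] : Prop :=
  ∃ (J : ClosedTwoSidedIdealC A) (H : Type) (_ : NormedAddCommGroup H)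
    (_ : InnerProductSpace ℂ H) (_ : CompleteSpace H)
    (ψ : J.carrier →⋆ₙₐ[ℂ] (H →L[ℂ] H)),
      Set.range ψ = {T : H →L[ℂ] H | IsCompactOperator ⇑T} ∧ ∃ x, ψ x ≠ 0

/-- A C*-algebra is nowhere scattered if no ideal-quotient of it is nonzero and
elementary. -/
def NowhereScattered (A : Type*) [NonUnitalCStarAlgebra A] : Prop :=
  ¬ HasNonzeroElementaryIdealQuotient A

/-- A C*-algebra is elementary if it is isomorphic to the algebra of compact operators
on some Hilbert space. -/
def IsElementaryCStar (A : Type*) [NonUnitalCStarAlgebra A] : Prop :=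
  ∃ (H : Type) (_ : NormedAddCommGroup H) (_ : InnerProductSpace ℂ H) (_ : CompleteSpace H)
    (ψ : A →⋆ₙₐ[ℂ] (H →L[ℂ] H)),
      Function.Injective ψ ∧ Set.range ψ = {T : H →L[ℂ] H | IsCompactOperator ⇑T}

/-- A C*-algebra is simple if it is nonzero and has no nontrivial closed two-sided
ideals. -/
def IsSimpleCStar (A : Type*) [NonUnitalCStarAlgebra A] : Prop :=
  (∃ a : A, a ≠ 0) ∧
    ∀ J : ClosedTwoSidedIdealC A, (J.carrier : Set A) = {0} ∨ (J.carrier : Set A) = Set.univ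

/-- Real rank zero: the invertible self-adjoint elements are dense in the self-adjoint
part of the minimal unitization. -/
def RealRankZero (A : Type*) [NonUnitalCStarAlgebra A] : Prop :=
  ∀ x : Unitization ℂ A, IsSelfAdjoint x →
    x ∈ closure {y : Unitization ℂ A | IsSelfAdjoint y ∧ IsUnit y}

/-- Stable rank one: the invertible elements are dense in the minimal unitization. -/
def StableRankOne (A : Type*) [NonUnitalCStarAlgebra A] : Prop :=
  ∀ x : Unitization ℂ A, x ∈ closure {y : Unitization ℂ A | IsUnit y}

section CP

variable {A B : Type*} [NonUnitalCStarAlgebra A] [NonUnitalCStarAlgebra B]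

/-- A linear map between C*-algebras is completely positive if all of its matrix
amplifications preserve positivity. -/
def IsCompletelyPositive (φ : A →ₗ[ℂ] B) : Prop :=
  ∀ (n : ℕ) (a : Matrix (Fin n) (Fin n) A), (∃ b : Matrix (Fin n) (Fin n) A, a = star b * b) →
    ∃ c : Matrix (Fin n) (Fin n) B, a.map ⇑φ = star c * c

/-- A completely positive contractive (c.p.c.) map. -/
def IsCPC (φ : A →ₗ[ℂ] B) : Prop :=
  IsCompletelyPositive φ ∧ ∀ a : A, ‖φ a‖ ≤ ‖a‖

/-- A map between C*-algebras has order zero if it preserves orthogonality of positive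
elements. -/
def IsOrderZero (φ : A →ₗ[ℂ] B) : Prop :=
  ∀ a b : A, CStarNonneg a → CStarNonneg b → a * b = 0 → φ a * φ b = 0

end CP

/-- `A` has nuclear dimension at most `k`: there are c.p.c. approximations of the
identity through finite dimensional C*-algebras in which the downwards maps are sums of
`k+1` c.p.c. order zero maps. -/
def NuclearDimLE (A : Type*) [NonUnitalCStarAlgebra A] (k : ℕ) : Prop :=
  ∀ (F : Finset A) (ε : ℝ), 0 < ε →
    ∃ (Fd : Type) (_ : NonUnitalCStarAlgebra Fd) (_ : FiniteDimensional ℂ Fd)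
      (ψ : A →ₗ[ℂ] Fd) (φ : Fin (k + 1) → (Fd →ₗ[ℂ] A)),
        IsCPC ψ ∧ (∀ i, IsCPC (φ i) ∧ IsOrderZero (φ i)) ∧
        ∀ a ∈ F, ‖(∑ i, φ i (ψ a)) - a‖ ≤ ε

section Prim

variable (A : Type*) [NonUnitalCStarAlgebra A]

/-- A primitive ideal: the kernel of an irreducible representation. -/
def IsPrimitiveIdeal {A : Type*} [NonUnitalCStarAlgebra A] (J : ClosedTwoSidedIdealC A) : Prop :=
  ∃ (H : Type) (_ : NormedAddCommGroup H) (_ : InnerProductSpace ℂ H) (_ : CompleteSpace H)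
    (π : A →⋆ₙₐ[ℂ] (H →L[ℂ] H)),
      IsIrreducibleRep π ∧ ∀ a : A, a ∈ J.carrier ↔ π a = 0

/-- The primitive ideal space of `A`. -/
def PrimIdealSpace := {J : ClosedTwoSidedIdealC A // IsPrimitiveIdeal J}

/-- The hull-kernel (Jacobson) topology on the primitive ideal space. -/
instance : TopologicalSpace (PrimIdealSpace A) :=
  TopologicalSpace.generateFrom {U | ∃ a : A, U = {P : PrimIdealSpace A | a ∉ P.1.carrier}}

/-- `A` has topological dimension zero: the primitive ideal space has a basis of
compact open sets. -/
def TopDimZero : Prop :=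
  ∃ 𝒷 : Set (Set (PrimIdealSpace A)), TopologicalSpace.IsTopologicalBasis 𝒷 ∧
    ∀ U ∈ 𝒷, IsCompact U ∧ IsOpen U

end Prim

section Proj

variable {B : Type*} [NonUnitalCStarAlgebra B]

/-- A projection in a C*-algebra. -/
def IsProjectionElem (p : B) : Prop := IsSelfAdjoint p ∧ p * p = p

/-- `B` contains an infinite projection: a projection which is Murray-von Neumann
equivalent to a proper subprojection of itself. -/
def HasInfiniteProjection (B : Type*) [NonUnitalCStarAlgebra B] : Prop :=
  ∃ p v : B, IsProjectionElem p ∧ star v * v = p ∧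
    p * (v * star v) = v * star v ∧ v * star v ≠ p

end Proj

/-! ### The Cuntz semigroup of a C*-algebra -/

/-- Padding a matrix by one extra row and column of zeros. -/
def matPad {A : Type*} [Zero A] {n : ℕ} (a : Matrix (Fin n) (Fin n) A) :
    Matrix (Fin (n + 1)) (Fin (n + 1)) A :=
  Matrix.of fun i j =>
    if h : (i : ℕ) < n ∧ (j : ℕ) < n then a ⟨i, h.1⟩ ⟨j, h.2⟩ else 0

/-- A witness that `S` is the Cuntz semigroup of the C*-algebra `A`: it provides a
stabilization `stab` of `A` (a model of `A ⊗ K`, described as the C*-completion of the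
union of the matrix algebras `Mₙ(A)`), together with the class map
`cls : (stab)₊ → S = Cu(A)` identifying `S` with the set of Cuntz equivalence classes of
positive elements of `A ⊗ K`, with order induced by Cuntz subequivalence, addition
induced by orthogonal (diagonal) addition, and with the compact containment relation
`≪` given by `x ≪ [a]` iff `x ≤ [(a - ε)₊]` for some `ε > 0`. -/
structure IsCuntzSemigroupOf (A : Type uu) [NonUnitalCStarAlgebra A]
    (S : Type vv) [CuSemigroup S] where
  stab : Type (max uu vv)
  [stabCStar : NonUnitalCStarAlgebra stab]
  matEmb : (n : ℕ) → (Matrix (Fin n) (Fin n) A →⋆ₙₐ[ℂ] stab)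
  matEmb_injective : ∀ n, Function.Injective (matEmb n)
  matEmb_compat : ∀ (n : ℕ) (a : Matrix (Fin n) (Fin n) A), matEmb (n + 1) (matPad a) = matEmb n a
  matEmb_dense : Dense (⋃ n, Set.range (matEmb n))
  cls : stab → S
  cls_zero : cls 0 = 0
  cls_surj : ∀ s : S, ∃ b : stab, CStarNonneg b ∧ cls b = s
  cls_le_iff : ∀ a b : stab, CStarNonneg a → CStarNonneg b → (cls a ≤ cls b ↔ CuntzBelow a b)
  cls_add_orth : ∀ a b : stab, CStarNonneg a → CStarNonneg b → a * b = 0 →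
    cls (a + b) = cls a + cls b
  exists_orth : ∀ a b : stab, CStarNonneg a → CStarNonneg b →
    ∃ a' b' : stab, CStarNonneg a' ∧ CStarNonneg b' ∧ a' * b' = 0 ∧
      cls a' = cls a ∧ cls b' = cls b
  waybelow_iff : ∀ (x : S) (a : stab), CStarNonneg a →
    (WayBelow x (cls a) ↔ ∃ ε : ℝ, 0 < ε ∧ x ≤ cls (cfcₙ (fun t : ℝ => max (t - ε) 0) a))

attribute [instance] IsCuntzSemigroupOf.stabCStar

/-- The Cuntz class `[a] ∈ Cu(A)` of an element `a` of `A` itself (via the canonical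
embedding `A ≅ M₁(A) ⊆ A ⊗ K`). -/
def IsCuntzSemigroupOf.clsA {A : Type*} [NonUnitalCStarAlgebra A] {S : Type*} [CuSemigroup S]
    (h : IsCuntzSemigroupOf A S) (a : A) : S :=
  h.cls (h.matEmb 1 (Matrix.of fun _ _ => a))

/-- `B` has a surjective rank map (every lower semicontinuous affine function on the
cone of functionals on `Cu(B)` is realized as a rank function). -/
def HasSurjectiveRankMap (B : Type*) [NonUnitalCStarAlgebra B] : Prop :=
  ∀ (S : Type) (inst : CuSemigroup S), IsCuntzSemigroupOf B S → CuDiv.SurjectiveRankMap S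

/-- The family of separable sub-C*-algebras of `A` having a surjective rank map. -/
def sepSurjRankFamily (A : Type*) [NonUnitalCStarAlgebra A] :
    Set (NonUnitalStarSubalgebra ℂ A) :=
  {B | ∃ _h : IsClosed (B : Set A),
    TopologicalSpace.SeparableSpace B ∧ HasSurjectiveRankMap B}

/-- The family of separable sub-C*-algebras of `A` with a surjective rank map is
σ-complete (closed under countable increasing unions) and cofinal (every separable
sub-C*-algebra is contained in a member). -/
def SepSurjRankFamilySigmaCompleteCofinal (A : Type*) [NonUnitalCStarAlgebra A] : Prop :=
  (∀ Bseq : ℕ → NonUnitalStarSubalgebra ℂ A, Monotone Bseq →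
    (∀ n, Bseq n ∈ sepSurjRankFamily A) →
      (⨆ n, Bseq n).topologicalClosure ∈ sepSurjRankFamily A) ∧
  (∀ C : NonUnitalStarSubalgebra ℂ A, IsClosed (C : Set A) →
    TopologicalSpace.SeparableSpace C → ∃ B ∈ sepSurjRankFamily A, C ≤ B)

end

section CuntzComparison

variable {D : Type*} [NonUnitalCStarAlgebra D]

lemma CuntzBelow.of_approx {a b : D} (h : ∀ ε : ℝ, 0 < ε → ∃ r : D, ‖r * b * star r - a‖ ≤ ε) :
    CuntzBelow a b := by
  choose r hr using fun n : ℕ => h (1 / ((n : ℝ) + 1)) (by positivity)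
  refine ⟨r, tendsto_iff_norm_sub_tendsto_zero.2 ?_⟩
  exact squeeze_zero (fun _ => norm_nonneg _) hr tendsto_one_div_add_atTop_nhds_zero_nat

lemma CuntzBelow.exists_approx {a b : D} (h : CuntzBelow a b) {ε : ℝ} (hε : 0 < ε) :
    ∃ r : D, ‖r * b * star r - a‖ ≤ ε := by
  obtain ⟨r, hr⟩ := h
  have := (tendsto_iff_norm_sub_tendsto_zero.1 hr).eventually (ge_mem_nhds hε)
  obtain ⟨n, hn⟩ := this.exists
  exact ⟨r n, hn⟩

lemma CuntzBelow.conj (r b : D) : CuntzBelow (r * b * star r) b :=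
  ⟨fun _ => r, tendsto_const_nhds⟩

lemma CuntzBelow.trans {a b c : D} (hab : CuntzBelow a b) (hbc : CuntzBelow b c) :
    CuntzBelow a c := by
  refine .of_approx fun ε hε => ?_
  obtain ⟨r, hr⟩ := hab.exists_approx (half_pos hε)
  have hpos : 0 < ‖r‖ * ‖r‖ + 1 := by positivity
  obtain ⟨s, hs⟩ := hbc.exists_approx (ε := ε / 2 / (‖r‖ * ‖r‖ + 1)) (by positivity)
  refine ⟨r * s, ?_⟩
  have key : r * s * c * star (r * s) - a
      = r * (s * c * star s - b) * star r + (r * b * star r - a) := by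
    rw [star_mul]; noncomm_ring
  have h1 : ‖r * (s * c * star s - b) * star r‖ ≤ ε / 2 := by
    calc ‖r * (s * c * star s - b) * star r‖
        ≤ ‖r‖ * ‖s * c * star s - b‖ * ‖star r‖ :=
          (norm_mul_le _ _).trans (mul_le_mul_of_nonneg_right (norm_mul_le _ _) (norm_nonneg _))
      _ = (‖r‖ * ‖r‖) * ‖s * c * star s - b‖ := by rw [norm_star]; ring
      _ ≤ (‖r‖ * ‖r‖ + 1) * (ε / 2 / (‖r‖ * ‖r‖ + 1)) := by gcongr; linarith
      _ = ε / 2 := by field_simp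
  rw [key]
  exact (norm_add_le _ _).trans (by linarith)

variable [PartialOrder D] [StarOrderedRing D]

lemma cstarNonneg_iff {a : D} : CStarNonneg a ↔ 0 ≤ a :=
  CStarAlgebra.nonneg_iff_eq_star_mul_self.symm

/-- The functions `t ↦ √t / (t + s)`, which invert `√t` approximately as `s → 0`. -/
lemma continuous_sqrt_div_abs_add {s : ℝ} (hs : 0 < s) :
    Continuous fun t : ℝ => √t / (|t| + s) := by
  refine Real.continuous_sqrt.div (by fun_prop) fun t => ?_
  have := abs_nonneg t
  positivity

lemma exists_approx_inverse {d : D} (hd : 0 ≤ d) {s : ℝ} (hs : 0 < s) :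
    ∃ g : D, star g = g ∧ Commute g d ∧ 0 ≤ g * d * g ∧
      ‖g * (d * d) * g - d‖ ≤ 2 * s ∧
      ‖d - g * d * g * d - d * (g * d * g) + g * d * g * d * (g * d * g)‖ ≤ 2 * s := by
  have hc := continuous_sqrt_div_abs_add hs
  set f : ℝ → ℝ := fun t => √t / (|t| + s) with hf
  have hf0 : f 0 = 0 := by simp [hf]
  have hspec : ∀ t ∈ quasispectrum ℝ d, 0 ≤ t := fun t ht =>
    quasispectrum_nonneg_of_nonneg d hd t ht
  have hsa : IsSelfAdjoint d := hd.isSelfAdjoint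
  have hbound : ∀ t : ℝ, 0 ≤ t → 0 ≤ f t * t * f t ∧ f t * t * f t ≤ 1 ∧
      t * (1 - f t * t * f t) ≤ 2 * s := by
    intro t ht
    have e : f t * t * f t = t ^ 2 / (t + s) ^ 2 := by
      have : √t * √t = t := Real.mul_self_sqrt ht
      simp only [hf, abs_of_nonneg ht]
      field_simp
      nlinarith
    have hts : 0 < t + s := by positivity
    rw [e]
    refine ⟨by positivity, ?_, ?_⟩
    · rw [div_le_one (by positivity)]; nlinarith
    · rw [show 1 - t ^ 2 / (t + s) ^ 2 = (2 * t * s + s ^ 2) / (t + s) ^ 2 by field_simp; ring,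
        ← mul_div_assoc, div_le_iff₀ (by positivity)]
      nlinarith [mul_nonneg ht hs.le, mul_nonneg (mul_nonneg ht hs.le) hs.le, pow_pos hs 3,
        mul_nonneg (mul_nonneg ht ht) hs.le]
  have hgdg : cfcₙ f d * d * cfcₙ f d = cfcₙ (fun t => f t * t * f t) d := by
    rw [cfcₙ_mul (fun t => f t * t) f d (by fun_prop) (by simp) (by fun_prop) hf0,
      cfcₙ_mul f (fun t => t) d (by fun_prop) hf0 (by fun_prop) rfl, cfcₙ_id' ℝ d]
  refine ⟨cfcₙ f d, (cfcₙ_predicate f d).star_eq, ?_, ?_, ?_, ?_⟩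
  · have := cfcₙ_commute_cfcₙ f (fun t => t) d
    rwa [cfcₙ_id' ℝ d] at this
  · rw [hgdg]
    exact cfcₙ_nonneg fun t ht => (hbound t (hspec t ht)).1
  · have : cfcₙ f d * (d * d) * cfcₙ f d - d = cfcₙ (fun t => f t * (t * t) * f t - t) d := by
      rw [cfcₙ_sub (fun t => f t * (t * t) * f t) (fun t => t) d (by fun_prop) (by simp)
          (by fun_prop) rfl,
        cfcₙ_mul (fun t => f t * (t * t)) f d (by fun_prop) (by simp) (by fun_prop) hf0,
        cfcₙ_mul f (fun t => t * t) d (by fun_prop) hf0 (by fun_prop) (by simp),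
        cfcₙ_mul (fun t => t) (fun t => t) d (by fun_prop) rfl (by fun_prop) rfl, cfcₙ_id' ℝ d]
    rw [this]
    refine norm_cfcₙ_le fun t ht => ?_
    have h0 := hspec t ht
    obtain ⟨h1, h2, h3⟩ := hbound t h0
    rw [Real.norm_eq_abs, abs_le]
    constructor <;> nlinarith
  · rw [hgdg]
    set k : ℝ → ℝ := fun t => f t * t * f t with hk
    have hkc : Continuous k := by fun_prop
    have hk0 : k 0 = 0 := by simp [hk]
    have : d - cfcₙ k d * d - d * cfcₙ k d + cfcₙ k d * d * cfcₙ k d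
        = cfcₙ (fun t => t - k t * t - t * k t + k t * t * k t) d := by
      rw [cfcₙ_add (fun t => t - k t * t - t * k t) (fun t => k t * t * k t) d (by fun_prop)
          (by simp) (by fun_prop) (by simp),
        cfcₙ_sub (fun t => t - k t * t) (fun t => t * k t) d (by fun_prop)
          (by simp) (by fun_prop) (by simp),
        cfcₙ_sub (fun t => t) (fun t => k t * t) d (by fun_prop)
          (by simp) (by fun_prop) (by simp),
        cfcₙ_mul (fun t => k t * t) k d (by fun_prop) (by simp) (by fun_prop) hk0,
        cfcₙ_mul k (fun t => t) d (by fun_prop) hk0 (by fun_prop) rfl,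
        cfcₙ_mul (fun t => t) k d (by fun_prop) rfl (by fun_prop) hk0, cfcₙ_id' ℝ d]
    rw [this]
    refine norm_cfcₙ_le fun t ht => ?_
    have h0 := hspec t ht
    obtain ⟨h1, h2, h3⟩ := hbound t h0
    have e : t - k t * t - t * k t + k t * t * k t = t * (1 - k t) * (1 - k t) := by ring
    change 0 ≤ k t at h1
    change k t ≤ 1 at h2
    change t * (1 - k t) ≤ 2 * s at h3
    rw [Real.norm_eq_abs, e, abs_le]
    constructor <;> nlinarith [mul_nonneg h0 (sub_nonneg.2 h2),
      mul_nonneg (mul_nonneg h0 (sub_nonneg.2 h2)) (sub_nonneg.2 h2)]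

lemma CuntzBelow.of_nonneg_mul_self {c : D} (hc : 0 ≤ c) : CuntzBelow c (c * c) := by
  refine .of_approx fun ε hε => ?_
  obtain ⟨g, hg, -, -, h, -⟩ := exists_approx_inverse hc (half_pos hε)
  exact ⟨g, by rw [hg]; linarith⟩

lemma conj_sub_mul_le {c d k : D} (hcd : c ≤ d) (hk : star k = k) :
    c - k * c - c * k + k * c * k ≤ d - k * d - d * k + k * d * k := by
  rw [← sub_nonneg]
  have h : 0 ≤ d - c := sub_nonneg.2 hcd
  have e : d - k * d - d * k + k * d * k - (c - k * c - c * k + k * c * k)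
      = (d - c) - k * (d - c) - (d - c) * k + k * (d - c) * k := by noncomm_ring
  rw [e]
  obtain ⟨y, hy⟩ := CStarAlgebra.nonneg_iff_eq_star_mul_self.1 h
  have : (d - c) - k * (d - c) - (d - c) * k + k * (d - c) * k
      = star (y - y * k) * (y - y * k) := by
    rw [hy, star_sub, star_mul, hk]; noncomm_ring
  rw [this]
  exact star_mul_self_nonneg _

lemma CuntzBelow.star_mul_self (y : D) : CuntzBelow (star y * y) (y * star y) := by
  refine (CuntzBelow.of_nonneg_mul_self (star_mul_self_nonneg y)).trans ?_
  have := CuntzBelow.conj (star y) (y * star y)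
  rwa [star_star, ← mul_assoc, mul_assoc] at this

lemma CuntzBelow.of_le {c d : D} (hc : 0 ≤ c) (hcd : c ≤ d) : CuntzBelow c d := by
  obtain ⟨y, hy⟩ := CStarAlgebra.nonneg_iff_eq_star_mul_self.1 hc
  have hcs := CuntzBelow.star_mul_self y
  rw [← hy] at hcs
  refine hcs.trans (.of_approx fun ε hε => ?_)
  have hpos : 0 < ‖y‖ + 1 := by positivity
  obtain ⟨g, hg, -, hk, -, h⟩ :=
    exists_approx_inverse (hc.trans hcd) (s := (ε / (‖y‖ + 1)) ^ 2 / 2) (by positivity)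
  set k := g * d * g with hkdef
  have hks : star k = k := hk.isSelfAdjoint.star_eq
  have h1 : ‖y - y * k‖ ≤ ε / (‖y‖ + 1) := by
    have e : star (y - y * k) * (y - y * k) = c - k * c - c * k + k * c * k := by
      rw [hy, star_sub, star_mul, hks]; noncomm_ring
    have h2 : ‖y - y * k‖ * ‖y - y * k‖ ≤ (ε / (‖y‖ + 1)) ^ 2 := by
      rw [← CStarRing.norm_star_mul_self, e]
      refine (CStarAlgebra.norm_le_norm_of_nonneg_of_le ?_ (conj_sub_mul_le hcd hks)).trans
        (h.trans (by linarith))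
      rw [← e]; exact star_mul_self_nonneg _
    nlinarith [norm_nonneg (y - y * k), show 0 < ε / (‖y‖ + 1) by positivity]
  refine ⟨y * g, ?_⟩
  have e : y * g * d * star (y * g) - y * star y = -((y - y * k) * star y) := by
    rw [star_mul, hg, hkdef]; noncomm_ring
  rw [e, norm_neg]
  calc ‖(y - y * k) * star y‖ ≤ ‖y - y * k‖ * ‖star y‖ := norm_mul_le _ _
    _ ≤ ε / (‖y‖ + 1) * (‖y‖ + 1) := by rw [norm_star]; gcongr; linarith
    _ = ε := by field_simp

lemma CuntzBelow.smul_self {c : D} (hc : 0 ≤ c) {C : ℝ} (hC : 0 ≤ C) : CuntzBelow (C • c) c := by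
  obtain ⟨y, hy⟩ := CStarAlgebra.nonneg_iff_eq_star_mul_self.1 hc
  have h1 : CuntzBelow (C • c) (C • (y * star y)) := by
    have := CuntzBelow.star_mul_self (√C • y)
    simpa only [star_smul, smul_mul_smul_comm, Real.mul_self_sqrt hC, ← hy, star_trivial] using this
  refine h1.trans ((CuntzBelow.of_nonneg_mul_self
    (smul_nonneg hC (mul_star_self_nonneg y))).trans ?_)
  have := CuntzBelow.conj (C • y) c
  rw [star_smul, star_trivial, hy, smul_mul_assoc, smul_mul_smul_comm] at this
  rw [smul_mul_smul_comm]
  convert this using 2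
  simp only [mul_assoc]

lemma CuntzBelow.of_nonneg_pow_three {c : D} (hc : 0 ≤ c) : CuntzBelow c (c * c * c) := by
  obtain ⟨s, hs, hsc⟩ : ∃ s : D, star s = s ∧ s * s = c :=
    ⟨CFC.sqrt c, (CFC.sqrt_nonneg c).isSelfAdjoint.star_eq, CFC.sqrt_mul_sqrt_self c hc⟩
  have h2 : 0 ≤ c * c := by
    have := star_mul_self_nonneg c
    rwa [hc.isSelfAdjoint.star_eq] at this
  refine (CuntzBelow.of_nonneg_mul_self hc).trans ((CuntzBelow.of_nonneg_mul_self h2).trans ?_)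
  have := CuntzBelow.conj s (c * c * c)
  convert this using 1
  rw [hs, ← hsc]; noncomm_ring

/-- The positive part `(a - ε)₊`. -/
noncomputable abbrev cutDown (ε : ℝ) (a : D) : D := cfcₙ (fun t : ℝ => max (t - ε) 0) a

lemma cutDown_nonneg (ε : ℝ) (a : D) : 0 ≤ cutDown ε a :=
  cfcₙ_nonneg fun _ _ => le_max_right _ _

lemma cutDown_isSelfAdjoint (ε : ℝ) (a : D) : IsSelfAdjoint (cutDown ε a) :=
  (cutDown_nonneg ε a).isSelfAdjoint

lemma norm_sub_cutDown_le {ε : ℝ} (hε : 0 ≤ ε) {a : D} (ha : 0 ≤ a) : ‖a - cutDown ε a‖ ≤ ε := by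
  have : a - cutDown ε a = cfcₙ (fun t : ℝ => t - max (t - ε) 0) a := by
    rw [cfcₙ_sub (fun t : ℝ => t) _ a (by fun_prop) rfl (by fun_prop) (by simpa using hε),
      cfcₙ_id' ℝ a]
  rw [this]
  refine norm_cfcₙ_le fun t ht => ?_
  have := quasispectrum_nonneg_of_nonneg a ha t ht
  rw [Real.norm_eq_abs, abs_le]
  rcases max_cases (t - ε) 0 with h | h <;> constructor <;> linarith [h.1, h.2]

lemma cutDown_conj_self {ε : ℝ} (hε : 0 ≤ ε) {a : D} (ha : 0 ≤ a) :
    cutDown ε a * a * cutDown ε a - ε • (cutDown ε a * cutDown ε a)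
      = cutDown ε a * cutDown ε a * cutDown ε a := by
  set f : ℝ → ℝ := fun t => max (t - ε) 0 with hf
  have hf0 : f 0 = 0 := by simpa [hf] using hε
  have hfc : Continuous f := by fun_prop
  change cfcₙ f a * a * cfcₙ f a - ε • (cfcₙ f a * cfcₙ f a) = cfcₙ f a * cfcₙ f a * cfcₙ f a
  have e1 : cfcₙ f a * a * cfcₙ f a = cfcₙ (fun t => f t * t * f t) a := by
    rw [cfcₙ_mul (fun t => f t * t) f a (by fun_prop) (by simp) (by fun_prop) hf0,
      cfcₙ_mul f (fun t => t) a (by fun_prop) hf0 (by fun_prop) rfl, cfcₙ_id' ℝ a]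
  have e2 : cfcₙ f a * cfcₙ f a = cfcₙ (fun t => f t * f t) a := by
    rw [cfcₙ_mul f f a (by fun_prop) hf0 (by fun_prop) hf0]
  have e3 : cfcₙ f a * cfcₙ f a * cfcₙ f a = cfcₙ (fun t => f t * f t * f t) a := by
    rw [cfcₙ_mul (fun t => f t * f t) f a (by fun_prop) (by simp [hf0]) (by fun_prop) hf0, e2]
  rw [e3, e1, e2, ← cfcₙ_smul ε (fun t => f t * f t) a (by fun_prop) (by simp [hf0]),
    ← cfcₙ_sub (fun t => f t * t * f t) (fun t => ε • (f t * f t)) a (by fun_prop) (by simp)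
      (by fun_prop) (by simp [hf0])]
  refine cfcₙ_congr fun t _ => ?_
  simp only [hf, smul_eq_mul]
  rcases max_cases (t - ε) 0 with h | h <;> rw [h.1] <;> ring

lemma conj_le_norm_smul_mul_self {g e : D} (hg : IsSelfAdjoint g) (he : IsSelfAdjoint e) :
    g * e * g ≤ ‖e‖ • (g * g) := by
  have := CStarAlgebra.star_left_conjugate_le_norm_smul (a := g) (b := e) (hb := he)
  rwa [hg.star_eq] at this

lemma CuntzBelow.cutDown_of_le_add {a b e : D} {ε : ℝ} (ha : 0 ≤ a)
    (he : IsSelfAdjoint e) (hab : a ≤ b + e) (heε : ‖e‖ ≤ ε) : CuntzBelow (cutDown ε a) b := by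
  have hε : 0 ≤ ε := (norm_nonneg e).trans heε
  set g := cutDown ε a with hgdef
  have hg : IsSelfAdjoint g := cutDown_isSelfAdjoint ε a
  have hgg : 0 ≤ g * g := by
    have := star_mul_self_nonneg g
    rwa [hg.star_eq] at this
  have h1 : g * g * g ≤ g * b * g := by
    rw [← cutDown_conj_self hε ha, sub_le_iff_le_add]
    have h2 : g * a * g ≤ g * (b + e) * g := by
      simpa [hg.star_eq] using star_left_conjugate_le_conjugate hab g
    have h3 : g * e * g ≤ ε • (g * g) :=
      (conj_le_norm_smul_mul_self hg he).trans (smul_le_smul_of_nonneg_right heε hgg)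
    calc g * a * g ≤ g * (b + e) * g := h2
      _ = g * b * g + g * e * g := by noncomm_ring
      _ ≤ _ := by gcongr
  have h0 : 0 ≤ g * g * g := by
    have := star_left_conjugate_nonneg (cutDown_nonneg ε a) g
    rwa [hg.star_eq] at this
  refine (CuntzBelow.of_nonneg_pow_three (cutDown_nonneg ε a)).trans
    ((CuntzBelow.of_le h0 h1).trans ?_)
  have := CuntzBelow.conj g b
  rwa [hg.star_eq] at this

end CuntzComparison

section CuntzSemigroup

lemma IsCuntzSemigroupOf.cls_le {A : Type*} [NonUnitalCStarAlgebra A] {S : Type*} [CuSemigroup S]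
    (hS : IsCuntzSemigroupOf A S) [PartialOrder hS.stab] [StarOrderedRing hS.stab]
    {a b : hS.stab} (ha : 0 ≤ a) (hb : 0 ≤ b) (h : CuntzBelow a b) : hS.cls a ≤ hS.cls b :=
  (hS.cls_le_iff a b (cstarNonneg_iff.2 ha) (cstarNonneg_iff.2 hb)).2 h

lemma CuSemigroup.add_le_add {S : Type*} [CuSemigroup S] {a b c d : S} (h : a ≤ b) (h' : c ≤ d) :
    a + c ≤ b + d :=
  (CuSemigroup.add_le_add' c d h' a).trans
    (by rw [add_comm a, add_comm b]; exact CuSemigroup.add_le_add' a b h d)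

lemma CuSemigroup.sum_le_sum {S : Type*} [CuSemigroup S] {ι : Type*} (s : Finset ι) {f g : ι → S}
    (h : ∀ i ∈ s, f i ≤ g i) : ∑ i ∈ s, f i ≤ ∑ i ∈ s, g i := by
  classical
  induction s using Finset.induction_on with
  | empty => simp
  | insert i s hi ih =>
    rw [Finset.sum_insert hi, Finset.sum_insert hi]
    exact CuSemigroup.add_le_add (h i (by simp)) (ih fun j hj => h j (by simp [hj]))

lemma CuSemigroup.nsmul_le_nsmul {S : Type*} [CuSemigroup S] (n : ℕ) {a b : S} (h : a ≤ b) :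
    n • a ≤ n • b := by
  have := CuSemigroup.sum_le_sum (Finset.range n) (f := fun _ => a) (g := fun _ => b)
    (fun _ _ => h)
  simpa using this

variable {A : Type*} [NonUnitalCStarAlgebra A] {S : Type*} [CuSemigroup S]
  (hS : IsCuntzSemigroupOf A S) [PartialOrder hS.stab] [StarOrderedRing hS.stab]

lemma IsCuntzSemigroupOf.cls_add_le {c d : hS.stab} (hc : 0 ≤ c) (hd : 0 ≤ d) :
    hS.cls (c + d) ≤ hS.cls c + hS.cls d := by
  obtain ⟨c', d', hc', hd', hcd, h1, h2⟩ :=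
    hS.exists_orth c d (cstarNonneg_iff.2 hc) (cstarNonneg_iff.2 hd)
  rw [← h1, ← h2, ← hS.cls_add_orth c' d' hc' hd' hcd]
  have hc0 := cstarNonneg_iff.1 hc'
  have hd0 := cstarNonneg_iff.1 hd'
  have hsc := hc0.isSelfAdjoint.star_eq
  have hsd := hd0.isSelfAdjoint.star_eq
  have hdc : d' * c' = 0 := by
    have := congrArg star hcd
    rwa [star_mul, hsc, hsd, star_zero] at this
  refine hS.cls_le (add_nonneg hc hd) (add_nonneg hc0 hd0) ?_
  have k1 : CuntzBelow c (c' * c' * c') :=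
    ((hS.cls_le_iff c c' (cstarNonneg_iff.2 hc) hc').1 h1.ge).trans (.of_nonneg_pow_three hc0)
  have k2 : CuntzBelow d (d' * d' * d') :=
    ((hS.cls_le_iff d d' (cstarNonneg_iff.2 hd) hd').1 h2.ge).trans (.of_nonneg_pow_three hd0)
  refine .of_approx fun ε hε => ?_
  obtain ⟨r, hr⟩ := k1.exists_approx (half_pos hε)
  obtain ⟨s, hs⟩ := k2.exists_approx (half_pos hε)
  refine ⟨r * c' + s * d', ?_⟩
  have e : (r * c' + s * d') * (c' + d') * star (r * c' + s * d') - (c + d)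
      = (r * (c' * c' * c') * star r - c) + (s * (d' * d' * d') * star s - d)
        + (r * c' * (c' * d') * star s + r * (c' * d') * c' * star r + r * (c' * d') * d' * star s
        + s * (d' * c') * c' * star r + s * (d' * c') * d' * star s
        + s * d' * (d' * c') * star r) := by
    rw [star_add, star_mul, star_mul, hsc, hsd]; noncomm_ring
  rw [e, hcd, hdc]
  simp only [mul_zero, zero_mul, add_zero]
  exact (norm_add_le _ _).trans (by linarith)

lemma IsCuntzSemigroupOf.cls_sum_le {ι : Type*} (s : Finset ι) {f : ι → hS.stab}
    (hf : ∀ i, 0 ≤ f i) : hS.cls (∑ i ∈ s, f i) ≤ ∑ i ∈ s, hS.cls (f i) := by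
  classical
  induction s using Finset.induction_on with
  | empty => simp [hS.cls_zero]
  | insert i s hi ih =>
    rw [Finset.sum_insert hi, Finset.sum_insert hi]
    exact (hS.cls_add_le (hf i) (Finset.sum_nonneg fun j _ => hf j)).trans
      (CuSemigroup.add_le_add le_rfl ih)

end CuntzSemigroup

section WeakDivisibility

variable {A : Type*} [NonUnitalCStarAlgebra A] {S : Type*} [CuSemigroup S]

lemma IsCuntzSemigroupOf.wayBelow_add_split (hS : IsCuntzSemigroupOf A S)
    {x z w : S} (h : WayBelow w (x + z)) :
    ∃ x' z', WayBelow x' x ∧ WayBelow z' z ∧ w ≤ x' + z' := by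
  let _ := CStarAlgebra.spectralOrder hS.stab
  have _ := CStarAlgebra.spectralOrderedRing hS.stab
  obtain ⟨a₀, ha₀, rfl⟩ := hS.cls_surj x
  obtain ⟨b₀, hb₀, rfl⟩ := hS.cls_surj z
  obtain ⟨a, b, ha', hb', hab, h1, h2⟩ := hS.exists_orth a₀ b₀ ha₀ hb₀
  rw [← h1, ← h2] at h ⊢
  have ha := cstarNonneg_iff.1 ha'
  have hb := cstarNonneg_iff.1 hb'
  rw [← hS.cls_add_orth a b ha' hb' hab,
    hS.waybelow_iff w _ (cstarNonneg_iff.2 (add_nonneg ha hb))] at h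
  obtain ⟨ε, hε, hw⟩ := h
  refine ⟨hS.cls (cutDown (ε / 2) a), hS.cls (cutDown (ε / 2) b),
    (hS.waybelow_iff _ a ha').2 ⟨ε / 2, half_pos hε, le_rfl⟩,
    (hS.waybelow_iff _ b hb').2 ⟨ε / 2, half_pos hε, le_rfl⟩, hw.trans ?_⟩
  refine le_trans ?_ (hS.cls_add_le (cutDown_nonneg _ a) (cutDown_nonneg _ b))
  refine hS.cls_le (cutDown_nonneg _ _) (add_nonneg (cutDown_nonneg _ _) (cutDown_nonneg _ _)) ?_
  refine CuntzBelow.cutDown_of_le_add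
    (e := (a - cutDown (ε / 2) a) + (b - cutDown (ε / 2) b)) (add_nonneg ha hb)
    ((ha.isSelfAdjoint.sub (cutDown_isSelfAdjoint _ _)).add
      (hb.isSelfAdjoint.sub (cutDown_isSelfAdjoint _ _))) (le_of_eq (by abel)) ?_
  have := norm_sub_cutDown_le (half_pos hε).le ha
  have := norm_sub_cutDown_le (half_pos hε).le hb
  exact (norm_add_le _ _).trans (by linarith)

lemma IsCuntzSemigroupOf.wayBelow_nsmul_split (hS : IsCuntzSemigroupOf A S)
    {x : S} (N : ℕ) {w : S}
    (h : WayBelow w (N • x)) : ∃ x' : Fin N → S, (∀ i, WayBelow (x' i) x) ∧ w ≤ ∑ i, x' i := by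
  induction N generalizing w with
  | zero =>
    rw [zero_smul] at h
    obtain ⟨n, hn⟩ := h (fun _ => 0) monotone_const 0 (by simp) le_rfl
    exact ⟨Fin.elim0, fun i => i.elim0, by simpa using hn⟩
  | succ N ih =>
    rw [add_smul, one_smul] at h
    obtain ⟨u, v, hu, hv, hw⟩ := hS.wayBelow_add_split h
    obtain ⟨x', hx', hux⟩ := ih hu
    refine ⟨Fin.snoc x' v, fun i => ?_, ?_⟩
    · refine Fin.lastCases ?_ (fun j => ?_) i
      · simpa using hv
      · simpa using hx' j
    · rw [Fin.sum_univ_castSucc]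
      simp only [Fin.snoc_castSucc, Fin.snoc_last]
      exact hw.trans (CuSemigroup.add_le_add hux le_rfl)

/-- Weak divisibility of an element passes to its multiples. -/
lemma IsCuntzSemigroupOf.isWeaklyDivisible_nsmul (hS : IsCuntzSemigroupOf A S)
    {x : S} {m n : ℕ} (N : ℕ)
    (h : CuDiv.IsWeaklyDivisible m n x) : CuDiv.IsWeaklyDivisible (N * m) (N * n) (N • x) := by
  intro w hw
  obtain ⟨x', hx', hwx⟩ := hS.wayBelow_nsmul_split N hw
  choose y hy hym using fun i => h (x' i) (hx' i)
  refine ⟨fun j => y (finProdFinEquiv.symm j).1 (finProdFinEquiv.symm j).2, ?_, fun j => ?_⟩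
  · rw [finProdFinEquiv.symm.sum_comp (fun p => y p.1 p.2), Fintype.sum_prod_type]
    exact hwx.trans (CuSemigroup.sum_le_sum _ fun i _ => hy i)
  · rw [mul_smul]
    exact CuSemigroup.nsmul_le_nsmul N (hym _ _)

lemma CuDiv.wdiv_le {x : S} {m n : ℕ} (hn : 1 ≤ n) (h : CuDiv.IsWeaklyDivisible m n x) :
    CuDiv.wdiv m x ≤ n :=
  sInf_le ⟨n, hn, rfl, h⟩

lemma IsCuntzSemigroupOf.wdiv_bound (hS : IsCuntzSemigroupOf A S)
    {k : ℕ}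
    (h : ∀ x : S, CuDiv.IsWeaklyDivisible 2 (4 * (k + 1)) x) :
    (∀ x : S, CuDiv.wdiv (4 * (k + 1)) ((2 * (k + 1)) • x) ≤ (8 * (k + 1) ^ 2 : ℕ)) ∧
    (∀ x : S, ∃ m : ℕ, 1 ≤ m ∧ CuDiv.wdiv (2 * m) (m • x) < ⊤) := by
  have key : ∀ x : S, CuDiv.wdiv (4 * (k + 1)) ((2 * (k + 1)) • x) ≤ (8 * (k + 1) ^ 2 : ℕ) := by
    intro x
    refine CuDiv.wdiv_le (Nat.one_le_iff_ne_zero.2 (by positivity)) ?_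
    convert hS.isWeaklyDivisible_nsmul (2 * (k + 1)) (h x) using 1 <;> ring
  refine ⟨key, fun x => ⟨2 * (k + 1), by omega, ?_⟩⟩
  have := key x
  rw [show 4 * (k + 1) = 2 * (2 * (k + 1)) by ring] at this
  exact this.trans_lt (ENat.natCast_lt_top _)

end WeakDivisibility

section StarHoms

open scoped CStarAlgebra

variable {D E : Type*} [NonUnitalCStarAlgebra D] [NonUnitalCStarAlgebra E]

lemma CuntzBelow.map (f : D →⋆ₙₐ[ℂ] E) {a b : D} (h : CuntzBelow a b) :
    CuntzBelow (f a) (f b) := by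
  obtain ⟨r, hr⟩ := h
  refine ⟨fun n => f (r n), ?_⟩
  have hf : Continuous f := map_continuous f
  have := (hf.tendsto a).comp hr
  simpa [Function.comp_def, map_mul, map_star] using this

lemma map_cutDown [PartialOrder D] [StarOrderedRing D] [PartialOrder E] [StarOrderedRing E]
    (f : D →⋆ₙₐ[ℂ] E) {ε : ℝ} (hε : 0 ≤ ε) {a : D} (ha : 0 ≤ a) :
    f (cutDown ε a) = cutDown ε (f a) :=
  NonUnitalStarAlgHom.map_cfcₙ f (fun t : ℝ => max (t - ε) 0) a (by fun_prop) (by simpa using hε)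
    (map_continuous f) ha.isSelfAdjoint (ha.isSelfAdjoint.map f)

lemma map_nonneg_of_starHom [PartialOrder D] [StarOrderedRing D] [PartialOrder E]
    [StarOrderedRing E] (f : D →⋆ₙₐ[ℂ] E) {a : D} (ha : 0 ≤ a) : 0 ≤ f a := by
  obtain ⟨y, rfl⟩ := CStarAlgebra.nonneg_iff_eq_star_mul_self.1 ha
  rw [map_mul, map_star]
  exact star_mul_self_nonneg _

end StarHoms

section MatrixReduction

variable {A : Type*} [NonUnitalCStarAlgebra A] {S : Type*} [CuSemigroup S]

/-- The embedding of the C⋆-algebra of matrices in the stabilization. -/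
noncomputable def IsCuntzSemigroupOf.cstarMatEmb (hS : IsCuntzSemigroupOf A S) (n : ℕ) :
    CStarMatrix (Fin n) (Fin n) A →⋆ₙₐ[ℂ] hS.stab where
  toFun a := hS.matEmb n (CStarMatrix.ofMatrix.symm a)
  map_smul' c a := map_smul (hS.matEmb n) c (CStarMatrix.ofMatrix.symm a)
  map_zero' := map_zero (hS.matEmb n)
  map_add' a b := map_add (hS.matEmb n) (CStarMatrix.ofMatrix.symm a) (CStarMatrix.ofMatrix.symm b)
  map_mul' a b := map_mul (hS.matEmb n) (CStarMatrix.ofMatrix.symm a) (CStarMatrix.ofMatrix.symm b)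
  map_star' a := map_star (hS.matEmb n) (CStarMatrix.ofMatrix.symm a)

lemma IsCuntzSemigroupOf.exists_cstarMatEmb_approx (hS : IsCuntzSemigroupOf A S)
    {a : hS.stab} (ha : CStarNonneg a) {ε : ℝ} (hε : 0 < ε) :
    ∃ (n : ℕ) (m : CStarMatrix (Fin n) (Fin n) A),
      ‖hS.cstarMatEmb n (star m * m) - a‖ ≤ ε := by
  obtain ⟨c, rfl⟩ := ha
  have hcont : Continuous fun x : hS.stab => ‖star x * x - star c * c‖ := by fun_prop
  have hopen : IsOpen {x : hS.stab | ‖star x * x - star c * c‖ < ε} :=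
    isOpen_lt hcont continuous_const
  obtain ⟨x, hx, hx'⟩ := hS.matEmb_dense.exists_mem_open hopen ⟨c, by simpa using hε⟩
  obtain ⟨n, m, rfl⟩ := Set.mem_iUnion.1 hx
  refine ⟨n, CStarMatrix.ofMatrix m, ?_⟩
  rw [map_mul, map_star]
  exact hx'.le

/-- A square zero element `v` gives two orthogonal equivalent elements `v * star v` and
`star v * v`. -/
lemma IsCuntzSemigroupOf.two_nsmul_cls (hS : IsCuntzSemigroupOf A S) {v : hS.stab}
    (hv : v * v = 0) :
    2 • hS.cls (v * star v) = hS.cls (v * star v + star v * v) := by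
  let _ := CStarAlgebra.spectralOrder hS.stab
  have _ := CStarAlgebra.spectralOrderedRing hS.stab
  have h1 : (v * star v) * (star v * v) = 0 := by
    have : star v * star v = 0 := by rw [← star_mul, hv, star_zero]
    rw [mul_assoc, ← mul_assoc (star v), this, zero_mul, mul_zero]
  rw [hS.cls_add_orth _ _ (cstarNonneg_iff.2 (mul_star_self_nonneg v))
    (cstarNonneg_iff.2 (star_mul_self_nonneg v)) h1, two_nsmul]
  congr 1
  apply le_antisymm
  · refine hS.cls_le (mul_star_self_nonneg v) (star_mul_self_nonneg v) ?_
    simpa using CuntzBelow.star_mul_self (star v)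
  · exact hS.cls_le (star_mul_self_nonneg v) (mul_star_self_nonneg v) (CuntzBelow.star_mul_self v)

lemma IsCuntzSemigroupOf.isWeaklyDivisible_two [PartialOrder A] [StarOrderedRing A]
    (hS : IsCuntzSemigroupOf A S) {N : ℕ}
    (h : ∀ (n : ℕ) (a : CStarMatrix (Fin n) (Fin n) A), 0 ≤ a → ∀ ε : ℝ, 0 < ε →
      ∃ v : Fin N → CStarMatrix (Fin n) (Fin n) A, (∀ j, v j * v j = 0) ∧
        (∀ j, CuntzBelow (v j * star (v j) + star (v j) * v j) a) ∧
        CuntzBelow (cutDown ε a) (∑ j, v j * star (v j))) (x : S) :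
    CuDiv.IsWeaklyDivisible 2 N x := by
  let _ := CStarAlgebra.spectralOrder hS.stab
  have _ := CStarAlgebra.spectralOrderedRing hS.stab
  intro w hw
  obtain ⟨a, ha', rfl⟩ := hS.cls_surj x
  have ha := cstarNonneg_iff.1 ha'
  obtain ⟨ε, hε, hwε⟩ := (hS.waybelow_iff w a ha').1 hw
  have hε3 : 0 < ε / 3 := by positivity
  obtain ⟨n, m, hm⟩ := hS.exists_cstarMatEmb_approx ha' hε3
  set f := hS.cstarMatEmb n with hf
  have hb : 0 ≤ star m * m := star_mul_self_nonneg m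
  set b := star m * m with hbdef
  have hfb : 0 ≤ f b := map_nonneg_of_starHom f hb
  obtain ⟨v, hv0, hva, hvs⟩ := h n (cutDown (ε / 3) b) (cutDown_nonneg _ _) (ε / 3) hε3
  refine ⟨fun j => hS.cls (f (v j) * star (f (v j))), ?_, fun j => ?_⟩
  · refine hwε.trans (le_trans ?_ (hS.cls_sum_le _ fun j => mul_star_self_nonneg _))
    have h1 := hvs.map f
    rw [map_cutDown f hε3.le (cutDown_nonneg _ _), map_cutDown f hε3.le hb, map_sum] at h1
    simp only [map_mul, map_star] at h1
    refine hS.cls_le (cutDown_nonneg _ _)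
      (Finset.sum_nonneg fun j _ => mul_star_self_nonneg _) (CuntzBelow.trans ?_ h1)
    set b₁ := cutDown (ε / 3) (f b)
    have hb₁ : 0 ≤ b₁ := cutDown_nonneg _ _
    refine CuntzBelow.cutDown_of_le_add
      (e := (a - f b) + (f b - b₁) + (b₁ - cutDown (ε / 3) b₁)) ha
      (((ha.isSelfAdjoint.sub hfb.isSelfAdjoint).add
        (hfb.isSelfAdjoint.sub hb₁.isSelfAdjoint)).add
        (hb₁.isSelfAdjoint.sub (cutDown_isSelfAdjoint _ _))) (le_of_eq (by abel)) ?_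
    have k1 : ‖a - f b‖ ≤ ε / 3 := by rwa [norm_sub_rev]
    have k2 : ‖f b - b₁‖ ≤ ε / 3 := norm_sub_cutDown_le hε3.le hfb
    have k3 : ‖b₁ - cutDown (ε / 3) b₁‖ ≤ ε / 3 := norm_sub_cutDown_le hε3.le hb₁
    exact (norm_add₃_le).trans (by linarith)
  · have hv : f (v j) * f (v j) = 0 := by rw [← map_mul, hv0, map_zero]
    rw [hS.two_nsmul_cls hv]
    have h1 := (hva j).map f
    rw [map_cutDown f hε3.le hb] at h1
    simp only [map_mul, map_add, map_star] at h1
    refine hS.cls_le (add_nonneg (mul_star_self_nonneg _) (star_mul_self_nonneg _)) ha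
      (h1.trans ?_)
    refine CuntzBelow.cutDown_of_le_add (e := f b - a) hfb
      (hfb.isSelfAdjoint.sub ha.isSelfAdjoint) (le_of_eq (by abel)) hm

end MatrixReduction

section ClosedRange

open scoped CStarAlgebra

variable {D E : Type*} [NonUnitalCStarAlgebra D] [NonUnitalCStarAlgebra E]

lemma exists_selfAdjoint_lift_norm_le (π : D →⋆ₙₐ[ℂ] E) {x : D} (hx : IsSelfAdjoint x) :
    ∃ z : D, π z = π x ∧ ‖z‖ ≤ ‖π x‖ := by
  set c := ‖π x‖ with hc
  have hc0 : 0 ≤ c := norm_nonneg _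
  have hcont : Continuous π := map_continuous π
  let f : ℝ → ℝ := fun t => max (-c) (min t c)
  have hf0 : f 0 = 0 := by simp [f, hc0]
  refine ⟨cfcₙ f x, ?_, ?_⟩
  · rw [NonUnitalStarAlgHom.map_cfcₙ π f x (by fun_prop) hf0 hcont hx (hx.map π)]
    conv_rhs => rw [← cfcₙ_id' ℝ (π x) (hx.map π)]
    refine cfcₙ_congr fun t ht => ?_
    have hx' : IsSelfAdjoint (π x) := hx.map π
    have h := norm_apply_le_norm_cfcₙ (fun t : ℝ => t) (π x) ht
    rw [cfcₙ_id' ℝ (π x), Real.norm_eq_abs, abs_le] at h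
    simp only [f]
    rw [min_eq_left h.2, max_eq_right h.1]
  · refine norm_cfcₙ_le fun t _ => ?_
    rw [Real.norm_eq_abs, abs_le]
    exact ⟨le_max_left _ _, max_le (by linarith) (min_le_right _ _)⟩

lemma exists_lift_norm_le (π : D →⋆ₙₐ[ℂ] E) (x : D) : ∃ z : D, π z = π x ∧ ‖z‖ ≤ 2 * ‖π x‖ := by
  have hr : π (realPart x : D) = realPart (π x) := by
    simp [realPart_apply_coe, map_star, ← Complex.coe_smul]
  have hi : π (imaginaryPart x : D) = imaginaryPart (π x) := by
    simp [imaginaryPart_apply_coe, map_star, ← Complex.coe_smul]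
  obtain ⟨z₁, h₁, n₁⟩ := exists_selfAdjoint_lift_norm_le π (realPart x).2
  obtain ⟨z₂, h₂, n₂⟩ := exists_selfAdjoint_lift_norm_le π (imaginaryPart x).2
  refine ⟨z₁ + Complex.I • z₂, ?_, ?_⟩
  · rw [map_add, map_smul, h₁, h₂, ← map_smul, ← map_add, realPart_add_I_smul_imaginaryPart]
  · have k1 : ‖z₁‖ ≤ ‖π x‖ := n₁.trans (by rw [hr]; exact realPart.norm_le (π x))
    have k2 : ‖z₂‖ ≤ ‖π x‖ := n₂.trans (by rw [hi]; exact imaginaryPart.norm_le (π x))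
    have : ‖Complex.I • z₂‖ = ‖z₂‖ := by rw [norm_smul, Complex.norm_I, one_mul]
    exact (norm_add_le _ _).trans (by linarith)

/-- The range of a star homomorphism between C⋆-algebras is closed. -/
lemma NonUnitalStarAlgHom.isClosed_range (π : D →⋆ₙₐ[ℂ] E) : IsClosed (Set.range π) := by
  let f : NormedAddGroupHom D E :=
    { toFun := π, map_add' := map_add π,
      bound' := ⟨1, fun x => by simpa using NonUnitalStarAlgHom.norm_apply_le π x⟩ }
  have h : f.SurjectiveOnWith f.range 2 := by
    rintro _ ⟨x, rfl⟩
    exact exists_lift_norm_le π x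
  have h' := controlled_closure_of_complete two_pos one_pos h
  refine isClosed_of_closure_subset fun y hy => ?_
  obtain ⟨z, hz, -⟩ := h' y (by
    rw [← SetLike.mem_coe, AddSubgroup.topologicalClosure_coe]
    exact closure_mono (by rintro _ ⟨x, rfl⟩; exact ⟨x, rfl⟩) hy)
  exact ⟨z, hz⟩

end ClosedRange

section CompactOperators

open InnerProductSpace

variable {H : Type*} [NormedAddCommGroup H] [InnerProductSpace ℂ H]

lemma isCompactOperator_rankOne (x y : H) : IsCompactOperator ⇑(rankOne ℂ x y : H →L[ℂ] H) := by
  rw [rankOne_def']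
  have : IsCompactOperator (ContinuousLinearMap.toSpanSingleton ℂ x : ℂ →L[ℂ] H) :=
    isCompactOperator_of_locallyCompactSpace_rng _
  exact this.comp_clm (innerSL ℂ y)

variable [CompleteSpace H]

/-- Compact operators are norm limits of finite sums of rank one operators. -/
lemma IsCompactOperator.mem_closure_span_rankOne {T : H →L[ℂ] H} (hT : IsCompactOperator ⇑T) :
    T ∈ closure (Submodule.span ℂ {R : H →L[ℂ] H | ∃ x y, R = rankOne ℂ x y} : Set (H →L[ℂ] H)) := by
  rw [Metric.mem_closure_iff]
  intro ε hε
  have hcpt := hT.isCompact_closure_image_closedBall (𝕜₁ := ℂ) (f := T.toLinearMap) 1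
  obtain ⟨s, hs, hcov⟩ := Metric.totallyBounded_iff.1 hcpt.totallyBounded (ε / 2) (half_pos hε)
  let U : Submodule ℂ H := Submodule.span ℂ s
  have : FiniteDimensional ℂ U := FiniteDimensional.span_of_finite ℂ hs
  let b := stdOrthonormalBasis ℂ U
  let P : H →L[ℂ] H := U.starProjection
  refine ⟨P ∘L T, ?_, ?_⟩
  · have : P ∘L T = ∑ i, rankOne ℂ (b i : H) (ContinuousLinearMap.adjoint T (b i)) := by
      simp only [P, b.starProjection_eq_sum_rankOne, ContinuousLinearMap.finsetSum_comp, rankOne_comp]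
    rw [this]
    exact Submodule.sum_mem _ fun i _ => Submodule.subset_span ⟨_, _, rfl⟩
  · rw [dist_eq_norm]
    refine lt_of_le_of_lt ?_ (half_lt_self hε)
    refine ContinuousLinearMap.opNorm_le_of_unit_norm (by positivity) fun x hx => ?_
    have hTx : T x ∈ closure (T.toLinearMap '' Metric.closedBall 0 1) :=
      subset_closure ⟨x, by simp [hx], rfl⟩
    obtain ⟨y, hy, hxy⟩ := Set.mem_iUnion₂.1 (hcov hTx)
    rw [Metric.mem_ball, dist_eq_norm] at hxy
    have hmin : ‖T x - P (T x)‖ ≤ ‖T x - y‖ := by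
      rw [show ‖T x - P (T x)‖ = _ from Submodule.starProjection_minimal (U := U) (T x)]
      exact ciInf_le ⟨0, by rintro _ ⟨z, rfl⟩; exact norm_nonneg _⟩
        (⟨y, Submodule.subset_span hy⟩ : U)
    exact hmin.trans hxy.le

lemma isCompactOperator_iff_mem_closure_span_rankOne {T : H →L[ℂ] H} :
    IsCompactOperator ⇑T ↔ T ∈ closure
      (Submodule.span ℂ {R : H →L[ℂ] H | ∃ x y, R = rankOne ℂ x y} : Set (H →L[ℂ] H)) := by
  refine ⟨fun h => h.mem_closure_span_rankOne, fun h => ?_⟩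
  have hcl : IsClosed {f : H →L[ℂ] H | IsCompactOperator f} := isClosed_setOfPred_isCompactOperator
  refine hcl.closure_subset_iff.2 (fun R hR => ?_) h
  refine Submodule.span_induction ?_ ?_ ?_ ?_ hR
  · rintro _ ⟨x, y, rfl⟩
    exact isCompactOperator_rankOne x y
  · exact isCompactOperator_zero
  · exact fun x y _ _ hx hy => hx.add hy
  · exact fun c x _ hx => hx.smul c

lemma IsCompactOperator.star {T : H →L[ℂ] H} (hT : IsCompactOperator ⇑T) :
    IsCompactOperator ⇑(star T) := by
  rw [isCompactOperator_iff_mem_closure_span_rankOne] at hT ⊢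
  refine map_mem_closure continuous_star hT fun R hR => ?_
  refine Submodule.span_induction ?_ ?_ ?_ ?_ hR
  · rintro _ ⟨x, y, rfl⟩
    exact Submodule.subset_span ⟨y, x, by simp [ContinuousLinearMap.star_eq_adjoint]⟩
  · simp
  · intro x y _ _ hx hy
    rw [star_add]
    exact Submodule.add_mem _ hx hy
  · intro c x _ hx
    rw [star_smul]
    exact Submodule.smul_mem _ _ hx

end CompactOperators

section ElementaryQuotient

open InnerProductSpace
open scoped CStarAlgebra ComplexOrder

variable {A : Type} [NonUnitalCStarAlgebra A]

/-- The ideal of elements acting as compact operators. -/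
noncomputable def compactIdeal {H : Type*} [NormedAddCommGroup H] [InnerProductSpace ℂ H]
    [CompleteSpace H] (π : A →⋆ₙₐ[ℂ] (H →L[ℂ] H)) : ClosedTwoSidedIdealC A where
  carrier :=
    { carrier := {a | IsCompactOperator ⇑(π a)}
      add_mem' := fun {a b} ha hb => by
        simp only [Set.mem_ofPred_eq, map_add] at *; exact ha.add hb
      zero_mem' := by
        simp only [Set.mem_ofPred_eq, map_zero]; exact isCompactOperator_zero
      mul_mem' := fun {a b} ha _ => by
        simp only [Set.mem_ofPred_eq, map_mul] at *; exact ha.comp_clm (π b)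
      smul_mem' := fun c a ha => by
        simp only [Set.mem_ofPred_eq, map_smul] at *; exact ha.smul c
      star_mem' := fun {a} ha => by
        simp only [Set.mem_ofPred_eq, map_star] at *; exact ha.star }
  isClosed := by
    have hcl : IsClosed {f : H →L[ℂ] H | IsCompactOperator f} :=
      isClosed_setOfPred_isCompactOperator
    have hπ : Continuous π := map_continuous π
    exact hcl.preimage hπ
  mul_mem_left a x hx := by
    change IsCompactOperator ⇑(π (a * x))
    rw [map_mul]
    exact IsCompactOperator.clm_comp (f := π x) hx (π a)
  mul_mem_right a x hx := by
    change IsCompactOperator ⇑(π (x * a))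
    rw [map_mul]
    exact IsCompactOperator.comp_clm (f := π x) hx (π a)

lemma hasNonzeroElementaryIdealQuotient_of_rep {H : Type} [NormedAddCommGroup H]
    [InnerProductSpace ℂ H] [CompleteSpace H] (π : A →⋆ₙₐ[ℂ] (H →L[ℂ] H)) {s : Set H}
    (hs : Dense s) (h : ∀ x ∈ s, ∀ y ∈ s, rankOne ℂ x y ∈ Set.range π) (hne : ∃ x : H, x ≠ 0) :
    HasNonzeroElementaryIdealQuotient A := by
  have hcl := π.isClosed_range
  have hrank : ∀ x y : H, rankOne ℂ x y ∈ Set.range π := by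
    intro x y
    have h1 : ∀ x ∈ s, ∀ y : H, rankOne ℂ x y ∈ Set.range π := fun x hx y => by
      have := map_mem_closure (rankOne ℂ x : H →L⋆[ℂ] (H →L[ℂ] H)).continuous (hs y) (h x hx)
      rwa [hcl.closure_eq] at this
    have h2 : ∀ y ∈ s, rankOne ℂ x y ∈ Set.range π := fun y hy => by
      obtain ⟨a, ha⟩ := h1 y hy x
      refine ⟨star a, ?_⟩
      rw [map_star, ha, ContinuousLinearMap.star_eq_adjoint, adjoint_rankOne]
    have := map_mem_closure (rankOne ℂ x : H →L⋆[ℂ] (H →L[ℂ] H)).continuous (hs y) h2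
    rwa [hcl.closure_eq] at this
  have hall : ∀ T : H →L[ℂ] H, IsCompactOperator ⇑T → T ∈ Set.range π := by
    intro T hT
    have h1 := hT.mem_closure_span_rankOne
    refine hcl.closure_subset_iff.2 (fun R hR => ?_) h1
    refine Submodule.span_induction ?_ ?_ ?_ ?_ hR
    · rintro _ ⟨x, y, rfl⟩
      exact hrank x y
    · exact ⟨0, map_zero π⟩
    · rintro _ _ _ _ ⟨a, rfl⟩ ⟨b, rfl⟩
      exact ⟨a + b, map_add π a b⟩
    · rintro c _ _ ⟨a, rfl⟩
      exact ⟨c • a, map_smul π c a⟩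
  refine ⟨compactIdeal π, H, inferInstance, inferInstance, inferInstance,
    π.comp (NonUnitalStarSubalgebraClass.subtype _), ?_, ?_⟩
  · ext T
    constructor
    · rintro ⟨a, rfl⟩
      exact a.2
    · intro hT
      obtain ⟨a, rfl⟩ := hall T hT
      exact ⟨⟨a, hT⟩, rfl⟩
  · obtain ⟨x, hx⟩ := hne
    obtain ⟨a, ha⟩ := hrank x x
    refine ⟨⟨a, ?_⟩, ?_⟩
    · change IsCompactOperator ⇑(π a)
      rw [ha]; exact isCompactOperator_rankOne x x
    · change π a ≠ 0
      rw [ha]; simpa using hx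

lemma hasNonzeroElementaryIdealQuotient_of_functional [PartialOrder A] [StarOrderedRing A]
    (ω : A →ₚ[ℂ] ℂ) (t : A) {c : ℂ} (hc : c ≠ 0)
    (h : ∀ s s' : A, ω (s' * t * s) = c * (ω s' * ω s)) {s₀ : A} (hs₀ : ω s₀ ≠ 0) :
    HasNonzeroElementaryIdealQuotient A := by
  have hdense : DenseRange ((↑) : ω.PreGNS → ω.GNS) := UniformSpace.Completion.denseRange_coe
  have hinner : ∀ a b d : A, inner ℂ (ω.toPreGNS a : ω.GNS)
      (ω.gnsNonUnitalStarAlgHom d (ω.toPreGNS b : ω.GNS)) = ω (star a * d * b) := by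
    intro a b d
    rw [PositiveLinearMap.gnsNonUnitalStarAlgHom_apply_coe, UniformSpace.Completion.inner_coe,
      PositiveLinearMap.preGNS_inner_def, mul_assoc]
    rfl
  have hinner' : ∀ a b : A, inner ℂ (ω.toPreGNS a : ω.GNS) (ω.toPreGNS b : ω.GNS)
      = ω (star a * b) := by
    intro a b
    rw [UniformSpace.Completion.inner_coe, PositiveLinearMap.preGNS_inner_def]
    rfl
  refine hasNonzeroElementaryIdealQuotient_of_rep ω.gnsNonUnitalStarAlgHom
    (s := Set.range ((↑) : ω.PreGNS → ω.GNS)) hdense ?_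
    ⟨(ω.toPreGNS s₀ : ω.GNS), fun h0 => ?_⟩
  · rintro _ ⟨x, rfl⟩ _ ⟨y, rfl⟩
    obtain ⟨x, rfl⟩ := ω.toPreGNS.surjective x
    obtain ⟨y, rfl⟩ := ω.toPreGNS.surjective y
    refine ⟨c⁻¹ • (x * t * star y), ?_⟩
    rw [map_smul, inv_smul_eq_iff₀ hc]
    refine ContinuousLinearMap.ext fun v => congrFun (hdense.equalizer
      (ContinuousLinearMap.continuous _) (ContinuousLinearMap.continuous _) ?_) v
    ext v
    obtain ⟨v, rfl⟩ := ω.toPreGNS.surjective v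
    refine hdense.eq_of_inner_right ℂ fun w => ?_
    obtain ⟨w, rfl⟩ := ω.toPreGNS.surjective w
    have h1 := h (star y * v) (star w * x)
    simp only [Function.comp_apply, smul_apply, rankOne_apply,
      inner_smul_right, hinner, hinner']
    simp only [mul_assoc] at h1 ⊢
    rw [h1]; ring
  · have h2 := hinner (star s₀) s₀ t
    rw [h0, map_zero, inner_zero_right, star_star, h] at h2
    exact mul_ne_zero hc (mul_ne_zero hs₀ hs₀) h2.symm

end ElementaryQuotient

section PositiveFunctionals

open scoped ComplexOrder

variable {D : Type*} [NonUnitalCStarAlgebra D] [PartialOrder D] [StarOrderedRing D]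

lemma PositiveLinearMap.apply_star_mul_eq_zero (ρ : D →ₚ[ℂ] ℂ) {x : D} (hx : ρ (star x * x) = 0)
    (y : D) : ρ (star x * y) = 0 := by
  have h := norm_inner_le_norm (𝕜 := ℂ) (ρ.toPreGNS x) (ρ.toPreGNS y)
  have h0 : ‖ρ.toPreGNS x‖ = 0 := by
    rw [PositiveLinearMap.preGNS_norm_def]
    change √(ρ (star x * x)).re = 0
    rw [hx]; simp
  rw [h0, zero_mul] at h
  exact norm_eq_zero.1 (le_antisymm h (norm_nonneg _))

lemma PositiveLinearMap.apply_mul_eq_zero (ρ : D →ₚ[ℂ] ℂ) {x : D} (hx : ρ (star x * x) = 0)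
    (y : D) : ρ (y * x) = 0 := by
  have h := norm_inner_le_norm (𝕜 := ℂ) (ρ.toPreGNS (star y)) (ρ.toPreGNS x)
  have h0 : ‖ρ.toPreGNS x‖ = 0 := by
    rw [PositiveLinearMap.preGNS_norm_def]
    change √(ρ (star x * x)).re = 0
    rw [hx]; simp
  rw [h0, mul_zero] at h
  have h1 : ρ (star (star y) * x) = 0 := norm_eq_zero.1 (le_antisymm h (norm_nonneg _))
  rwa [star_star] at h1

lemma cutDown_le_smul_mul_self {ε : ℝ} (hε : 0 < ε) {a : D} (ha : 0 ≤ a) :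
    cutDown ε a ≤ ε⁻¹ • (a * a) := by
  have h1 : ε⁻¹ • (a * a) = cfcₙ (fun t : ℝ => ε⁻¹ • (t * t)) a := by
    rw [cfcₙ_smul (R := ℝ) ε⁻¹ (fun t => t * t) a, cfcₙ_mul (fun t : ℝ => t) (fun t => t) a,
      cfcₙ_id' ℝ a]
  rw [h1]
  refine cfcₙ_mono (fun t ht => ?_) (by fun_prop) (by fun_prop) (by simpa using hε.le) (by simp)
  have ht0 := quasispectrum_nonneg_of_nonneg a ha t ht
  rw [smul_eq_mul]
  refine max_le ?_ (by positivity)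
  rw [inv_mul_eq_div, le_div_iff₀ hε]
  nlinarith [sq_nonneg (t - ε), mul_nonneg ht0 hε.le]

lemma PositiveLinearMap.apply_mul_self_ne_zero (ρ : D →ₚ[ℂ] ℂ) {a : D} (ha : 0 ≤ a)
    (h : ρ a ≠ 0) : ρ (a * a) ≠ 0 := by
  intro h0
  apply h
  obtain ⟨C, hC⟩ := ρ.exists_norm_apply_le
  refine norm_eq_zero.1 (le_antisymm (le_of_forall_pos_le_add fun ε hε => ?_) (norm_nonneg _))
  have hδ : 0 < ε / (C + 1) := by positivity
  set δ := ε / (C + 1) with hδ'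
  have h1 : ρ (cutDown δ a) = 0 := by
    refine le_antisymm ?_ (map_nonneg ρ (cutDown_nonneg _ _))
    have := OrderHomClass.mono ρ (cutDown_le_smul_mul_self hδ ha)
    rwa [← Complex.coe_smul, map_smul, h0, smul_zero] at this
  have h2 := hC (a - cutDown δ a)
  rw [map_sub, h1, sub_zero] at h2
  calc ‖ρ a‖ ≤ C * ‖a - cutDown δ a‖ := h2
    _ ≤ C * δ := by gcongr; exact norm_sub_cutDown_le hδ.le ha
    _ ≤ 0 + ε := by
      rw [hδ', zero_add, ← mul_div_assoc, div_le_iff₀ (by positivity)]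
      nlinarith [C.2]

lemma PositiveLinearMap.apply_pow_three_ne_zero (ρ : D →ₚ[ℂ] ℂ) {a : D} (ha : 0 ≤ a)
    (h : ρ a ≠ 0) : ρ (a * a * a) ≠ 0 := by
  have h2 := ρ.apply_mul_self_ne_zero ha h
  have ha2 : 0 ≤ a * a := by simpa [ha.isSelfAdjoint.star_eq] using star_mul_self_nonneg a
  have h4 := ρ.apply_mul_self_ne_zero ha2 h2
  intro h3
  apply h4
  have hs : star (CFC.sqrt a) = CFC.sqrt a := (CFC.sqrt_nonneg a).isSelfAdjoint
  have hss : CFC.sqrt a * CFC.sqrt a = a := CFC.sqrt_mul_sqrt_self a ha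
  have h5 : ρ (star (CFC.sqrt a * a) * (CFC.sqrt a * a)) = 0 := by
    rw [← h3, star_mul, hs, ha.isSelfAdjoint.star_eq]
    congr 1
    conv_rhs => enter [1, 2]; rw [← hss]
    noncomm_ring
  have h6 := ρ.apply_star_mul_eq_zero h5 (CFC.sqrt a * a * a)
  rw [← h6, star_mul, hs, ha.isSelfAdjoint.star_eq]
  congr 1
  conv_lhs => enter [1, 2]; rw [← hss]
  noncomm_ring

lemma PositiveLinearMap.apply_mul_self_eq_zero_of_parts (ρ : D →ₚ[ℂ] ℂ) {w : D}
    (hw : IsSelfAdjoint w) (h0 : ρ w = 0) (h : ρ w⁺ * ρ w⁻ = 0) : ρ (w * w) = 0 := by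
  have hsub : w = w⁺ - w⁻ := (CFC.posPart_sub_negPart w).symm
  have heq : ρ w⁺ = ρ w⁻ := by
    have : ρ (w⁺ - w⁻) = 0 := hsub ▸ h0
    rwa [map_sub, sub_eq_zero] at this
  have key : ∀ c : D, 0 ≤ c → ρ c = 0 → ρ (c * c) = 0 := by
    intro c hc hc0
    have hs : star (CFC.sqrt c) = CFC.sqrt c := (CFC.sqrt_nonneg c).isSelfAdjoint
    have hss : CFC.sqrt c * CFC.sqrt c = c := CFC.sqrt_mul_sqrt_self c hc
    have := ρ.apply_star_mul_eq_zero (x := CFC.sqrt c) (by rw [hs, hss, hc0]) (CFC.sqrt c * c)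
    rwa [hs, ← mul_assoc, hss] at this
  have hp : ρ w⁺ = 0 := by
    rw [← heq] at h; exact mul_self_eq_zero.1 h
  have hn : ρ w⁻ = 0 := heq ▸ hp
  have h2 : w * w = w⁺ * w⁺ + w⁻ * w⁻ := by
    conv_lhs => rw [hsub]
    rw [sub_mul, mul_sub, mul_sub, CFC.posPart_mul_negPart, CFC.negPart_mul_posPart]
    abel
  rw [h2, map_add, key _ (CFC.posPart_nonneg w) hp, key _ (CFC.negPart_nonneg w) hn, add_zero]

section Corner

variable (ρ : D →ₚ[ℂ] ℂ) {a : D}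

lemma PositiveLinearMap.corner_apply_eq (ha : 0 ≤ a) (hρ : ρ a ≠ 0)
    (h : ∀ z c d : D, IsSelfAdjoint z → 0 ≤ c → 0 ≤ d → c * d = 0 → c - d = a * z * a →
      ρ c * ρ d = 0) (z y : D) :
    ρ (a * z * a * y) * ρ (a * a * a) = ρ (a * z * a) * ρ (a * a * a * y) ∧
      ρ (y * (a * z * a)) * ρ (a * a * a) = ρ (a * z * a) * ρ (y * (a * a * a)) := by
  have hu := ρ.apply_pow_three_ne_zero ha hρ
  have hsa : star a = a := ha.isSelfAdjoint
  have key : ∀ z : D, IsSelfAdjoint z →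
    ρ (a * z * a * y) * ρ (a * a * a) = ρ (a * z * a) * ρ (a * a * a * y) ∧
      ρ (y * (a * z * a)) * ρ (a * a * a) = ρ (a * z * a) * ρ (y * (a * a * a)) := by
    intro z hz
    have hb : IsSelfAdjoint (a * z * a) := by
      rw [IsSelfAdjoint, star_mul, star_mul, hsa, hz.star_eq, mul_assoc]
    have hu' : IsSelfAdjoint (a * a * a) := by
      rw [IsSelfAdjoint, star_mul, star_mul, hsa, mul_assoc]
    have hreal : ∀ x : D, IsSelfAdjoint x → ((ρ x).re : ℂ) = ρ x := by
      intro x hx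
      have : x = x⁺ - x⁻ := (CFC.posPart_sub_negPart x).symm
      have h1 := Complex.nonneg_iff.1 (map_nonneg ρ (CFC.posPart_nonneg x))
      have h2 := Complex.nonneg_iff.1 (map_nonneg ρ (CFC.negPart_nonneg x))
      apply Complex.ext
      · simp
      · rw [this, map_sub]; simp [← h1.2, ← h2.2]
    set s : ℝ := (ρ (a * z * a)).re / (ρ (a * a * a)).re with hs
    have hsC : (s : ℂ) = ρ (a * z * a) / ρ (a * a * a) := by
      rw [hs, Complex.ofReal_div, hreal _ hb, hreal _ hu']
    have hw : a * z * a - (s : ℂ) • (a * a * a) = a * (z - (s : ℂ) • a) * a := by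
      rw [mul_sub, sub_mul, mul_smul_comm, smul_mul_assoc]
    have hz' : IsSelfAdjoint (z - (s : ℂ) • a) := by
      refine hz.sub ?_
      rw [IsSelfAdjoint, star_smul, hsa]; simp
    have hwsa : IsSelfAdjoint (a * (z - (s : ℂ) • a) * a) := by
      rw [IsSelfAdjoint, star_mul, star_mul, hsa, hz'.star_eq, mul_assoc]
    have hw0 : ρ (a * (z - (s : ℂ) • a) * a) = 0 := by
      rw [← hw, map_sub, map_smul, hsC, smul_eq_mul, div_mul_cancel₀ _ hu, sub_self]
    have hww := ρ.apply_mul_self_eq_zero_of_parts hwsa hw0 (h _ _ _ hz' (CFC.posPart_nonneg _)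
      (CFC.negPart_nonneg _) (CFC.posPart_mul_negPart _) (CFC.posPart_sub_negPart _))
    have hww' : ρ (star (a * (z - (s : ℂ) • a) * a) * (a * (z - (s : ℂ) • a) * a)) = 0 := by
      rwa [hwsa.star_eq]
    have h1 := ρ.apply_star_mul_eq_zero hww' y
    have h2 := ρ.apply_mul_eq_zero hww' y
    rw [hwsa.star_eq, ← hw, sub_mul, smul_mul_assoc, map_sub, map_smul, sub_eq_zero, hsC] at h1
    rw [← hw, mul_sub, mul_smul_comm, map_sub, map_smul, sub_eq_zero, hsC] at h2
    rw [h1, h2, smul_eq_mul, smul_eq_mul]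
    constructor <;> field_simp
  obtain ⟨h1, h2⟩ := key _ (realPart z).2
  obtain ⟨h3, h4⟩ := key _ (imaginaryPart z).2
  rw [← realPart_add_I_smul_imaginaryPart z]
  simp only [mul_add, add_mul, mul_smul_comm, smul_mul_assoc, map_add, map_smul, smul_eq_mul]
  constructor
  · linear_combination h1 + Complex.I * h3
  · linear_combination h2 + Complex.I * h4

lemma PositiveLinearMap.corner_apply_mul (ha : 0 ≤ a) (hρ : ρ a ≠ 0)
    (h : ∀ z c d : D, IsSelfAdjoint z → 0 ≤ c → 0 ≤ d → c * d = 0 → c - d = a * z * a →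
      ρ c * ρ d = 0) (z y : D) :
    ρ (a * z * a * (a * y * a)) =
      ρ (a * a * a * (a * a * a)) / ρ (a * a * a) ^ 2 * (ρ (a * z * a) * ρ (a * y * a)) := by
  have hu := ρ.apply_pow_three_ne_zero ha hρ
  have h1 := (ρ.corner_apply_eq ha hρ h z (a * y * a)).1
  have h2 := (ρ.corner_apply_eq ha hρ h y (a * a * a)).2
  field_simp
  linear_combination ρ (a * a * a) * h1 + ρ (a * z * a) * h2

end Corner

end PositiveFunctionals

section MatrixFunctionals

open scoped ComplexOrder

variable {A : Type} [NonUnitalCStarAlgebra A] {n : ℕ}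

/-- The matrix with one prescribed entry and zeros elsewhere. -/
def cstarSingle (i j : Fin n) (p : A) : CStarMatrix (Fin n) (Fin n) A :=
  CStarMatrix.ofMatrix (Matrix.single i j p)

lemma cstarSingle_add (i j : Fin n) (p q : A) :
    cstarSingle i j (p + q) = cstarSingle i j p + cstarSingle i j q :=
  Matrix.single_add i j p q

lemma cstarSingle_smul (i j : Fin n) (c : ℂ) (p : A) :
    cstarSingle i j (c • p) = c • cstarSingle i j p :=
  (Matrix.smul_single c i j p).symm

lemma star_cstarSingle (i j : Fin n) (p : A) :
    star (cstarSingle i j p) = cstarSingle j i (star p) :=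
  Matrix.conjTranspose_single i j p

lemma cstarSingle_mul_cstarSingle (i j l : Fin n) (p q : A) :
    cstarSingle i j p * cstarSingle j l q = cstarSingle i l (p * q) :=
  Matrix.single_mul_single_same (i := i) (j := j) (k := l) p q

lemma cstarSingle_mul_mul_cstarSingle (j : Fin n) (p q : A) (x : CStarMatrix (Fin n) (Fin n) A) :
    cstarSingle j j p * x * cstarSingle j j q = cstarSingle j j (p * x j j * q) :=
  Matrix.single_mul_mul_single j j j j p x q

lemma sum_cstarSingle (x : CStarMatrix (Fin n) (Fin n) A) :
    x = ∑ i, ∑ j, cstarSingle i j (x i j) :=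
  Matrix.matrix_eq_sum_single x

theorem NowhereScattered.not_functional [PartialOrder A] [StarOrderedRing A]
    (hA : NowhereScattered A)
    (ρ : CStarMatrix (Fin n) (Fin n) A →ₚ[ℂ] ℂ) {a : CStarMatrix (Fin n) (Fin n) A} (ha : 0 ≤ a)
    (hρ : ρ a ≠ 0)
    (h : ∀ z c d, IsSelfAdjoint z → 0 ≤ c → 0 ≤ d → c * d = 0 → c - d = a * z * a →
      ρ c * ρ d = 0) : False := by
  have hu := ρ.apply_pow_three_ne_zero ha hρ
  have hsa : star a = a := ha.isSelfAdjoint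
  have hunn : 0 ≤ a * a * a := by
    simpa [hsa] using star_left_conjugate_nonneg ha a
  have huu := ρ.apply_mul_self_ne_zero hunn hu
  have huuu := ρ.apply_pow_three_ne_zero hunn hu
  set u := a * a * a with hu_def
  have hus : star u = u := hunn.isSelfAdjoint
  let ω (j : Fin n) : A →ₚ[ℂ] ℂ := .mk₀
    { toFun := fun s => ρ (u * cstarSingle j j s * u)
      map_add' := fun s t => by rw [cstarSingle_add, mul_add, add_mul, map_add]
      map_smul' := fun c s => by
        rw [cstarSingle_smul, mul_smul_comm, smul_mul_assoc, map_smul]; rfl }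
    (fun s hs => by
      obtain ⟨y, rfl⟩ := CStarAlgebra.nonneg_iff_eq_star_mul_self.1 hs
      change 0 ≤ ρ _
      rw [← cstarSingle_mul_cstarSingle, ← star_cstarSingle]
      have := map_nonneg ρ (star_mul_self_nonneg (cstarSingle j j y * u))
      rw [star_mul, hus] at this
      simpa only [mul_assoc] using this)
  have hω : ∀ j s, ω j s = ρ (u * cstarSingle j j s * u) := fun _ _ => rfl
  have hform : ∀ x, u * x * u = a * (a * a * x * a * a) * a := by
    intro x; rw [hu_def]; noncomm_ring
  by_cases hex : ∃ j s, ω j s ≠ 0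
  · obtain ⟨j, s₀, hs₀⟩ := hex
    refine hA (hasNonzeroElementaryIdealQuotient_of_functional (ω j) ((u * u) j j)
      (c := ρ (u * u) / ρ u ^ 2) (div_ne_zero huu (pow_ne_zero _ hu)) ?_ hs₀)
    intro s s'
    rw [hω, hω, hω, ← cstarSingle_mul_mul_cstarSingle]
    have := ρ.corner_apply_mul ha hρ h (a * a * cstarSingle j j s' * a * a)
      (a * a * cstarSingle j j s * a * a)
    rw [← hform, ← hform, ← hu_def] at this
    rw [← this]
    congr 1
    noncomm_ring
  · push Not at hex
    apply huuu
    have h1 : ∀ (y : CStarMatrix (Fin n) (Fin n) A) i j p, ρ (y * (cstarSingle i j p * u)) = 0 := by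
      intro y i j p
      refine ρ.apply_mul_eq_zero ?_ y
      have := hex j (star p * p)
      rw [hω, ← cstarSingle_mul_cstarSingle j i j, ← star_cstarSingle] at this
      rw [star_mul, hus, ← this]
      congr 1
      noncomm_ring
    conv_lhs => enter [2, 1, 2]; rw [sum_cstarSingle u]
    simp only [Finset.sum_mul, Finset.mul_sum, map_sum]
    refine Finset.sum_eq_zero fun i _ => Finset.sum_eq_zero fun j _ => ?_
    rw [mul_assoc]
    exact h1 _ _ _ _

end MatrixFunctionals

section FiniteDimensional

variable {G : Type*} [NonUnitalCStarAlgebra G]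

lemma isSelfAdjoint_of_unit {u : G} (hu : ∀ x, u * x = x ∧ x * u = x) : IsSelfAdjoint u := by
  have h := (hu (star u)).1
  have h2 := congrArg star h
  rw [star_mul, star_star] at h2
  rw [IsSelfAdjoint, ← h, h2]

lemma isStarProjection_of_unit {u : G} (hu : ∀ x, u * x = x ∧ x * u = x) : IsStarProjection u :=
  ⟨(hu u).1, isSelfAdjoint_of_unit hu⟩

variable [FiniteDimensional ℂ G]

lemma finite_quasispectrum (a : G) : (quasispectrum ℝ a).Finite := by
  have h1 : Module.Finite ℂ (Unitization ℂ G) := by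
    refine Module.Finite.of_surjective (LinearMap.coprod
      (LinearMap.toSpanSingleton ℂ (Unitization ℂ G) 1) (Unitization.inrHom ℂ ℂ G)) fun x => ?_
    refine ⟨(x.fst, x.snd), ?_⟩
    ext <;> simp
  have h2 : Module.Finite ℝ (Unitization ℂ G) := Module.Finite.trans ℂ _
  rw [Unitization.quasispectrum_eq_spectrum_inr' ℝ ℂ a]
  obtain ⟨p, hp, hp0⟩ := IsIntegral.of_finite ℝ (a : Unitization ℂ G)
  have hp0' : Polynomial.aeval (a : Unitization ℂ G) p = 0 := hp0
  refine (p.roots.toFinset.finite_toSet).subset fun t ht => ?_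
  have h3 := spectrum.subset_polynomial_aeval (a : Unitization ℂ G) p ⟨t, ht, rfl⟩
  rw [hp0', spectrum.zero_eq] at h3
  simpa [hp.ne_zero] using h3

lemma continuousOn_quasispectrum (f : ℝ → ℝ) (a : G) : ContinuousOn f (quasispectrum ℝ a) :=
  (finite_quasispectrum a).continuousOn f

lemma isStarProjection_cfcₙ {f : ℝ → ℝ} (hf : ∀ t, f t * f t = f t) (hf0 : f 0 = 0) (a : G) :
    IsStarProjection (cfcₙ f a) := by
  refine ⟨?_, cfcₙ_predicate f a⟩
  rw [IsIdempotentElem, ← cfcₙ_mul f f a (continuousOn_quasispectrum _ _) hf0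
    (continuousOn_quasispectrum _ _) hf0]
  simp only [hf]

/-- The indicator of a set of nonzero reals, as a function suited to the functional calculus. -/
noncomputable abbrev ind (s : Set ℝ) : ℝ → ℝ := (s \ {0}).indicator 1

lemma ind_zero (s : Set ℝ) : ind s 0 = 0 := by simp [ind]

lemma ind_mul_self (s : Set ℝ) (t : ℝ) : ind s t * ind s t = ind s t := by
  by_cases h : t ∈ s \ {0} <;> simp [ind, h]

lemma exists_unit (G : Type*) [NonUnitalCStarAlgebra G] [FiniteDimensional ℂ G] :
    ∃ u : G, ∀ x, u * x = x ∧ x * u = x := by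
  let _ := CStarAlgebra.spectralOrder G
  have _ := CStarAlgebra.spectralOrderedRing G
  let b := Module.finBasis ℂ G
  have key : ∃ u : G, IsSelfAdjoint u ∧ ∀ i, u * b i = b i ∧ b i * u = b i := by
    set y : G := ∑ i, (star (b i) * b i + b i * star (b i)) with hy
    have hyn : 0 ≤ y := Finset.sum_nonneg fun i _ =>
      add_nonneg (star_mul_self_nonneg _) (mul_star_self_nonneg _)
    have hys := hyn.isSelfAdjoint
    set u := cfcₙ (ind Set.univ) y with hu
    have hproj : IsStarProjection u := isStarProjection_cfcₙ (ind_mul_self _) (ind_zero _) y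
    have hus : star u = u := hproj.isSelfAdjoint
    have hyu : y * u = y := by
      conv_lhs => enter [1]; rw [← cfcₙ_id' ℝ y]
      rw [← cfcₙ_mul (fun t : ℝ => t) _ y (by fun_prop) rfl (continuousOn_quasispectrum _ _)
        (ind_zero _)]
      conv_rhs => rw [← cfcₙ_id' ℝ y]
      refine cfcₙ_congr fun t _ => ?_
      by_cases h : t = 0 <;> simp [ind, h]
    have zero_of : ∀ x : G, star x * x ≤ y → x * u = x := by
      intro x hx
      have h1 : star (x * u - x) * (x * u - x)
          = u * (star x * x) * u - u * (star x * x) - (star x * x) * u + star x * x := by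
        rw [star_sub, star_mul, hus]; noncomm_ring
      obtain ⟨s, hs⟩ : ∃ s, s = CFC.sqrt (y - star x * x) := ⟨_, rfl⟩
      have hss : s * s = y - star x * x := by
        rw [hs]; exact CFC.sqrt_mul_sqrt_self _ (sub_nonneg.2 hx)
      have hsa : star s = s := by rw [hs]; exact (CFC.sqrt_nonneg _).isSelfAdjoint
      have huy : u * y = y := by
        have := congrArg star hyu
        rwa [star_mul, hus, hys.star_eq] at this
      have hyuu : u * y * u = y := by rw [huy, hyu]
      have hsum : star (x * u - x) * (x * u - x) + star (s * u - s) * (s * u - s) = 0 := by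
        have h2 : star (s * u - s) * (s * u - s)
            = u * (s * s) * u - u * (s * s) - (s * s) * u + s * s := by
          rw [star_sub, star_mul, hus, hsa]; noncomm_ring
        rw [h1, h2, hss]
        have : ∀ z : G, u * z * u - u * z - z * u + z +
          (u * (y - z) * u - u * (y - z) - (y - z) * u + (y - z)) =
            u * y * u - u * y - y * u + y := by intro z; noncomm_ring
        rw [this, hyuu, huy, hyu]; abel
      have h3 : star (x * u - x) * (x * u - x) = 0 := by
        refine le_antisymm ?_ (star_mul_self_nonneg _)
        rw [← hsum]
        exact le_add_of_nonneg_right (star_mul_self_nonneg _)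
      exact sub_eq_zero.1 (CStarRing.star_mul_self_eq_zero_iff _ |>.1 h3)
    refine ⟨u, hproj.isSelfAdjoint, fun i => ?_⟩
    have hle : star (b i) * b i + b i * star (b i) ≤ y :=
      Finset.single_le_sum (f := fun i => star (b i) * b i + b i * star (b i))
        (fun i _ => add_nonneg (star_mul_self_nonneg _) (mul_star_self_nonneg _))
        (Finset.mem_univ i)
    have h1 := zero_of (b i) ((le_add_of_nonneg_right (mul_star_self_nonneg _)).trans hle)
    have h2 := zero_of (star (b i)) (by
      rw [star_star]; exact (le_add_of_nonneg_left (star_mul_self_nonneg _)).trans hle)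
    refine ⟨?_, h1⟩
    have := congrArg star h2
    rwa [star_mul, star_star, hus] at this
  obtain ⟨u, -, hu⟩ := key
  refine ⟨u, fun x => ?_⟩
  constructor
  · have : LinearMap.mulLeft ℂ u = LinearMap.id := b.ext fun i => by simp [(hu i).1]
    simpa using congrArg (fun f => f x) this
  · have : LinearMap.mulRight ℂ u = LinearMap.id := b.ext fun i => by simp [(hu i).2]
    simpa using congrArg (fun f => f x) this

lemma eq_sum_spectral {a : G} (ha : IsSelfAdjoint a) :
    a = ∑ t ∈ (finite_quasispectrum a).toFinset, (t : ℂ) • cfcₙ (ind {t}) a := by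
  conv_lhs => rw [← cfcₙ_id' ℝ a]
  have h1 : ∀ t : ℝ, (t : ℂ) • cfcₙ (ind {t}) a = cfcₙ (fun s => t • ind {t} s) a := by
    intro t
    rw [cfcₙ_smul (R := ℝ) t (ind {t}) a (continuousOn_quasispectrum _ _) (ind_zero _)]
    exact Complex.coe_smul _ _
  simp only [h1]
  rw [← cfcₙ_sum (fun t s => t • ind {t} s) a _ (fun _ _ => continuousOn_quasispectrum _ _)
    (fun t _ => by simp)]
  refine cfcₙ_congr fun s hs => ?_
  rw [Finset.sum_apply, Finset.sum_eq_single s]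
  · by_cases h : s = 0 <;> simp [ind, h]
  · intro t _ hts
    simp [ind, hts.symm]
  · intro h
    exact absurd ((finite_quasispectrum a).mem_toFinset.2 hs) h

lemma span_isStarProjection : Submodule.span ℂ {p : G | IsStarProjection p} = ⊤ := by
  have key : ∀ a : G, IsSelfAdjoint a → a ∈ Submodule.span ℂ {p : G | IsStarProjection p} := by
    intro a ha
    rw [eq_sum_spectral ha]
    refine Submodule.sum_mem _ fun t _ => Submodule.smul_mem _ _ (Submodule.subset_span ?_)
    exact isStarProjection_cfcₙ (ind_mul_self _) (ind_zero _) a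
  refine eq_top_iff.2 fun x _ => ?_
  rw [← realPart_add_I_smul_imaginaryPart x]
  exact add_mem (key _ (realPart x).2) (Submodule.smul_mem _ _ (key _ (imaginaryPart x).2))

end FiniteDimensional

section Combinatorics

variable {ι : Type*} [Fintype ι]

lemma exists_perm_rel_fixed_iff {r : ι → ι → Prop} (hr : Equivalence r) :
    ∃ σ : Equiv.Perm ι, (∀ i, r i (σ i)) ∧ ∀ i, σ i = i → ∀ j, r i j → j = i := by
  classical
  obtain ⟨σ, hσ, hmin⟩ := Set.exists_min_image {σ : Equiv.Perm ι | ∀ i, r i (σ i)}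
    (fun σ => (Finset.univ.filter fun i => σ i = i).card) (Set.toFinite _)
    ⟨1, fun i => hr.refl i⟩
  refine ⟨σ, hσ, fun i hi j hij => ?_⟩
  by_contra hne
  have hmem : ∀ l, r l ((Equiv.swap i j) (σ l)) := by
    intro l
    rw [Equiv.swap_apply_def]
    split_ifs with h1 h2
    · exact hr.trans (h1 ▸ hσ l) hij
    · exact hr.trans (h2 ▸ hσ l) (hr.symm hij)
    · exact hσ l
  have h := hmin (σ.trans (Equiv.swap i j)) hmem
  refine absurd h (not_le.2 (Finset.card_lt_card ?_))
  refine Finset.ssubset_iff_of_subset ?_ |>.2 ⟨i, by simpa using hi, ?_⟩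
  · intro l hl
    rw [Finset.mem_filter] at hl ⊢
    refine ⟨Finset.mem_univ _, ?_⟩
    replace hl : Equiv.swap i j (σ l) = l := hl.2
    rw [Equiv.swap_apply_def] at hl
    split_ifs at hl with h1 h2
    · exfalso
      have : l = i := σ.injective (h1.trans hi.symm)
      exact hne (hl.trans this)
    · exfalso
      rw [← hl, hi] at h2
      exact hne h2.symm
    · exact hl
  · rw [Finset.mem_filter]
    rintro ⟨-, h1⟩
    rw [Equiv.trans_apply, hi, Equiv.swap_apply_left] at h1
    exact hne h1

lemma exists_coloring_perm (σ : Equiv.Perm ι) :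
    ∃ c : ι → Fin 4, ∀ i, σ i ≠ i → c i ≠ c (σ i) := by
  classical
  suffices h : ∀ s : Finset ι, ∃ c : ι → Fin 4, ∀ i, i ∈ s → σ i ∈ s → σ i ≠ i → c i ≠ c (σ i) by
    obtain ⟨c, hc⟩ := h Finset.univ
    exact ⟨c, fun i => hc i (Finset.mem_univ _) (Finset.mem_univ _)⟩
  intro s
  induction s using Finset.induction_on with
  | empty => exact ⟨fun _ => 0, by simp⟩
  | insert x s hx ih =>
    obtain ⟨c, hc⟩ := ih
    have havoid : ∀ a b : Fin 4, ∃ d, d ≠ a ∧ d ≠ b := by decide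
    obtain ⟨d, hd1, hd2⟩ := havoid (c (σ x)) (c (σ.symm x))
    refine ⟨Function.update c x d, fun i hi hσi hne => ?_⟩
    by_cases h1 : i = x
    · subst h1
      rwa [Function.update_self, Function.update_of_ne hne]
    · by_cases h2 : σ i = x
      · rw [h2, Function.update_self, Function.update_of_ne h1]
        rw [← h2, Equiv.symm_apply_apply] at hd2
        exact hd2.symm
      · rw [Function.update_of_ne h1, Function.update_of_ne h2]
        exact hc i (Finset.mem_of_mem_insert_of_ne hi h1) (Finset.mem_of_mem_insert_of_ne hσi h2) hne

end Combinatorics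

section MinimalProjections

variable {G : Type*} [NonUnitalCStarAlgebra G]

/-- A nonzero projection whose corner is one-dimensional. -/
def IsMinimalProjection (e : G) : Prop :=
  IsStarProjection e ∧ e ≠ 0 ∧ ∀ x, ∃ c : ℂ, e * x * e = c • e

lemma IsMinimalProjection.exists_partialIsometry {e f : G} (he : IsMinimalProjection e)
    (hf : IsMinimalProjection f) {x : G} (hx : e * x * f ≠ 0) :
    ∃ v : G, v * star v = e ∧ star v * v = f := by
  let _ := CStarAlgebra.spectralOrder G
  have _ := CStarAlgebra.spectralOrderedRing G
  obtain ⟨⟨hee, hes⟩, he0, hec⟩ := he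
  obtain ⟨⟨hff, hfs⟩, hf0, hfc⟩ := hf
  rw [IsIdempotentElem] at hee hff
  rw [IsSelfAdjoint] at hes hfs
  set w := e * x * f with hw
  have hew : e * w = w := by rw [hw, ← mul_assoc, ← mul_assoc, hee]
  have hwf : w * f = w := by rw [hw, mul_assoc, hff]
  have hwse : star w * e = star w := by
    have := congrArg star hew; rwa [star_mul, hes] at this
  obtain ⟨c, hc⟩ := hec (w * star w)
  rw [← mul_assoc, hew, mul_assoc, hwse] at hc
  have hnorm : ‖c‖ • ‖e‖ = ‖w‖ * ‖w‖ := by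
    rw [← CStarRing.norm_self_mul_star, hc, norm_smul, smul_eq_mul]
  have hen : ‖e‖ = 1 := by
    have h1 : ‖e‖ * ‖e‖ = ‖e‖ := by
      have := CStarRing.norm_star_mul_self (x := e)
      rw [hes, hee] at this; exact this.symm
    have h2 : ‖e‖ ≠ 0 := norm_ne_zero_iff.2 he0
    exact mul_left_cancel₀ h2 (h1.trans (mul_one _).symm)
  have hc0 : c ≠ 0 := by
    rintro rfl
    rw [zero_smul] at hc
    exact hx ((CStarRing.mul_star_self_eq_zero_iff w).1 hc)
  have hcpos : c = ((‖c‖ : ℝ) : ℂ) := by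
    have h1 : 0 ≤ c • e := hc ▸ mul_star_self_nonneg w
    have h2 : star (c • e) = c • e := h1.isSelfAdjoint
    rw [star_smul, hes] at h2
    have h3 : star c = c := by
      by_contra hne
      have : (star c - c) • e = 0 := by rw [sub_smul, h2, sub_self]
      exact (smul_ne_zero (sub_ne_zero.2 hne) he0) this
    have h4 : ((c.re : ℝ) : ℂ) = c := Complex.conj_eq_iff_re.1 h3
    have h5 : 0 ≤ c.re := by
      by_contra hneg
      push Not at hneg
      have h6 : 0 ≤ -(c • e) := by
        rw [← neg_smul, ← h4, ← Complex.ofReal_neg, Complex.coe_smul]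
        exact smul_nonneg (by linarith) (by
          have := star_mul_self_nonneg e; rwa [hes, hee] at this)
      have h7 : c • e = 0 := le_antisymm (neg_nonneg.1 h6) h1
      exact smul_ne_zero hc0 he0 h7
    rw [← h4, Complex.norm_real, Real.norm_of_nonneg h5]
  have hcn : 0 < ‖c‖ := norm_pos_iff.2 hc0
  set μ : ℂ := (((√‖c‖)⁻¹ : ℝ) : ℂ) with hμ
  have hμμ : μ * μ * c = 1 := by
    rw [hcpos, hμ, ← Complex.ofReal_mul, ← Complex.ofReal_mul, ← mul_inv,
      Real.mul_self_sqrt hcn.le, inv_mul_cancel₀ hcn.ne', Complex.ofReal_one]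
  have hμs : star μ = μ := Complex.conj_ofReal _
  set v := μ • w with hv
  have hvv : v * star v = e := by
    rw [hv, star_smul, hμs, smul_mul_smul_comm, hc, smul_smul, hμμ, one_smul]
  refine ⟨v, hvv, ?_⟩
  have hvf : v * f = v := by rw [hv, smul_mul_assoc, hwf]
  have hev : e * v = v := by rw [hv, mul_smul_comm, hew]
  have hfv : f * star v = star v := by
    have := congrArg star hvf; rwa [star_mul, hfs] at this
  obtain ⟨d, hd⟩ := hfc (star v * v)
  rw [← mul_assoc, hfv, mul_assoc, hvf] at hd
  have h1 : v = d • v := by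
    conv_lhs => rw [← hev, ← hvv, mul_assoc, hd, mul_smul_comm, hvf]
  have hv0 : v ≠ 0 := by
    intro h; rw [h, zero_mul] at hvv; exact he0 hvv.symm
  have hd1 : d = 1 := by
    by_contra hne
    have : (d - 1) • v = 0 := by rw [sub_smul, one_smul, ← h1, sub_self]
    exact smul_ne_zero (sub_ne_zero.2 hne) hv0 this
  rw [hd, hd1, one_smul]

lemma exists_good_partialIsometries {ι : Type*} [Fintype ι] {e : ι → G}
    (he : ∀ i, IsMinimalProjection (e i)) (horth : ∀ i j, i ≠ j → e i * e j = 0) :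
    ∃ (I : Finset ι) (v : Fin 4 → G), (∀ i ∉ I, ∀ j, j ≠ i → ∀ x, e i * x * e j = 0) ∧
      (∀ c, v c * v c = 0) ∧ (∀ c, IsStarProjection (v c * star (v c))) ∧
      (∀ c, IsStarProjection (star (v c) * v c)) ∧ (∀ c, (∑ i, e i) * v c = v c) ∧
      (∀ c, v c * ∑ i, e i = v c) ∧ ∑ c, v c * star (v c) = ∑ i ∈ I, e i := by
  classical
  have hee : ∀ i, e i * e i = e i := fun i => (he i).1.isIdempotentElem
  have hes : ∀ i, star (e i) = e i := fun i => (he i).1.isSelfAdjoint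
  let r : ι → ι → Prop := fun i j => ∃ v : G, v * star v = e i ∧ star v * v = e j
  have hr : Equivalence r := by
    refine ⟨fun i => ⟨e i, ?_, ?_⟩, ?_, ?_⟩
    · rw [hes, hee]
    · rw [hes, hee]
    · rintro i j ⟨v, h1, h2⟩
      exact ⟨star v, by rw [star_star, h2], by rw [star_star, h1]⟩
    · rintro i j l ⟨v, h1, h2⟩ ⟨w, h3, h4⟩
      refine ⟨v * w, ?_, ?_⟩
      · calc v * w * star (v * w) = v * (w * star w) * star v := by
              rw [star_mul]; noncomm_ring
          _ = (v * star v) * (v * star v) := by rw [h3, ← h2]; noncomm_ring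
          _ = e i := by rw [h1, hee]
      · calc star (v * w) * (v * w) = star w * (star v * v) * w := by
              rw [star_mul]; noncomm_ring
          _ = (star w * w) * (star w * w) := by rw [h2, ← h3]; noncomm_ring
          _ = e l := by rw [h4, hee]
  obtain ⟨σ, hσ, hfix⟩ := exists_perm_rel_fixed_iff hr
  obtain ⟨c, hc⟩ := exists_coloring_perm σ
  choose w hw1 hw2 using hσ
  have hew : ∀ i, e i * w i = w i := by
    intro i
    have h0 : (e i * w i - w i) * star (e i * w i - w i) = 0 := by
      have : (e i * w i - w i) * star (e i * w i - w i)
          = e i * (w i * star (w i)) * e i - e i * (w i * star (w i))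
            - (w i * star (w i)) * e i + w i * star (w i) := by
        rw [star_sub, star_mul, hes]; noncomm_ring
      rw [this, hw1, hee, hee]; abel
    exact sub_eq_zero.1 ((CStarRing.mul_star_self_eq_zero_iff _).1 h0)
  have hwe : ∀ i, w i * e (σ i) = w i := by
    intro i
    have h0 : star (w i * e (σ i) - w i) * (w i * e (σ i) - w i) = 0 := by
      have : star (w i * e (σ i) - w i) * (w i * e (σ i) - w i)
          = e (σ i) * (star (w i) * w i) * e (σ i) - e (σ i) * (star (w i) * w i)
            - (star (w i) * w i) * e (σ i) + star (w i) * w i := by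
        rw [star_sub, star_mul, hes]; noncomm_ring
      rw [this, hw2, hee, hee]; abel
    exact sub_eq_zero.1 ((CStarRing.star_mul_self_eq_zero_iff _).1 h0)
  have hsw : ∀ i, star (w i) * e i = star (w i) := by
    intro i
    have := congrArg star (hew i); rwa [star_mul, hes] at this
  have hsw' : ∀ i, e (σ i) * star (w i) = star (w i) := by
    intro i
    have := congrArg star (hwe i); rwa [star_mul, hes] at this
  have hww : ∀ i j, i ≠ j → w i * star (w j) = 0 := by
    intro i j hij
    rw [← hwe i, ← hsw' j, mul_assoc, ← mul_assoc (e (σ i)),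
      horth _ _ (σ.injective.ne hij), zero_mul, mul_zero]
  have hww' : ∀ i j, i ≠ j → star (w i) * w j = 0 := by
    intro i j hij
    rw [← hsw i, ← hew j, mul_assoc, ← mul_assoc (e i), horth _ _ hij, zero_mul, mul_zero]
  have hww2 : ∀ i j, j ≠ σ i → w i * w j = 0 := by
    intro i j hij
    rw [← hwe i, ← hew j, mul_assoc, ← mul_assoc (e (σ i)), horth _ _ hij.symm, zero_mul, mul_zero]
  have hproj : ∀ (s : Finset ι) (f : ι → ι), Function.Injective f →
      IsStarProjection (∑ i ∈ s, e (f i)) := by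
    intro s f hf
    refine ⟨?_, ?_⟩
    · rw [IsIdempotentElem, Finset.sum_mul_sum]
      refine Finset.sum_congr rfl fun i hi => ?_
      rw [Finset.sum_eq_single i (fun j _ hj => horth _ _ (hf.ne hj.symm)) (fun h => absurd hi h),
        hee]
    · rw [IsSelfAdjoint, star_sum]
      exact Finset.sum_congr rfl fun i _ => hes _
  let I : Finset ι := Finset.univ.filter fun i => σ i ≠ i
  let J : Fin 4 → Finset ι := fun d => I.filter fun i => c i = d
  have hJ1 : ∀ d, (∑ i ∈ J d, w i) * star (∑ i ∈ J d, w i) = ∑ i ∈ J d, e i := by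
    intro d
    rw [star_sum, Finset.sum_mul_sum]
    refine Finset.sum_congr rfl fun i hi => ?_
    rw [Finset.sum_eq_single i (fun j _ hj => hww _ _ hj.symm) (fun h => absurd hi h), hw1]
  have hJ2 : ∀ d, star (∑ i ∈ J d, w i) * (∑ i ∈ J d, w i) = ∑ i ∈ J d, e (σ i) := by
    intro d
    rw [star_sum, Finset.sum_mul_sum]
    refine Finset.sum_congr rfl fun i hi => ?_
    rw [Finset.sum_eq_single i (fun j _ hj => hww' _ _ hj.symm) (fun h => absurd hi h), hw2]
  refine ⟨I, fun d => ∑ i ∈ J d, w i, ?_, ?_, ?_, ?_, ?_, ?_, ?_⟩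
  · intro i hi j hj x
    by_contra hne
    have hi' : σ i = i := by simpa [I] using hi
    exact hj (hfix i hi' j ((he i).exists_partialIsometry (he j) hne))
  · intro d
    rw [Finset.sum_mul_sum]
    refine Finset.sum_eq_zero fun i hi => Finset.sum_eq_zero fun j hj => hww2 i j ?_
    rintro rfl
    simp only [J, I, Finset.mem_filter, Finset.mem_univ, true_and] at hi hj
    exact hc i hi.1 (hi.2.trans hj.2.symm)
  · intro d
    rw [hJ1]; exact hproj _ id Function.injective_id
  · intro d
    rw [hJ2]; exact hproj _ σ σ.injective
  · intro d
    rw [Finset.mul_sum]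
    refine Finset.sum_congr rfl fun i _ => ?_
    rw [Finset.sum_mul, Finset.sum_eq_single i, hew]
    · intro j _ hj
      rw [← hew i, ← mul_assoc, horth _ _ hj, zero_mul]
    · simp
  · intro d
    rw [Finset.sum_mul]
    refine Finset.sum_congr rfl fun i _ => ?_
    rw [Finset.mul_sum, Finset.sum_eq_single (σ i), hwe]
    · intro j _ hj
      rw [← hwe i, mul_assoc, horth _ _ hj.symm, mul_zero]
    · simp
  · simp only [hJ1]
    exact Finset.sum_fiberwise I c e

end MinimalProjections

section Decomposition

variable {G : Type*} [NonUnitalCStarAlgebra G] [FiniteDimensional ℂ G]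

lemma exists_proper_subprojection {p x : G} (hx : IsSelfAdjoint x)
    (hpx : p * x = x) (hxp : x * p = x) (hne : ∀ c : ℂ, x ≠ c • p) :
    ∃ r : G, IsStarProjection r ∧ r ≠ 0 ∧ r ≠ p ∧ p * r = r ∧ r * p = r ∧
      ∀ y, Commute x y → Commute r y := by
  classical
  by_contra hcon
  push Not at hcon
  have key : ∀ t : ℝ, cfcₙ (ind {t}) x = 0 ∨ cfcₙ (ind {t}) x = p := by
    intro t
    by_contra hor
    push Not at hor
    have hg : cfcₙ (ind {t}) x = x * cfcₙ (fun s => ind {t} s / s) x := by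
      conv_rhs => enter [1]; rw [← cfcₙ_id' ℝ x]
      rw [← cfcₙ_mul (fun s : ℝ => s) _ x (by fun_prop) rfl (continuousOn_quasispectrum _ _)
        (by simp)]
      refine cfcₙ_congr fun s _ => ?_
      by_cases h : s = 0
      · simp [ind, h]
      · field_simp
    have hg' : cfcₙ (ind {t}) x = cfcₙ (fun s => ind {t} s / s) x * x := by
      rw [hg]
      have := cfcₙ_commute_cfcₙ (fun s : ℝ => s) (fun s => ind {t} s / s) x
      rw [cfcₙ_id' ℝ x] at this
      exact this
    obtain ⟨y, hy1, hy2⟩ := hcon _ (isStarProjection_cfcₙ (ind_mul_self {t}) (ind_zero _) x)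
      hor.1 hor.2 (by rw [hg, ← mul_assoc, hpx]) (by rw [hg', mul_assoc, hxp])
    exact hy2 (hy1.cfcₙ_real _)
  refine hne (∑ t ∈ (finite_quasispectrum x).toFinset,
    if cfcₙ (ind {t}) x = p then (t : ℂ) else 0) ?_
  conv_lhs => rw [eq_sum_spectral hx]
  rw [Finset.sum_smul]
  refine Finset.sum_congr rfl fun t _ => ?_
  split_ifs with h
  · rw [h]
  · rw [(key t).resolve_right h, smul_zero, zero_smul]

/-- The corner of an algebra cut out by an element. -/
def cornerSubmodule (p : G) : Submodule ℂ G :=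
  LinearMap.range (LinearMap.mulLeft ℂ p ∘ₗ LinearMap.mulRight ℂ p)

lemma finrank_corner_lt {p r : G} (hr : IsStarProjection r) (hp : IsStarProjection p)
    (hne : r ≠ p) (hpr : p * r = r) (hrp : r * p = r) :
    Module.finrank ℂ (cornerSubmodule r) < Module.finrank ℂ (cornerSubmodule p) := by
  refine Submodule.finrank_lt_finrank_of_lt (lt_of_le_of_ne ?_ ?_)
  · rintro _ ⟨z, rfl⟩
    refine ⟨r * z * r, ?_⟩
    simp only [LinearMap.comp_apply, LinearMap.mulLeft_apply, LinearMap.mulRight_apply]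
    rw [mul_assoc _ r p, hrp, ← mul_assoc, ← mul_assoc, hpr, mul_assoc]
  · intro heq
    have hmem : p ∈ cornerSubmodule r := by
      rw [heq]
      refine ⟨p, ?_⟩
      simp only [LinearMap.comp_apply, LinearMap.mulLeft_apply, LinearMap.mulRight_apply]
      rw [hp.isIdempotentElem.eq, hp.isIdempotentElem.eq]
    obtain ⟨z, hz⟩ := hmem
    simp only [LinearMap.comp_apply, LinearMap.mulLeft_apply, LinearMap.mulRight_apply] at hz
    apply hne
    rw [← hrp]
    conv_lhs => rw [← hz]
    rw [← mul_assoc, hr.isIdempotentElem.eq, hz]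

lemma exists_minimal_decomposition {y : G} (hy : IsSelfAdjoint y) {p : G}
    (hp : IsStarProjection p) (hpy : Commute p y) :
    ∃ (ι : Type) (_ : Fintype ι) (e : ι → G) (l : ι → ℂ), (∀ i, IsMinimalProjection (e i)) ∧
      (∀ i j, i ≠ j → e i * e j = 0) ∧ ∑ i, e i = p ∧
      ∀ i, y * e i = l i • e i := by
  induction hn : Module.finrank ℂ (cornerSubmodule p) using Nat.strong_induction_on
    generalizing p with
  | _ n ih =>
    have hpp : p * p = p := hp.isIdempotentElem
    have hps : star p = p := hp.isSelfAdjoint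
    by_cases hp0 : p = 0
    · exact ⟨Empty, inferInstance, fun i => i.elim, fun i => i.elim, fun i => i.elim,
        fun i => i.elim, by simp [hp0], fun i => i.elim⟩
    by_cases hmin : ∀ x, ∃ c : ℂ, p * x * p = c • p
    · obtain ⟨l, hl⟩ := hmin y
      refine ⟨Unit, inferInstance, fun _ => p, fun _ => l, fun _ => ⟨hp, hp0, hmin⟩,
        fun i j h => absurd (Subsingleton.elim i j) h, by simp, fun _ => ?_⟩
      rw [← hl, hpy.eq, mul_assoc, hpp]
    have hr : ∃ r : G, IsStarProjection r ∧ r ≠ 0 ∧ r ≠ p ∧ p * r = r ∧ r * p = r ∧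
        Commute r y := by
      by_cases hyp : ∃ c : ℂ, y * p = c • p
      · obtain ⟨c, hc⟩ := hyp
        have hpy' : p * y = c • p := hpy.eq.trans hc
        have hx : ∃ x : G, IsSelfAdjoint x ∧ ∀ c : ℂ, p * x * p ≠ c • p := by
          by_contra hcon
          push Not at hcon
          apply hmin
          intro x
          obtain ⟨c1, h1⟩ := hcon _ (realPart x).2
          obtain ⟨c2, h2⟩ := hcon _ (imaginaryPart x).2
          refine ⟨c1 + Complex.I * c2, ?_⟩
          rw [← realPart_add_I_smul_imaginaryPart x, mul_add, add_mul, h1, mul_smul_comm,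
            smul_mul_assoc, h2, add_smul, mul_smul]
        obtain ⟨x, hx, hxc⟩ := hx
        obtain ⟨r, h1, h2, h3, h4, h5, -⟩ := exists_proper_subprojection (p := p)
          (x := p * x * p) (by rw [IsSelfAdjoint, star_mul, star_mul, hps, hx.star_eq, mul_assoc])
          (by rw [← mul_assoc, ← mul_assoc, hpp]) (by rw [mul_assoc, hpp]) hxc
        refine ⟨r, h1, h2, h3, h4, h5, ?_⟩
        rw [Commute, SemiconjBy]
        conv_lhs => rw [← h5, mul_assoc, hpy', mul_smul_comm, h5]
        conv_rhs => rw [← h4, ← mul_assoc, hc, smul_mul_assoc, h4]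
      · push Not at hyp
        obtain ⟨r, h1, h2, h3, h4, h5, h6⟩ := exists_proper_subprojection (p := p)
          (x := y * p) (by rw [IsSelfAdjoint, star_mul, hps, hy.star_eq, hpy.eq])
          (by rw [← mul_assoc, hpy.eq, mul_assoc, hpp]) (by rw [mul_assoc, hpp]) hyp
        exact ⟨r, h1, h2, h3, h4, h5, h6 y ((Commute.refl y).mul_left hpy)⟩
    obtain ⟨r, hr, hr0, hrne, hpr, hrp, hry⟩ := hr
    have hrr : r * r = r := hr.isIdempotentElem
    have hd : IsStarProjection (p - r) := by
      refine ⟨?_, hp.isSelfAdjoint.sub hr.isSelfAdjoint⟩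
      rw [IsIdempotentElem, sub_mul, mul_sub, mul_sub, hpp, hpr, hrp, hrr, sub_self, sub_zero]
    obtain ⟨ι₁, _, e₁, l₁, h1, h2, h3, h4⟩ := ih _
      (hn ▸ finrank_corner_lt hr hp hrne hpr hrp) hr hry rfl
    obtain ⟨ι₂, _, e₂, l₂, k1, k2, k3, k4⟩ := ih _
      (hn ▸ finrank_corner_lt hd hp (fun h => hr0 (by simpa using h))
        (by rw [mul_sub, hpp, hpr]) (by rw [sub_mul, hpp, hrp])) hd (hpy.sub_left hry) rfl
    have hre : ∀ i, r * e₁ i = e₁ i ∧ e₁ i * r = e₁ i := by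
      classical
      intro i
      rw [← h3, Finset.sum_mul, Finset.mul_sum, Finset.sum_eq_single i, Finset.sum_eq_single i]
      · have := (h1 i).1.isIdempotentElem.eq
        exact ⟨this, this⟩
      · exact fun j _ hj => h2 _ _ hj.symm
      · simp
      · exact fun j _ hj => h2 _ _ hj
      · simp
    have hde : ∀ i, (p - r) * e₂ i = e₂ i ∧ e₂ i * (p - r) = e₂ i := by
      classical
      intro i
      rw [← k3, Finset.sum_mul, Finset.mul_sum, Finset.sum_eq_single i, Finset.sum_eq_single i]
      · have := (k1 i).1.isIdempotentElem.eq
        exact ⟨this, this⟩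
      · exact fun j _ hj => k2 _ _ hj.symm
      · simp
      · exact fun j _ hj => k2 _ _ hj
      · simp
    have hrd : r * (p - r) = 0 := by rw [mul_sub, hrp, hrr, sub_self]
    have hdr : (p - r) * r = 0 := by rw [sub_mul, hpr, hrr, sub_self]
    refine ⟨ι₁ ⊕ ι₂, inferInstance, Sum.elim e₁ e₂, Sum.elim l₁ l₂, ?_, ?_, ?_, ?_⟩
    · rintro (i | i)
      exacts [h1 i, k1 i]
    · rintro (i | i) (j | j) hij
      · exact h2 i j fun h => hij (by rw [h])
      · simp only [Sum.elim_inl, Sum.elim_inr]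
        rw [← (hre i).2, ← (hde j).1, mul_assoc, ← mul_assoc r, hrd, zero_mul, mul_zero]
      · simp only [Sum.elim_inl, Sum.elim_inr]
        rw [← (hde i).2, ← (hre j).1, mul_assoc, ← mul_assoc (p - r), hdr, zero_mul, mul_zero]
      · exact k2 i j fun h => hij (by rw [h])
    · rw [Fintype.sum_sum_type]
      simp [h3, k3]
    · rintro (i | i)
      exacts [h4 i, k4 i]

lemma exists_spectral_cut [PartialOrder G] [StarOrderedRing G] {y : G} (hy : 0 ≤ y) {θ : ℝ}
    (hθ : 0 < θ) : ∃ q : G, IsStarProjection q ∧ Commute q y ∧ θ • q ≤ y ∧ ‖y - y * q‖ ≤ θ := by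
  refine ⟨cfcₙ (ind (Set.Ioi θ)) y, isStarProjection_cfcₙ (ind_mul_self _) (ind_zero _) y,
    ?_, ?_, ?_⟩
  · have := cfcₙ_commute_cfcₙ (ind (Set.Ioi θ)) (fun s : ℝ => s) y
    rwa [cfcₙ_id' ℝ y] at this
  · rw [← cfcₙ_smul (R := ℝ) θ (ind (Set.Ioi θ)) y (continuousOn_quasispectrum _ _) (ind_zero _)]
    conv_rhs => rw [← cfcₙ_id' ℝ y]
    refine cfcₙ_mono (fun t ht => ?_) (continuousOn_quasispectrum _ _)
      (continuousOn_quasispectrum _ _) (by simp) rfl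
    have h0 := quasispectrum_nonneg_of_nonneg y hy t ht
    by_cases h : t ∈ Set.Ioi θ \ {0}
    · simpa [ind, h] using h.1.le
    · simpa [ind, h] using h0
  · have : y - y * cfcₙ (ind (Set.Ioi θ)) y
        = cfcₙ (fun t : ℝ => t - t * ind (Set.Ioi θ) t) y := by
      rw [cfcₙ_sub (fun t : ℝ => t) _ y (continuousOn_quasispectrum _ _) rfl
        (continuousOn_quasispectrum _ _) (by simp),
        cfcₙ_mul (fun t : ℝ => t) _ y (continuousOn_quasispectrum _ _) rfl
        (continuousOn_quasispectrum _ _) (by simp), cfcₙ_id' ℝ y]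
    rw [this]
    refine norm_cfcₙ_le fun t ht => ?_
    have h0 := quasispectrum_nonneg_of_nonneg y hy t ht
    by_cases h : t ∈ Set.Ioi θ \ {0}
    · simpa [ind, h] using hθ.le
    · have : t ≤ θ := by
        by_contra hlt
        push Not at hlt
        exact h ⟨hlt, by simpa using (hθ.trans hlt).ne'⟩
      simpa [ind, h, abs_of_nonneg h0] using this

end Decomposition

section OrderZero

/-- A positive bounded linear map `Φ` on a C*-algebra with unit `u` satisfying the
multiplicativity relation of order zero maps. -/
structure IsOrderZeroLike {G M : Type*} [NonUnitalCStarAlgebra G] [NonUnitalCStarAlgebra M]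
    [PartialOrder G] [PartialOrder M] (u : G) (K : ℝ) (Φ : G →ₗ[ℂ] M) : Prop where
  nonneg : ∀ x, 0 ≤ x → 0 ≤ Φ x
  map_star : ∀ x, Φ (star x) = star (Φ x)
  norm_le : ∀ x, ‖Φ x‖ ≤ K * ‖x‖
  mul_left : ∀ x y, Φ x * Φ y = Φ u * Φ (x * y)
  mul_right : ∀ x y, Φ x * Φ y = Φ (x * y) * Φ u

variable {G A : Type*} [NonUnitalCStarAlgebra G] [NonUnitalCStarAlgebra A]

lemma IsCompletelyPositive.apply_star_mul_self {φ : G →ₗ[ℂ] A} (hφ : IsCompletelyPositive φ)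
    (b : G) : CStarNonneg (φ (star b * b)) := by
  obtain ⟨c, hc⟩ := hφ 1 (star (Matrix.of fun _ _ => b) * Matrix.of fun _ _ => b) ⟨_, rfl⟩
  refine ⟨c 0 0, ?_⟩
  have := congrFun (congrFun hc 0) 0
  simpa [Matrix.mul_apply] using this

lemma IsCompletelyPositive.exists_two_by_two {φ : G →ₗ[ℂ] A} (hφ : IsCompletelyPositive φ)
    {u : G} (hu : ∀ x, u * x = x ∧ x * u = x) (y : G) :
    ∃ c : Matrix (Fin 2) (Fin 2) A,
      φ (y * star y) = ∑ k, star (c k 0) * c k 0 ∧ φ y = ∑ k, star (c k 0) * c k 1 ∧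
      φ (star y) = ∑ k, star (c k 1) * c k 0 := by
  have hus : star u = u := isSelfAdjoint_of_unit hu
  obtain ⟨c, hc⟩ := hφ 2 (star !![star y, u; 0, 0] * !![star y, u; 0, 0]) ⟨_, rfl⟩
  refine ⟨c, ?_, ?_, ?_⟩
  · have := congrFun (congrFun hc 0) 0
    simpa [Matrix.mul_apply] using this
  · have := congrFun (congrFun hc 0) 1
    simpa [Matrix.mul_apply, (hu y).2] using this
  · have := congrFun (congrFun hc 1) 0
    simpa [Matrix.mul_apply, hus, (hu _).1] using this

lemma IsCompletelyPositive.map_star {φ : G →ₗ[ℂ] A} (hφ : IsCompletelyPositive φ)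
    {u : G} (hu : ∀ x, u * x = x ∧ x * u = x) (y : G) : φ (star y) = star (φ y) := by
  obtain ⟨c, -, h1, h2⟩ := hφ.exists_two_by_two hu y
  rw [h1, h2, star_sum]
  simp

lemma IsOrderZero.mul_eq_zero {φ : G →ₗ[ℂ] A} (hφ : IsCompletelyPositive φ)
    (h0 : IsOrderZero φ) {u : G} (hu : ∀ x, u * x = x ∧ x * u = x) {c d : G}
    (hc : CStarNonneg c) (hcd : c * d = 0) (x : G) :
    φ c * φ (d * x) = 0 := by
  let _ := CStarAlgebra.spectralOrder A
  have _ := CStarAlgebra.spectralOrderedRing A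
  obtain ⟨C, h1, h2, -⟩ := hφ.exists_two_by_two hu (d * x)
  have hcn : CStarNonneg (φ c) := by
    obtain ⟨b, rfl⟩ := hc
    exact hφ.apply_star_mul_self b
  have hcs : star (φ c) = φ c := (cstarNonneg_iff.1 hcn).isSelfAdjoint
  have h3 : φ c * φ (d * x * star (d * x)) = 0 := by
    refine h0 _ _ hc ⟨star (d * x), by rw [star_star]⟩ ?_
    rw [← mul_assoc, ← mul_assoc, hcd, zero_mul, zero_mul]
  have h4 : ∑ k, star (C k 0 * φ c) * (C k 0 * φ c) = 0 := by
    have : φ c * φ (d * x * star (d * x)) * φ c = 0 := by rw [h3, zero_mul]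
    rw [h1] at this
    rw [← this, Finset.mul_sum, Finset.sum_mul]
    refine Finset.sum_congr rfl fun k _ => ?_
    rw [star_mul, hcs]
    simp only [mul_assoc]
  have h5 : ∀ k, C k 0 * φ c = 0 := by
    intro k
    have := (Finset.sum_eq_zero_iff_of_nonneg fun k _ => star_mul_self_nonneg (C k 0 * φ c)).1 h4 k
      (Finset.mem_univ k)
    exact CStarRing.star_mul_self_eq_zero_iff _ |>.1 this
  rw [h2, Finset.mul_sum]
  refine Finset.sum_eq_zero fun k _ => ?_
  have := congrArg star (h5 k)
  rw [star_mul, hcs, star_zero] at this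
  rw [← mul_assoc, this, zero_mul]

lemma IsStarProjection.cstarNonneg {p : G} (hp : IsStarProjection p) : CStarNonneg p :=
  ⟨p, by rw [hp.isSelfAdjoint.star_eq, hp.isIdempotentElem.eq]⟩

lemma IsOrderZero.mul_left [FiniteDimensional ℂ G] {φ : G →ₗ[ℂ] A} (hφ : IsCompletelyPositive φ)
    (h0 : IsOrderZero φ) {u : G} (hu : ∀ x, u * x = x ∧ x * u = x) (x y : G) :
    φ x * φ y = φ u * φ (x * y) := by
  have hx : x ∈ Submodule.span ℂ {p : G | IsStarProjection p} := by
    rw [span_isStarProjection]; trivial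
  induction hx using Submodule.span_induction with
  | zero => simp
  | add a b _ _ ha hb => rw [map_add, add_mul, ha, hb, add_mul, map_add, mul_add]
  | smul c a _ ha => rw [map_smul, smul_mul_assoc, ha, smul_mul_assoc, map_smul, mul_smul_comm]
  | mem p hp =>
    have hp : IsStarProjection p := hp
    have hus : star u = u := isSelfAdjoint_of_unit hu
    have hq : CStarNonneg (u - p) := by
      refine ⟨u - p, ?_⟩
      rw [star_sub, hus, hp.isSelfAdjoint.star_eq, mul_sub, sub_mul, sub_mul, (hu u).1, (hu p).1,
        (hu p).2, hp.isIdempotentElem.eq]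
      abel
    have e1 := IsOrderZero.mul_eq_zero hφ h0 hu (d := u - p) hp.cstarNonneg
      (by rw [mul_sub, (hu p).2, hp.isIdempotentElem.eq, sub_self]) y
    have e2 := IsOrderZero.mul_eq_zero hφ h0 hu (d := p) hq
      (by rw [sub_mul, (hu p).1, hp.isIdempotentElem.eq, sub_self]) y
    rw [sub_mul, (hu y).1, map_sub, mul_sub] at e1
    rw [map_sub, sub_mul] at e2
    rw [sub_eq_zero.1 e1, sub_eq_zero.1 e2]

end OrderZero

section Amplification

variable {A : Type} [NonUnitalCStarAlgebra A] [PartialOrder A] [StarOrderedRing A] {n : ℕ}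

lemma norm_cstarSingle_le (i j : Fin n) (p : A) : ‖cstarSingle i j p‖ ≤ ‖p‖ := by
  have hdiag : ∀ (j : Fin n) (p : A), ‖cstarSingle j j p‖ ≤ ‖p‖ := by
    intro j p
    let f : A →⋆ₙₐ[ℂ] CStarMatrix (Fin n) (Fin n) A :=
      { toFun := cstarSingle j j
        map_smul' := cstarSingle_smul j j
        map_zero' := Matrix.single_zero j j
        map_add' := cstarSingle_add j j
        map_mul' := fun p q => (cstarSingle_mul_cstarSingle j j j p q).symm
        map_star' := fun p => (star_cstarSingle j j p).symm }
    exact NonUnitalStarAlgHom.norm_apply_le f p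
  have h := CStarRing.norm_star_mul_self (x := cstarSingle i j p)
  rw [star_cstarSingle, cstarSingle_mul_cstarSingle] at h
  have h2 := hdiag j (star p * p)
  rw [h, CStarRing.norm_star_mul_self] at h2
  exact abs_le_of_sq_le_sq' (by nlinarith) (norm_nonneg _) |>.2

lemma norm_cstarMatrix_le (x : CStarMatrix (Fin n) (Fin n) A) {C : ℝ}
    (h : ∀ i j, ‖x i j‖ ≤ C) : ‖x‖ ≤ (n : ℝ) * n * C := by
  rw [sum_cstarSingle x]
  refine (norm_sum_le _ _).trans ((Finset.sum_le_card_nsmul _ _ ((n : ℝ) * C) fun i _ => ?_).trans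
    (le_of_eq (by simp; ring)))
  refine (norm_sum_le _ _).trans ((Finset.sum_le_card_nsmul _ _ C fun j _ => ?_).trans
    (le_of_eq (by simp)))
  exact (norm_cstarSingle_le _ _ _).trans (h i j)

lemma norm_cstarMatrix_map_le {B : Type} [NonUnitalCStarAlgebra B]
    [PartialOrder B] [StarOrderedRing B] {φ : A →ₗ[ℂ] B}
    (hφ : ∀ a, ‖φ a‖ ≤ ‖a‖) (x : CStarMatrix (Fin n) (Fin n) A) :
    ‖(CStarMatrix.mapₗ φ x : CStarMatrix (Fin n) (Fin n) B)‖ ≤ (n : ℝ) * n * ‖x‖ :=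
  norm_cstarMatrix_le _ fun _ _ => (hφ _).trans CStarMatrix.norm_entry_le_norm

lemma IsCompletelyPositive.mapₗ_nonneg {B : Type} [NonUnitalCStarAlgebra B]
    [PartialOrder B] [StarOrderedRing B]
    {φ : A →ₗ[ℂ] B} (hφ : IsCompletelyPositive φ)
    {x : CStarMatrix (Fin n) (Fin n) A} (hx : 0 ≤ x) :
    (0 : CStarMatrix (Fin n) (Fin n) B) ≤ CStarMatrix.mapₗ φ x := by
  obtain ⟨b, hb⟩ := cstarNonneg_iff.2 hx
  obtain ⟨c, hc⟩ := hφ n x ⟨b, hb⟩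
  exact cstarNonneg_iff.1 ⟨c, hc⟩

/-- Approximate factorisations of the identity of `M` through finite dimensional C*-algebras, with
`k + 1` order zero maps going up and all maps bounded by `K`. -/
def HasOrderZeroApprox (M : Type*) [NonUnitalCStarAlgebra M] [PartialOrder M] (k : ℕ) (K : ℝ) :
    Prop :=
  ∀ (F : Finset M) (ε : ℝ), 0 < ε → ∃ (G : Type) (_ : NonUnitalCStarAlgebra G)
    (_ : FiniteDimensional ℂ G) (_ : PartialOrder G) (_ : StarOrderedRing G) (u : G)
    (Ψ : M →ₗ[ℂ] G) (Φ : Fin (k + 1) → (G →ₗ[ℂ] M)),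
    (∀ x, u * x = x ∧ x * u = x) ∧ (∀ x, 0 ≤ x → 0 ≤ Ψ x) ∧ (∀ x, ‖Ψ x‖ ≤ K * ‖x‖) ∧
    (∀ i, IsOrderZeroLike u K (Φ i)) ∧ ∀ a ∈ F, ‖(∑ i, Φ i (Ψ a)) - a‖ ≤ ε

theorem NuclearDimLE.hasOrderZeroApprox {k : ℕ}
    (hA : NuclearDimLE A k) (n : ℕ) :
    HasOrderZeroApprox (CStarMatrix (Fin n) (Fin n) A) k ((n : ℝ) * n + 1) := by
  classical
  intro F ε hε
  have hK : (0 : ℝ) < (n : ℝ) * n + 1 := by positivity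
  obtain ⟨H, _, _, ψ, φ, hψ, hφ, happ⟩ := hA
    (F.biUnion fun x => Finset.univ.image fun ij : Fin n × Fin n => x ij.1 ij.2)
    (ε / ((n : ℝ) * n + 1)) (by positivity)
  let _ := CStarAlgebra.spectralOrder H
  have _ := CStarAlgebra.spectralOrderedRing H
  obtain ⟨u, hu⟩ := exists_unit H
  have hfin : FiniteDimensional ℂ (CStarMatrix (Fin n) (Fin n) H) :=
    inferInstanceAs (FiniteDimensional ℂ (Matrix (Fin n) (Fin n) H))
  refine ⟨CStarMatrix (Fin n) (Fin n) H, inferInstance, hfin, inferInstance, inferInstance,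
    CStarMatrix.ofMatrix (Matrix.diagonal fun _ => u), CStarMatrix.mapₗ ψ,
    fun i => CStarMatrix.mapₗ (φ i), ?_, fun x hx => hψ.1.mapₗ_nonneg hx, ?_, ?_, ?_⟩
  · intro x
    constructor
    · ext i j
      rw [CStarMatrix.mul_apply, Finset.sum_eq_single i]
      · simp [hu]
      · intro l _ hl
        simp [Matrix.diagonal_apply_ne' _ hl]
      · simp
    · ext i j
      rw [CStarMatrix.mul_apply, Finset.sum_eq_single j]
      · simp [hu]
      · intro l _ hl
        simp [Matrix.diagonal_apply_ne _ hl]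
      · simp
  · intro x
    have := norm_cstarMatrix_map_le hψ.2 x
    nlinarith [norm_nonneg x]
  · intro i
    obtain ⟨hcp, hoz⟩ := hφ i
    have hml : ∀ x y : CStarMatrix (Fin n) (Fin n) H, CStarMatrix.mapₗ (φ i) x *
        CStarMatrix.mapₗ (φ i) y = CStarMatrix.mapₗ (φ i)
          (CStarMatrix.ofMatrix (Matrix.diagonal fun _ => u)) * CStarMatrix.mapₗ (φ i) (x * y) := by
      intro x y
      ext a b
      rw [CStarMatrix.mul_apply, CStarMatrix.mul_apply, Finset.sum_eq_single a (s := Finset.univ)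
        (f := fun c => (CStarMatrix.mapₗ (φ i) (CStarMatrix.ofMatrix (Matrix.diagonal fun _ => u)) :
          CStarMatrix (Fin n) (Fin n) A) a c *
          (CStarMatrix.mapₗ (φ i) (x * y) : CStarMatrix (Fin n) (Fin n) A) c b)]
      · change ∑ c, φ i (x a c) * φ i (y c b) = φ i (Matrix.diagonal (fun _ => u) a a) *
          φ i ((x * y) a b)
        rw [Matrix.diagonal_apply_eq, CStarMatrix.mul_apply, map_sum, Finset.mul_sum]
        exact Finset.sum_congr rfl fun c _ => IsOrderZero.mul_left hcp.1 hoz hu _ _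
      · intro l _ hl
        change φ i (Matrix.diagonal (fun _ => u) a l) * _ = 0
        rw [Matrix.diagonal_apply_ne' _ hl, map_zero, zero_mul]
      · simp
    have hst : ∀ x : CStarMatrix (Fin n) (Fin n) H, CStarMatrix.mapₗ (φ i) (star x) =
        star (CStarMatrix.mapₗ (φ i) x : CStarMatrix (Fin n) (Fin n) A) := by
      intro x
      ext a b
      exact hcp.1.map_star hu _
    refine ⟨fun x hx => hcp.1.mapₗ_nonneg hx, hst, fun x => ?_, hml, fun x y => ?_⟩
    · have := norm_cstarMatrix_map_le hcp.2 x
      nlinarith [norm_nonneg x]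
    · have hus : star (CStarMatrix.ofMatrix (Matrix.diagonal fun _ : Fin n => u)) =
          CStarMatrix.ofMatrix (Matrix.diagonal fun _ : Fin n => u) := by
        change (Matrix.diagonal fun _ : Fin n => u).conjTranspose = _
        rw [Matrix.diagonal_conjTranspose]
        congr 1
        ext i
        exact isSelfAdjoint_of_unit hu
      have := congrArg star (hml (star y) (star x))
      rwa [star_mul, ← hst, ← hst, star_star, star_star, star_mul, ← hst, ← hst, hus, star_mul,
        star_star, star_star] at this
  · intro x hx
    refine (norm_cstarMatrix_le (C := ε / ((n : ℝ) * n + 1)) _ fun a b => ?_).trans ?_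
    · have h1 := happ (x a b) (Finset.mem_biUnion.2 ⟨x, hx, Finset.mem_image.2
        ⟨(a, b), Finset.mem_univ _, rfl⟩⟩)
      convert h1 using 2
      change (∑ i, (CStarMatrix.mapₗ (φ i) (CStarMatrix.mapₗ ψ x) :
        CStarMatrix (Fin n) (Fin n) A)) a b - x a b = _
      congr 1
      exact Matrix.sum_apply a b _ _
    · rw [mul_div_assoc', div_le_iff₀ hK]
      nlinarith

end Amplification

section GoodPart

variable {M : Type*} [NonUnitalCStarAlgebra M] [PartialOrder M] [StarOrderedRing M]

lemma cutDown_mul_self_eq (δ : ℝ) (hδ : 0 ≤ δ) {h : M} (hh : 0 ≤ h) :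
    cutDown δ h * h = cutDown δ h * cutDown δ h + δ • cutDown δ h := by
  have h1 : cutDown δ h * h = cfcₙ (fun t : ℝ => max (t - δ) 0 * t) h := by
    rw [cfcₙ_mul (fun t : ℝ => max (t - δ) 0) (fun t => t) h (by fun_prop) (by simpa using hδ)
      (by fun_prop) rfl, cfcₙ_id' ℝ h]
  have h2 : cutDown δ h * cutDown δ h + δ • cutDown δ h =
      cfcₙ (fun t : ℝ => max (t - δ) 0 * max (t - δ) 0 + δ • max (t - δ) 0) h := by
    rw [cfcₙ_add (fun t : ℝ => max (t - δ) 0 * max (t - δ) 0) (fun t => δ • max (t - δ) 0) h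
      (by fun_prop) (by simp [hδ]) (by fun_prop) (by simp [hδ]),
      cfcₙ_mul (fun t : ℝ => max (t - δ) 0) (fun t => max (t - δ) 0) h (by fun_prop)
        (by simpa using hδ) (by fun_prop) (by simpa using hδ),
      cfcₙ_smul (R := ℝ) δ (fun t => max (t - δ) 0) h (by fun_prop) (by simpa using hδ)]
  rw [h1, h2]
  congr 1
  ext t
  rcases le_total (t - δ) 0 with ht | ht
  · rw [max_eq_right ht]; simp
  · rw [max_eq_left ht, smul_eq_mul]; ring

lemma cutDown_commute {δ : ℝ} {h R : M} (hc : Commute h R) :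
    Commute (cutDown δ h) R :=
  hc.cfcₙ_real _

lemma cutDown_mul_cutDown_mul_nonneg {δ : ℝ} {h R : M} (hh : 0 ≤ h) (hR : 0 ≤ R)
    (hc : Commute h R) : 0 ≤ cutDown δ h * cutDown δ h * h * R := by
  have hk := cutDown_commute (δ := δ) hc
  have hkh : Commute (cutDown δ h) h := cutDown_commute (Commute.refl h)
  have hk0 := cutDown_nonneg δ h
  exact Commute.mul_nonneg (Commute.mul_nonneg (Commute.mul_nonneg hk0 hk0 (Commute.refl _)) hh
    (hkh.mul_left hkh)) hR ((hk.mul_left hk).mul_left hc)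

lemma CuntzBelow.cutDown_mul_of_le {h R a e : M} {θ δ : ℝ} (hh : 0 ≤ h) (hR : 0 ≤ R)
    (ha : 0 ≤ a) (hRR : R * R = h * R) (hc : Commute h R) (hδ : 0 ≤ δ)
    (hle : θ • R ≤ a + e) (he : IsSelfAdjoint e) (heδ : ‖e‖ < θ * δ) :
    CuntzBelow (cutDown δ h * cutDown δ h * h * R) a := by
  set k := cutDown δ h with hk_def
  have hk : Commute k R := cutDown_commute hc
  have hkh : Commute k h := cutDown_commute (Commute.refl h)
  have hk0 : 0 ≤ k := cutDown_nonneg δ h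
  have hkk := cutDown_mul_self_eq δ hδ hh
  rw [← hk_def] at hkk
  set X := k * R with hX
  have hXs : star X = X := by
    rw [hX, star_mul, hR.isSelfAdjoint.star_eq, hk0.isSelfAdjoint.star_eq, hk.eq]
  have hXX : X * X = k * k * h * R := by
    rw [hX, mul_assoc k R, ← mul_assoc R k, ← hk.eq, mul_assoc k R, hRR]
    simp only [mul_assoc]
  have hXRX : X * R * X = k * k * k * h * R + δ • (k * k * h * R) := by
    have h1 : X * R * X = k * (k * h) * h * R := by
      rw [hX, mul_assoc k R R, hRR, mul_assoc k, mul_assoc h, ← mul_assoc R k R, ← hk.eq,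
        mul_assoc k R, hRR, ← mul_assoc h k, ← hkh.eq]
      simp only [mul_assoc]
    rw [h1, hkk]
    simp only [mul_add, add_mul, mul_smul_comm, smul_mul_assoc, mul_assoc]
  have h3 : X * (θ • R) * X ≤ X * (a + e) * X := by
    have := star_left_conjugate_le_conjugate hle X
    rwa [hXs] at this
  have h4 : X * e * X ≤ ‖e‖ • (k * k * h * R) := by
    have := conj_le_norm_smul_mul_self (g := X) hXs he
    rwa [hXX] at this
  set B := k * k * h * R with hB
  have hB0 : 0 ≤ B := cutDown_mul_cutDown_mul_nonneg hh hR hc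
  have hkB0 : 0 ≤ k * k * k * h * R := by
    have : Commute k B := ((((Commute.refl k).mul_right (Commute.refl k)).mul_right hkh).mul_right hk)
    have := Commute.mul_nonneg hk0 hB0 this
    rw [hB] at this
    simpa only [mul_assoc] using this
  have hθ : 0 ≤ θ := by
    by_contra hneg
    push Not at hneg
    nlinarith [norm_nonneg e]
  have h5 : (θ * δ - ‖e‖) • B ≤ X * a * X := by
    rw [mul_smul_comm, smul_mul_assoc, hXRX, mul_add, add_mul] at h3
    rw [sub_smul, sub_le_iff_le_add]
    calc (θ * δ) • B ≤ θ • (k * k * k * h * R + δ • B) := by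
          rw [smul_add, smul_smul]
          exact le_add_of_nonneg_left (smul_nonneg hθ hkB0)
      _ ≤ _ := h3
      _ ≤ _ := by gcongr
  have hpos : 0 < θ * δ - ‖e‖ := by linarith
  have h6 : B ≤ (θ * δ - ‖e‖)⁻¹ • (X * a * X) := by
    have := smul_le_smul_of_nonneg_left h5 (inv_nonneg.2 hpos.le)
    rwa [smul_smul, inv_mul_cancel₀ hpos.ne', one_smul] at this
  have h7 : 0 ≤ X * a * X := by
    have := star_left_conjugate_nonneg ha X
    rwa [hXs] at this
  refine (CuntzBelow.of_le hB0 h6).trans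
    ((CuntzBelow.smul_self h7 (inv_nonneg.2 hpos.le)).trans ?_)
  have := CuntzBelow.conj X a
  rwa [hXs] at this

/-- `a` is dominated by `b` up to a selfadjoint error of norm at most `ε`. -/
def LeUpTo (ε : ℝ) (a b : M) : Prop := ∃ e : M, IsSelfAdjoint e ∧ ‖e‖ ≤ ε ∧ a ≤ b + e

lemma LeUpTo.of_le {a b : M} (h : a ≤ b) : LeUpTo 0 a b := ⟨0, .zero _, by simp, by simpa using h⟩

lemma LeUpTo.of_norm {a : M} (ha : IsSelfAdjoint a) {ε : ℝ} (h : ‖a‖ ≤ ε) : LeUpTo ε a 0 :=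
  ⟨a, ha, h, by simp⟩

lemma LeUpTo.add {ε δ : ℝ} {a b c d : M} (h : LeUpTo ε a b) (h' : LeUpTo δ c d) :
    LeUpTo (ε + δ) (a + c) (b + d) := by
  obtain ⟨e, he, hn, hle⟩ := h
  obtain ⟨f, hf, hn', hle'⟩ := h'
  exact ⟨e + f, he.add hf, (norm_add_le _ _).trans (add_le_add hn hn'),
    (add_le_add hle hle').trans (le_of_eq (by abel))⟩

lemma LeUpTo.sum {ι : Type*} (s : Finset ι) {ε : ℝ} {a b : ι → M}
    (h : ∀ i ∈ s, LeUpTo ε (a i) (b i)) :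
    LeUpTo (s.card * ε) (∑ i ∈ s, a i) (∑ i ∈ s, b i) := by
  classical
  induction s using Finset.induction_on with
  | empty => simpa using LeUpTo.of_le (le_refl (0 : M))
  | insert i s hi ih =>
    rw [Finset.sum_insert hi, Finset.sum_insert hi, Finset.card_insert_of_notMem hi]
    have := (h i (Finset.mem_insert_self _ _)).add
      (ih fun j hj => h j (Finset.mem_insert_of_mem hj))
    convert this using 1
    push_cast; ring

lemma LeUpTo.smul {ε : ℝ} {a b : M} (h : LeUpTo ε a b) {C : ℝ} (hC : 0 ≤ C) :
    LeUpTo (C * ε) (C • a) (C • b) := by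
  obtain ⟨e, he, hn, hle⟩ := h
  refine ⟨C • e, IsSelfAdjoint.smul (by simp [isSelfAdjoint_iff]) he, ?_, ?_⟩
  · rw [norm_smul, Real.norm_of_nonneg hC]
    gcongr
  · rw [← smul_add]
    exact smul_le_smul_of_nonneg_left hle hC

lemma LeUpTo.trans {ε δ : ℝ} {a b c : M} (h : LeUpTo ε a b) (h' : LeUpTo δ b c) :
    LeUpTo (ε + δ) a c := by
  obtain ⟨e, he, hn, hle⟩ := h
  obtain ⟨f, hf, hn', hle'⟩ := h'
  refine ⟨f + e, hf.add he, ?_, ?_⟩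
  · exact (norm_add_le _ _).trans (by linarith)
  · calc a ≤ b + e := hle
      _ ≤ c + f + e := by gcongr
      _ = _ := by abel

lemma LeUpTo.mono {ε δ : ℝ} {a b : M} (h : LeUpTo ε a b) (hεδ : ε ≤ δ) : LeUpTo δ a b := by
  obtain ⟨e, he, hn, hle⟩ := h
  exact ⟨e, he, hn.trans hεδ, hle⟩

lemma LeUpTo.cutDown_cuntzBelow {ε C : ℝ} {a b : M} (h : LeUpTo ε a (C • b)) (ha : 0 ≤ a)
    (hb : 0 ≤ b) (hC : 0 ≤ C) : CuntzBelow (cutDown ε a) b := by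
  obtain ⟨e, he, hn, hle⟩ := h
  exact (CuntzBelow.cutDown_of_le_add ha he hle hn).trans (CuntzBelow.smul_self hb hC)

lemma leUpTo_cutDown_mul {h P : M} {δ K : ℝ} (hh : 0 ≤ h) (hP : 0 ≤ P)
    (hPP : P * P = h * P) (hc : Commute h P) (hδ : 0 < δ) (hK : ‖P‖ ≤ K) :
    LeUpTo √(2 * δ * K) P ((2 * δ ^ 3)⁻¹ • (cutDown δ h * cutDown δ h * h * P)) := by
  set k := cutDown δ h with hk_def
  set C : ℝ := (2 * δ ^ 3)⁻¹ with hC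
  have hC0 : 0 ≤ C := by positivity
  have hk : Commute k P := cutDown_commute hc
  let w : ℝ → ℝ := fun t => max (t - δ) 0 * max (t - δ) 0 * t
  let l : ℝ → ℝ := fun t => min 1 (C * w t)
  have hwc : Continuous w := by fun_prop
  have hlc : Continuous l := by fun_prop
  have hw0 : w 0 = 0 := by simp [w]
  have hl0 : l 0 = 0 := by simp [l, hw0]
  have hkkh : k * k * h = cfcₙ w h := by
    rw [cfcₙ_mul (fun t : ℝ => max (t - δ) 0 * max (t - δ) 0) (fun t => t) h (by fun_prop)
      (by simp [hδ.le]) (by fun_prop) rfl,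
      cfcₙ_mul (fun t : ℝ => max (t - δ) 0) (fun t => max (t - δ) 0) h (by fun_prop)
        (by simpa using hδ.le) (by fun_prop) (by simpa using hδ.le), cfcₙ_id' ℝ h]
  set L := cfcₙ l h with hL
  have hLP : Commute L P := hc.cfcₙ_real _
  have hLh : Commute L h := (Commute.refl h).cfcₙ_real _
  have hLs : IsSelfAdjoint L := cfcₙ_predicate _ _
  have hPs := hP.isSelfAdjoint
  refine ⟨P - L * P, ?_, ?_, ?_⟩
  · refine hPs.sub ?_
    rw [isSelfAdjoint_iff, star_mul, hPs.star_eq, hLs.star_eq, hLP.eq]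
  · have hes : star (P - L * P) = P - L * P := by
      rw [star_sub, star_mul, hPs.star_eq, hLs.star_eq, hLP.eq]
    have hm : (P - L * P) * (P - L * P) = (h - L * h - L * h + L * (L * h)) * P := by
      have e1 : P * (L * P) = L * (h * P) := by rw [← mul_assoc, ← hLP.eq, mul_assoc, hPP]
      have e2 : L * P * P = L * (h * P) := by rw [mul_assoc, hPP]
      have e3 : L * P * (L * P) = L * (L * (h * P)) := by rw [mul_assoc, e1]
      rw [mul_sub, sub_mul, sub_mul, e1, e2, e3, hPP]
      simp only [add_mul, sub_mul, mul_assoc]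
      abel
    have hmn : ‖h - L * h - L * h + L * (L * h)‖ ≤ 2 * δ := by
      have : h - L * h - L * h + L * (L * h) =
          cfcₙ (fun t : ℝ => t - l t * t - l t * t + l t * (l t * t)) h := by
        rw [cfcₙ_add (fun t : ℝ => t - l t * t - l t * t) (fun t => l t * (l t * t)) h
          (by fun_prop) (by simp) (by fun_prop) (by simp),
          cfcₙ_sub (fun t : ℝ => t - l t * t) (fun t => l t * t) h
          (by fun_prop) (by simp) (by fun_prop) (by simp),
          cfcₙ_sub (fun t : ℝ => t) (fun t => l t * t) h
          (by fun_prop) (by simp) (by fun_prop) (by simp),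
          cfcₙ_mul l (fun t => l t * t) h (by fun_prop) hl0 (by fun_prop) (by simp),
          cfcₙ_mul l (fun t => t) h (by fun_prop) hl0 (by fun_prop) (by simp), cfcₙ_id' ℝ h]
      rw [this]
      refine norm_cfcₙ_le fun t ht => ?_
      have ht0 := quasispectrum_nonneg_of_nonneg h hh t ht
      have hw : 0 ≤ C * w t := by positivity
      have h1 : t - l t * t - l t * t + l t * (l t * t) = t * (1 - l t) ^ 2 := by ring
      have hl1 : l t ≤ 1 := min_le_left _ _
      have hl2 : 0 ≤ l t := le_min zero_le_one hw
      rw [h1, Real.norm_of_nonneg (by positivity)]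
      rcases le_total t (2 * δ) with htd | htd
      · have : (1 - l t) ^ 2 ≤ 1 := by nlinarith
        nlinarith
      · have hlt : l t = 1 := by
          refine min_eq_left ?_
          have hm : δ ≤ max (t - δ) 0 := le_max_of_le_left (by linarith)
          have hw' : 2 * δ ^ 3 ≤ w t := by
            calc 2 * δ ^ 3 = δ * δ * (2 * δ) := by ring
              _ ≤ _ := by
                show _ ≤ max (t - δ) 0 * max (t - δ) 0 * t
                gcongr
          rw [hC, inv_mul_eq_div, le_div_iff₀ (by positivity)]
          simpa using hw'
        rw [hlt]
        simp; positivity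
    have h2 : ‖P - L * P‖ ^ 2 ≤ 2 * δ * K := by
      rw [sq, ← CStarRing.norm_star_mul_self, hes, hm]
      exact (norm_mul_le _ _).trans (mul_le_mul hmn hK (norm_nonneg _) (by positivity))
    exact Real.le_sqrt_of_sq_le h2
  · have h1 : 0 ≤ (C • (k * k * h) - L) * P := by
      refine Commute.mul_nonneg ?_ hP (((((hk.mul_left hk).mul_left hc).smul_left C).sub_left hLP))
      rw [sub_nonneg, hkkh, hL, ← cfcₙ_smul (R := ℝ) C w h (by fun_prop) hw0]
      exact cfcₙ_mono (fun t _ => min_le_right _ _) (by fun_prop) (by fun_prop) hl0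
        (by simp [hw0])
    rw [sub_mul, smul_mul_assoc, sub_nonneg] at h1
    calc P = L * P + (P - L * P) := by abel
      _ ≤ _ := by gcongr

end GoodPart

section OrthogonalProjections

variable {G : Type*} [NonUnitalCStarAlgebra G]

lemma sum_mul_sum_of_orthogonal {ι : Type*} {e : ι → G}
    (horth : ∀ i j, i ≠ j → e i * e j = 0) (s : Finset ι) :
    (∑ i ∈ s, e i) * ∑ i ∈ s, e i = ∑ i ∈ s, e i * e i := by
  rw [Finset.sum_mul_sum]
  refine Finset.sum_congr rfl fun i hi => ?_
  rw [Finset.sum_eq_single i (fun j _ hj => horth i j hj.symm) (fun h => (h hi).elim)]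

lemma isStarProjection_sum_of_orthogonal {ι : Type*} {e : ι → G}
    (he : ∀ i, IsStarProjection (e i)) (horth : ∀ i j, i ≠ j → e i * e j = 0) (s : Finset ι) :
    IsStarProjection (∑ i ∈ s, e i) := by
  refine ⟨?_, ?_⟩
  · change _ * _ = _
    rw [sum_mul_sum_of_orthogonal horth]
    exact Finset.sum_congr rfl fun i _ => (he i).isIdempotentElem.eq
  · rw [isSelfAdjoint_iff, star_sum]
    exact Finset.sum_congr rfl fun i _ => (he i).isSelfAdjoint.star_eq

variable [PartialOrder G] [StarOrderedRing G]

lemma mul_self_le_norm_smul {x : G} (hx : 0 ≤ x) : x * x ≤ ‖x‖ • x := by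
  have h := CStarAlgebra.star_left_conjugate_le_norm_smul (a := CFC.sqrt x) (b := x)
    hx.isSelfAdjoint
  rw [(CFC.sqrt_nonneg x).isSelfAdjoint.star_eq, CFC.sqrt_mul_sqrt_self x hx] at h
  have : CFC.sqrt x * x * CFC.sqrt x = x * x := by
    conv_lhs => enter [1, 2]; rw [← CFC.sqrt_mul_sqrt_self x hx]
    rw [← mul_assoc, CFC.sqrt_mul_sqrt_self x hx, mul_assoc, CFC.sqrt_mul_sqrt_self x hx]
  rwa [this] at h

open scoped ComplexOrder in
lemma nonneg_of_smul_nonneg {e : G} (he : IsStarProjection e) (hne : e ≠ 0) {c : ℂ}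
    (h : 0 ≤ c • e) : 0 ≤ c := by
  have h1 : star c = c := by
    have := h.isSelfAdjoint.star_eq
    rw [star_smul, he.isSelfAdjoint.star_eq, ← sub_eq_zero, ← sub_smul] at this
    exact sub_eq_zero.1 ((smul_eq_zero.1 this).resolve_right hne)
  obtain ⟨r, rfl⟩ := Complex.conj_eq_iff_real.1 h1
  by_contra hneg
  have hr : r < 0 := by
    by_contra h0
    exact hneg (Complex.zero_le_real.2 (not_lt.1 h0))
  rw [Complex.coe_smul] at h
  have h2 : 0 ≤ (-r) • e := smul_nonneg (by linarith) he.nonneg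
  rw [neg_smul, neg_nonneg] at h2
  have h3 := le_antisymm h2 h
  exact hne ((smul_eq_zero.1 h3).resolve_left hr.ne)

lemma eigenvalue_real {y e : G} (hy : 0 ≤ y) (he : IsStarProjection e) (hne : e ≠ 0) {l : ℂ}
    (h : y * e = l • e) : ∃ r : ℝ, 0 ≤ r ∧ r ≤ ‖y‖ ∧ y * e = r • e := by
  have h1 := star_left_conjugate_nonneg hy e
  rw [he.isSelfAdjoint.star_eq, mul_assoc, h, mul_smul_comm, he.isIdempotentElem.eq] at h1
  have h2 := nonneg_of_smul_nonneg he hne h1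
  have h3 : ‖l‖ ≤ ‖y‖ := by
    have h4 := norm_mul_le y e
    rw [h, norm_smul] at h4
    exact le_of_mul_le_mul_right h4 (norm_pos_iff.2 hne)
  have h5 := Complex.eq_coe_norm_of_nonneg h2
  refine ⟨‖l‖, norm_nonneg _, h3, ?_⟩
  rw [h, ← Complex.coe_smul, ← h5]

lemma le_of_mul_eq {q r : G} (hq : IsStarProjection q) (hr : IsStarProjection r)
    (h1 : q * r = r) : r ≤ q := by
  have h2 : r * q = r := by
    have := congrArg star h1
    rwa [star_mul, hq.isSelfAdjoint.star_eq, hr.isSelfAdjoint.star_eq] at this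
  have : q - r = star (q - r) * (q - r) := by
    rw [star_sub, hq.isSelfAdjoint.star_eq, hr.isSelfAdjoint.star_eq, mul_sub, sub_mul, sub_mul,
      h1, h2, hq.isIdempotentElem.eq, hr.isIdempotentElem.eq]
    abel
  rw [← sub_nonneg, this]
  exact star_mul_self_nonneg _

end OrthogonalProjections

namespace IsOrderZeroLike

variable {G M : Type*} [NonUnitalCStarAlgebra G] [PartialOrder G] [StarOrderedRing G]
  [NonUnitalCStarAlgebra M] [PartialOrder M] [StarOrderedRing M] {u : G} {K : ℝ} {Φ : G →ₗ[ℂ] M}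

lemma mono (hΦ : IsOrderZeroLike u K Φ) {x y : G} (h : x ≤ y) : Φ x ≤ Φ y := by
  rw [← sub_nonneg, ← map_sub]
  exact hΦ.nonneg _ (sub_nonneg.2 h)

lemma map_real_smul (r : ℝ) (x : G) : Φ (r • x) = r • Φ x := by
  rw [← Complex.coe_smul, map_smul, Complex.coe_smul]

lemma isSelfAdjoint (hΦ : IsOrderZeroLike u K Φ) {x : G} (h : IsSelfAdjoint x) :
    IsSelfAdjoint (Φ x) := by
  rw [isSelfAdjoint_iff, ← hΦ.map_star, h.star_eq]

lemma commute_unit (hΦ : IsOrderZeroLike u K Φ) (hu : ∀ x, u * x = x ∧ x * u = x) (x : G) :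
    Commute (Φ u) (Φ x) := by
  have := hΦ.mul_right u x
  rwa [(hu x).1] at this

lemma unit_nonneg (hΦ : IsOrderZeroLike u K Φ) (hu : ∀ x, u * x = x ∧ x * u = x) : 0 ≤ Φ u :=
  hΦ.nonneg _ (isStarProjection_of_unit hu).nonneg

/-- The lift through an order zero map of an element of the domain, cut down by the image of the
unit. -/
noncomputable def lift (u : G) (Φ : G →ₗ[ℂ] M) (δ : ℝ) (v : G) : M := cutDown δ (Φ u) * Φ v

lemma lift_mul_lift (hΦ : IsOrderZeroLike u K Φ) (hu : ∀ x, u * x = x ∧ x * u = x) (δ : ℝ)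
    (v w : G) : lift u Φ δ v * lift u Φ δ w =
      cutDown δ (Φ u) * cutDown δ (Φ u) * Φ u * Φ (v * w) := by
  have hc : Commute (cutDown δ (Φ u)) (Φ v) := cutDown_commute (hΦ.commute_unit hu v)
  rw [lift, lift, mul_assoc, ← mul_assoc (Φ v), ← hc.eq, mul_assoc _ (Φ v), hΦ.mul_left]
  simp only [mul_assoc]

lemma star_lift (hΦ : IsOrderZeroLike u K Φ) (hu : ∀ x, u * x = x ∧ x * u = x) (δ : ℝ) (v : G) :
    star (lift u Φ δ v) = lift u Φ δ (star v) := by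
  have hc : Commute (cutDown δ (Φ u)) (Φ (star v)) :=
    cutDown_commute (hΦ.commute_unit hu (star v))
  rw [lift, lift, star_mul, ← hΦ.map_star, (cutDown_isSelfAdjoint _ _).star_eq, hc.eq]

lemma norm_sum_le_of_orthogonal (hΦ : IsOrderZeroLike u K Φ) {ι : Type*} {e : ι → G}
    (he : ∀ i, IsStarProjection (e i)) (horth : ∀ i j, i ≠ j → e i * e j = 0) (s : Finset ι)
    {δ : ℝ} (hδ : 0 ≤ δ) (h : ∀ i ∈ s, ‖Φ (e i)‖ ≤ δ) : ‖∑ i ∈ s, Φ (e i)‖ ≤ δ := by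
  have hpos : ∀ i, 0 ≤ Φ (e i) := fun i => hΦ.nonneg _ (he i).nonneg
  set S := ∑ i ∈ s, Φ (e i) with hS
  have hS0 : 0 ≤ S := Finset.sum_nonneg fun i _ => hpos i
  have h1 : S * S ≤ δ • S := by
    rw [hS, sum_mul_sum_of_orthogonal (fun i j hij => by
      rw [hΦ.mul_left, horth i j hij, map_zero, mul_zero]), Finset.smul_sum]
    refine Finset.sum_le_sum fun i hi => (mul_self_le_norm_smul (hpos i)).trans ?_
    exact smul_le_smul_of_nonneg_right (h i hi) (hpos i)
  have h2 : ‖S‖ * ‖S‖ ≤ δ * ‖S‖ := by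
    have h3 := CStarAlgebra.norm_le_norm_of_nonneg_of_le
      (Commute.mul_nonneg hS0 hS0 (Commute.refl _)) h1
    have h4 := CStarRing.norm_star_mul_self (x := S)
    rw [hS0.isSelfAdjoint.star_eq] at h4
    rwa [h4, norm_smul, Real.norm_of_nonneg hδ] at h3
  rcases (norm_nonneg S).eq_or_lt with h0 | h0
  · rwa [← h0]
  · exact le_of_mul_le_mul_right h2 h0

lemma leUpTo_of_decomposition (hΦ : IsOrderZeroLike u K Φ) (hK : 0 ≤ K) {y : G} (hy : 0 ≤ y)
    {ι : Type*} [Fintype ι] {e : ι → G} (he : ∀ i, IsStarProjection (e i))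
    (horth : ∀ i j, i ≠ j → e i * e j = 0) {r : ι → ℝ} (hye : ∀ i, y * e i = r i • e i)
    {L θ θ₀ δ₀ : ℝ} (hrL : ∀ i, r i ≤ L) (hL : 0 ≤ L) (hθ₀ : 0 ≤ θ₀)
    (hδ₀ : 0 ≤ δ₀) (hq : ‖y - y * ∑ i, e i‖ ≤ θ) (I : Finset ι)
    (hbad : ∀ i ∉ I, r i ≤ θ₀ ∨ ‖Φ (e i)‖ ≤ δ₀) :
    LeUpTo (K * θ + (θ₀ * K + L * δ₀)) (Φ y) (L • Φ (∑ i ∈ I, e i)) := by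
  classical
  have hpos : ∀ i, 0 ≤ Φ (e i) := fun i => hΦ.nonneg _ (he i).nonneg
  have hyq : y * ∑ i, e i = ∑ i, r i • e i := by
    rw [Finset.mul_sum]; exact Finset.sum_congr rfl fun i _ => hye i
  have hdec : Φ y = Φ (y - y * ∑ i, e i) + (∑ i ∈ I, r i • Φ (e i) +
      (∑ i ∈ Iᶜ with r i ≤ θ₀, r i • Φ (e i) + ∑ i ∈ Iᶜ with ¬ r i ≤ θ₀, r i • Φ (e i))) := by
    rw [Finset.sum_filter_add_sum_filter_not, Finset.sum_add_sum_compl, map_sub, hyq, map_sum]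
    simp only [map_real_smul, sub_add_cancel]
  have h1 : LeUpTo (K * θ) (Φ (y - y * ∑ i, e i)) 0 := by
    refine LeUpTo.of_norm (hΦ.isSelfAdjoint ?_) ((hΦ.norm_le _).trans (by gcongr))
    rw [hyq]
    refine hy.isSelfAdjoint.sub ?_
    rw [isSelfAdjoint_iff, star_sum]
    exact Finset.sum_congr rfl fun i _ => by
      rw [star_smul, (he i).isSelfAdjoint.star_eq, star_trivial]
  have h2 : LeUpTo 0 (∑ i ∈ I, r i • Φ (e i)) (L • Φ (∑ i ∈ I, e i)) := by
    refine LeUpTo.of_le ?_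
    rw [map_sum, Finset.smul_sum]
    exact Finset.sum_le_sum fun i _ => smul_le_smul_of_nonneg_right (hrL i) (hpos i)
  have h3 : LeUpTo (θ₀ * K) (∑ i ∈ Iᶜ with r i ≤ θ₀, r i • Φ (e i)) 0 := by
    have hle : ∑ i ∈ Iᶜ with r i ≤ θ₀, r i • Φ (e i) ≤
        θ₀ • Φ (∑ i ∈ Iᶜ with r i ≤ θ₀, e i) := by
      rw [map_sum, Finset.smul_sum]
      exact Finset.sum_le_sum fun i hi =>
        smul_le_smul_of_nonneg_right (Finset.mem_filter.1 hi).2 (hpos i)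
    have hproj := isStarProjection_sum_of_orthogonal he horth (Finset.filter (fun i => r i ≤ θ₀) Iᶜ)
    refine ((LeUpTo.of_le hle).trans (LeUpTo.of_norm (ε := θ₀ * K)
      (IsSelfAdjoint.smul (by simp [isSelfAdjoint_iff]) (hΦ.isSelfAdjoint hproj.isSelfAdjoint))
      ?_)).mono (by simp)
    rw [norm_smul, Real.norm_of_nonneg hθ₀]
    have := hΦ.norm_le (∑ i ∈ Iᶜ with r i ≤ θ₀, e i)
    have := hproj.norm_le
    gcongr
    nlinarith
  have h4 : LeUpTo (L * δ₀) (∑ i ∈ Iᶜ with ¬ r i ≤ θ₀, r i • Φ (e i)) 0 := by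
    have hle : ∑ i ∈ Iᶜ with ¬ r i ≤ θ₀, r i • Φ (e i) ≤
        L • ∑ i ∈ Iᶜ with ¬ r i ≤ θ₀, Φ (e i) := by
      rw [Finset.smul_sum]
      exact Finset.sum_le_sum fun i _ => smul_le_smul_of_nonneg_right (hrL i) (hpos i)
    refine ((LeUpTo.of_le hle).trans (LeUpTo.of_norm (ε := L * δ₀)
      (IsSelfAdjoint.smul (by simp [isSelfAdjoint_iff])
        (Finset.sum_nonneg fun i _ => hpos i).isSelfAdjoint) ?_)).mono (by simp)
    rw [norm_smul, Real.norm_of_nonneg hL]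
    gcongr
    refine hΦ.norm_sum_le_of_orthogonal he horth _ hδ₀ fun i hi => ?_
    rw [Finset.mem_filter, Finset.mem_compl] at hi
    exact (hbad i hi.1).resolve_left hi.2
  rw [hdec]
  have := h1.add (h2.add (h3.add h4))
  simpa using this

end IsOrderZeroLike

section GoodCase

variable {G M : Type*} [NonUnitalCStarAlgebra G] [PartialOrder G] [StarOrderedRing G]
  [NonUnitalCStarAlgebra M] [PartialOrder M] [StarOrderedRing M]

lemma IsOrderZeroLike.exists_nilpotents {u : G} (hu : ∀ x, u * x = x ∧ x * u = x) {k : ℕ} {K : ℝ}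
    (hK : 0 ≤ K) {Φ : Fin (k + 1) → (G →ₗ[ℂ] M)} (hΦ : ∀ j, IsOrderZeroLike u K (Φ j))
    {a : M} (ha : 0 ≤ a) {y : G} (hy : 0 ≤ y) {η : ℝ} (happ : ‖(∑ j, Φ j y) - a‖ ≤ η)
    {ι : Type*} [Fintype ι] {e : ι → G} (he : ∀ i, IsStarProjection (e i))
    (horth : ∀ i j, i ≠ j → e i * e j = 0) {r : ι → ℝ} (hye : ∀ i, y * e i = r i • e i)
    {L θ θ₀ δ₀ : ℝ} (hrL : ∀ i, r i ≤ L) (hL : 0 ≤ L) (hθ₀ : 0 ≤ θ₀)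
    (hδ₀ : 0 ≤ δ₀) (hq : ‖y - y * ∑ i, e i‖ ≤ θ) (hθy : θ • ∑ i, e i ≤ y) (hθ : 0 ≤ θ)
    (I : Finset ι) (hbad : ∀ i ∉ I, r i ≤ θ₀ ∨ ∀ j, ‖Φ j (e i)‖ ≤ δ₀)
    {v : Fin 4 → G} (hvv : ∀ c, v c * v c = 0) (hvp : ∀ c, IsStarProjection (v c * star (v c)))
    (hvp' : ∀ c, IsStarProjection (star (v c) * v c)) (hqv : ∀ c, (∑ i, e i) * v c = v c)
    (hvq : ∀ c, v c * ∑ i, e i = v c) (hsum : ∑ c, v c * star (v c) = ∑ i ∈ I, e i)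
    {δ ε : ℝ} (hδ : 0 < δ) (hη : η < θ * δ)
    (hε : η + (k + 1) * (K * θ + (θ₀ * K + L * δ₀) + L * (4 * √(2 * δ * K))) ≤ ε) :
    ∃ w : Fin (4 * (k + 1)) → M, (∀ j, w j * w j = 0) ∧
      (∀ j, CuntzBelow (w j * star (w j) + star (w j) * w j) a) ∧
      CuntzBelow (cutDown ε a) (∑ j, w j * star (w j)) := by
  set q := ∑ i, e i with hq_def
  have hqproj : IsStarProjection q := isStarProjection_sum_of_orthogonal he horth _
  let W : Fin 4 × Fin (k + 1) → M := fun s => lift u (Φ s.2) δ (v s.1)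
  have hWW : ∀ s, W s * star (W s) = cutDown δ (Φ s.2 u) * cutDown δ (Φ s.2 u) * Φ s.2 u *
      Φ s.2 (v s.1 * star (v s.1)) := fun s => by
    rw [(hΦ s.2).star_lift hu, (hΦ s.2).lift_mul_lift hu]
  have hWW' : ∀ s, star (W s) * W s = cutDown δ (Φ s.2 u) * cutDown δ (Φ s.2 u) * Φ s.2 u *
      Φ s.2 (star (v s.1) * v s.1) := fun s => by
    rw [(hΦ s.2).star_lift hu, (hΦ s.2).lift_mul_lift hu]
  refine ⟨fun j => W (finProdFinEquiv.symm j), fun j => ?_, fun j => ?_, ?_⟩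
  · change lift u _ δ _ * lift u _ δ _ = 0
    rw [(hΦ _).lift_mul_lift hu, hvv, map_zero, mul_zero]
  · change CuntzBelow (W (finProdFinEquiv.symm j) * star (W (finProdFinEquiv.symm j)) +
      star (W (finProdFinEquiv.symm j)) * W (finProdFinEquiv.symm j)) a
    generalize finProdFinEquiv.symm j = s
    obtain ⟨c, j⟩ := s
    rw [hWW, hWW', ← mul_add, ← map_add]
    have hstar : star (v c) * star (v c) = 0 := by rw [← star_mul, hvv, star_zero]
    set p := v c * star (v c) with hp
    set p' := star (v c) * v c with hp'
    have hpp' : p * p' = 0 := by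
      rw [hp, hp', mul_assoc, ← mul_assoc (star (v c)), hstar, zero_mul, mul_zero]
    have hp'p : p' * p = 0 := by
      rw [hp, hp', mul_assoc, ← mul_assoc (v c), hvv, zero_mul, mul_zero]
    have hrproj : IsStarProjection (p + p') := by
      refine ⟨?_, (hvp c).isSelfAdjoint.add (hvp' c).isSelfAdjoint⟩
      change (p + p') * (p + p') = p + p'
      rw [mul_add, add_mul, add_mul, hpp', hp'p, (hvp c).isIdempotentElem.eq,
        (hvp' c).isIdempotentElem.eq, add_zero, zero_add]
    have hqr : q * (p + p') = p + p' := by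
      have : q * star (v c) = star (v c) := by
        have := congrArg star (hvq c)
        rwa [star_mul, hqproj.isSelfAdjoint.star_eq] at this
      rw [mul_add, hp, hp', ← mul_assoc, ← mul_assoc, hqv, this]
    have hrq : p + p' ≤ q := le_of_mul_eq hqproj hrproj hqr
    refine CuntzBelow.cutDown_mul_of_le (θ := θ) (e := (∑ j, Φ j y) - a)
      ((hΦ j).unit_nonneg hu) ((hΦ j).nonneg _ hrproj.nonneg) ha ?_ ((hΦ j).commute_unit hu _)
      hδ.le ?_ ?_ (happ.trans_lt hη)
    · rw [(hΦ j).mul_left, hrproj.isIdempotentElem.eq]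
    · rw [add_sub_cancel, ← map_real_smul]
      refine le_trans ((hΦ j).mono ((smul_le_smul_of_nonneg_left hrq hθ).trans hθy)) ?_
      exact Finset.single_le_sum (f := fun j => Φ j y) (fun i _ => (hΦ i).nonneg _ hy)
        (Finset.mem_univ j)
    · exact (Finset.sum_nonneg fun i _ => (hΦ i).nonneg _ hy).isSelfAdjoint.sub ha.isSelfAdjoint
  · rw [Equiv.sum_comp finProdFinEquiv.symm (fun s => W s * star (W s))]
    refine LeUpTo.cutDown_cuntzBelow (C := L * (2 * δ ^ 3)⁻¹) ?_ ha
      (Finset.sum_nonneg fun s _ => mul_star_self_nonneg _) (by positivity)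
    have h1 : LeUpTo η a (∑ j, Φ j y) := by
      refine ⟨a - ∑ j, Φ j y, ha.isSelfAdjoint.sub
        (Finset.sum_nonneg fun i _ => (hΦ i).nonneg _ hy).isSelfAdjoint, by rwa [norm_sub_rev], ?_⟩
      rw [add_sub_cancel]
    have h2 : ∀ j, LeUpTo (K * θ + (θ₀ * K + L * δ₀) + L * (4 * √(2 * δ * K))) (Φ j y)
        (L • ∑ c, (2 * δ ^ 3)⁻¹ • (W (c, j) * star (W (c, j)))) := by
      intro j
      refine ((hΦ j).leUpTo_of_decomposition hK hy he horth hye hrL hL hθ₀ hδ₀ hq I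
        fun i hi => (hbad i hi).imp_right fun h => h j).trans (LeUpTo.smul ?_ hL)
      rw [← hsum, map_sum]
      have := LeUpTo.sum Finset.univ (a := fun c => Φ j (v c * star (v c)))
        (b := fun c => (2 * δ ^ 3)⁻¹ • (W (c, j) * star (W (c, j)))) (ε := √(2 * δ * K))
        fun c _ => by
          rw [hWW]
          refine leUpTo_cutDown_mul ((hΦ j).unit_nonneg hu) ((hΦ j).nonneg _ (hvp c).nonneg) ?_
            ((hΦ j).commute_unit hu _) hδ ?_
          · rw [(hΦ j).mul_left, (hvp c).isIdempotentElem.eq]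
          · have h3 := (hΦ j).norm_le (v c * star (v c))
            have h4 := (hvp c).norm_le
            nlinarith
      simpa using this
    have h3 := h1.trans (LeUpTo.sum Finset.univ fun j _ => h2 j)
    refine (h3.mono (le_trans (le_of_eq ?_) hε)).trans (LeUpTo.of_le (le_of_eq ?_)) |>.mono
      (le_of_eq (add_zero _))
    · simp
    · rw [Fintype.sum_prod_type_right, Finset.smul_sum]
      refine Finset.sum_congr rfl fun j _ => ?_
      rw [← Finset.smul_sum, smul_smul]

end GoodCase

section BadEstimates

variable {M : Type*} [NonUnitalCStarAlgebra M] [PartialOrder M] [StarOrderedRing M]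

lemma norm_mul_sq_le {x : M} (hx : 0 ≤ x) (g : M) : ‖x * g‖ ^ 2 ≤ ‖x‖ * ‖star g * x * g‖ := by
  have h1 : star (x * g) * (x * g) ≤ ‖x‖ • (star g * x * g) := by
    have := star_left_conjugate_le_conjugate (mul_self_le_norm_smul hx) g
    rw [mul_smul_comm, smul_mul_assoc] at this
    rw [star_mul, hx.isSelfAdjoint.star_eq]
    simpa only [mul_assoc] using this
  have h2 := CStarAlgebra.norm_le_norm_of_nonneg_of_le (star_mul_self_nonneg _) h1
  rwa [CStarRing.norm_star_mul_self, ← sq, norm_smul, Real.norm_of_nonneg (norm_nonneg _)] at h2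

lemma norm_mul_sq_le_of_le {x s y : M} (hx : 0 ≤ x) (hxs : x ≤ s) :
    ‖x * y‖ ^ 2 ≤ ‖x‖ * (‖y‖ * ‖s * y‖) := by
  refine (norm_mul_sq_le hx y).trans ?_
  gcongr
  refine (CStarAlgebra.norm_le_norm_of_nonneg_of_le (star_left_conjugate_nonneg hx y)
    (star_left_conjugate_le_conjugate hxs y)).trans ?_
  rw [mul_assoc]
  refine (norm_mul_le _ _).trans ?_
  rw [norm_star]

lemma norm_mul_le_of_le_approx {x y s t c d : M} (hx : 0 ≤ x) (hxs : x ≤ s) (hy : 0 ≤ y)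
    (hyt : y ≤ t) (hc : 0 ≤ c) (hd : 0 ≤ d) (hcd : c * d = 0) {η : ℝ} (hη : η ≤ 1)
    (hsc : ‖s - c‖ ≤ η) (htd : ‖t - d‖ ≤ η) :
    ‖x * y‖ ≤ √((‖c‖ + ‖d‖ + 1) ^ 2 *
      √((‖c‖ + ‖d‖ + 1) ^ 2 * (2 * (‖c‖ + ‖d‖ + 1) * η))) := by
  set N := ‖c‖ + ‖d‖ + 1 with hN
  have hη0 : 0 ≤ η := (norm_nonneg _).trans hsc
  have hcn := norm_nonneg c
  have hdn := norm_nonneg d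
  have hN0 : 0 ≤ N := by positivity
  have hs : ‖s‖ ≤ N := by
    have := norm_le_norm_sub_add s c
    linarith
  have ht : ‖t‖ ≤ N := by
    have := norm_le_norm_sub_add t d
    linarith
  have hxN : ‖x‖ ≤ N := (CStarAlgebra.norm_le_norm_of_nonneg_of_le hx hxs).trans hs
  have hyN : ‖y‖ ≤ N := (CStarAlgebra.norm_le_norm_of_nonneg_of_le hy hyt).trans ht
  have hs0 : 0 ≤ s := hx.trans hxs
  have hdc : d * c = 0 := by
    have := congrArg star hcd
    rwa [star_mul, hc.isSelfAdjoint.star_eq, hd.isSelfAdjoint.star_eq, star_zero] at this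
  have hts : ‖t * s‖ ≤ 2 * N * η := by
    have : t * s = (t - d) * s + d * (s - c) := by
      rw [sub_mul, mul_sub, hdc]; abel
    rw [this]
    have e1 : ‖(t - d) * s‖ ≤ η * N := (norm_mul_le _ _).trans (by gcongr)
    have e2 : ‖d * (s - c)‖ ≤ N * η := (norm_mul_le _ _).trans (by gcongr; linarith)
    exact (norm_add_le _ _).trans (by linarith)
  have hys : ‖s * y‖ ≤ √(N ^ 2 * (2 * N * η)) := by
    have e : ‖s * y‖ = ‖y * s‖ := by
      rw [← norm_star, star_mul, hs0.isSelfAdjoint.star_eq, hy.isSelfAdjoint.star_eq]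
    rw [e]
    refine Real.le_sqrt_of_sq_le ((norm_mul_sq_le_of_le hy hyt).trans ?_)
    rw [sq, mul_assoc]
    gcongr
  refine Real.le_sqrt_of_sq_le ((norm_mul_sq_le_of_le hx hxs).trans ?_)
  rw [sq, mul_assoc]
  gcongr
  rwa [← sq]

lemma le_smul_add_of_orthogonal {a z c d : M} (ha : 0 ≤ a) (hz : IsSelfAdjoint z) (hc : 0 ≤ c)
    (hd : 0 ≤ d) (hcd : c * d = 0) (h : c - d = a * z * a) {δ : ℝ} (hδ : 0 < δ) :
    c ≤ (δ⁻¹ * (‖z * a * a * z‖ * ‖a‖)) • a + (c - cutDown δ c) := by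
  have hdc : d * c = 0 := by
    have := congrArg star hcd
    rwa [star_mul, hc.isSelfAdjoint.star_eq, hd.isSelfAdjoint.star_eq, star_zero] at this
  have h1 : c * c ≤ a * (z * a * a * z) * a := by
    have e : a * (z * a * a * z) * a = (c - d) * (c - d) := by
      rw [h]; simp only [mul_assoc]
    rw [e, mul_sub, sub_mul, sub_mul, hcd, hdc, sub_zero, zero_sub, sub_neg_eq_add]
    exact le_add_of_nonneg_right (Commute.mul_nonneg hd hd (Commute.refl _))
  have hs : IsSelfAdjoint (z * a * a * z) := by
    rw [isSelfAdjoint_iff]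
    simp only [star_mul, hz.star_eq, ha.isSelfAdjoint.star_eq, mul_assoc]
  have h2 : a * (z * a * a * z) * a ≤ (‖z * a * a * z‖ * ‖a‖) • a := by
    refine (conj_le_norm_smul_mul_self ha.isSelfAdjoint hs).trans ?_
    rw [mul_smul]
    exact smul_le_smul_of_nonneg_left (mul_self_le_norm_smul ha) (norm_nonneg _)
  have h3 : cutDown δ c ≤ (δ⁻¹ * (‖z * a * a * z‖ * ‖a‖)) • a := by
    refine (cutDown_le_smul_mul_self hδ hc).trans ?_
    rw [mul_smul]
    exact smul_le_smul_of_nonneg_left (h1.trans h2) (inv_nonneg.2 hδ.le)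
  calc c = cutDown δ c + (c - cutDown δ c) := by abel
    _ ≤ _ := by gcongr

lemma IsMinimalProjection.norm_apply_mul_sub_le {G : Type*} [NonUnitalCStarAlgebra G] {e q u : G}
    (he : IsMinimalProjection e) (hu : ∀ x, u * x = x ∧ x * u = x)
    (hq : ∀ x, e * x * q = e * x * e) {ρ : G → ℂ} (hρ : ∀ x, e * x * e = ρ x • e) (c d : G) :
    ‖ρ (c * d) - ρ c * ρ d‖ ≤ ‖c * (u - q)‖ * ‖d‖ := by
  have h1 : (ρ (c * d) - ρ c * ρ d) • e = e * (c * (u - q) * d) * e := by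
    rw [sub_smul, ← hρ, mul_smul, ← hρ d, ← smul_mul_assoc, ← smul_mul_assoc, ← hρ c, ← hq c,
      mul_sub, (hu c).2]
    simp only [mul_sub, sub_mul, mul_assoc]
  have hle : ‖e‖ ≤ 1 := he.1.norm_le
  have hpos : 0 < ‖e‖ := norm_pos_iff.2 he.2.1
  have h2 : ‖(ρ (c * d) - ρ c * ρ d) • e‖ ≤ ‖c * (u - q)‖ * ‖d‖ * ‖e‖ := by
    rw [h1]
    calc ‖e * (c * (u - q) * d) * e‖ ≤ ‖e‖ * (‖c * (u - q)‖ * ‖d‖) * ‖e‖ :=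
          (norm_mul_le _ _).trans (mul_le_mul_of_nonneg_right ((norm_mul_le _ _).trans
            (mul_le_mul_of_nonneg_left (norm_mul_le _ _) (norm_nonneg _))) (norm_nonneg _))
      _ ≤ 1 * (‖c * (u - q)‖ * ‖d‖) * ‖e‖ := by gcongr
      _ = _ := by ring
  rw [norm_smul] at h2
  exact le_of_mul_le_mul_right h2 hpos

lemma IsOrderZeroLike.norm_apply_mul_le {G : Type*} [NonUnitalCStarAlgebra G] [PartialOrder G]
    [StarOrderedRing G] {u e : G} {K : ℝ} {Φ : G →ₗ[ℂ] M} (hΦ : IsOrderZeroLike u K Φ)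
    (he : IsMinimalProjection e) {ρ : G → ℂ} (hρ : ∀ x, e * x * e = ρ x • e) {δ₀ : ℝ}
    (hδ₀ : 0 < δ₀) (hδe : δ₀ ≤ ‖Φ e‖) (c d : G) : ‖ρ (c * d)‖ ≤ (δ₀ ^ 2)⁻¹ * ‖Φ c * Φ d‖ := by
  have hs : star (Φ e) = Φ e := hΦ.isSelfAdjoint he.1.isSelfAdjoint
  have hee : e * e = e := he.1.isIdempotentElem.eq
  have h1 : Φ e * (Φ c * Φ d) * Φ e = ρ (c * d) • ((Φ e * Φ e) * (Φ e * Φ e)) := by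
    have e1 : Φ e * (Φ c * Φ d) * Φ e = Φ u * (Φ u * (Φ u * Φ (e * (c * d) * e))) := by
      rw [← mul_assoc, hΦ.mul_left e c, mul_assoc (Φ u), hΦ.mul_left (e * c) d, mul_assoc (Φ u),
        mul_assoc (Φ u), hΦ.mul_left (e * c * d) e]
      simp only [mul_assoc]
    have e2 : (Φ e * Φ e) * (Φ e * Φ e) = Φ u * (Φ u * (Φ u * Φ e)) := by
      rw [← mul_assoc, hΦ.mul_left e e, hee, mul_assoc (Φ u), hΦ.mul_left e e, hee,
        mul_assoc (Φ u), mul_assoc (Φ u), hΦ.mul_left e e, hee]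
    rw [e1, e2, hρ, map_smul, mul_smul_comm, mul_smul_comm, mul_smul_comm]
  have hn2 : ‖Φ e * Φ e‖ = ‖Φ e‖ * ‖Φ e‖ := by
    have := CStarRing.norm_star_mul_self (x := Φ e)
    rwa [hs] at this
  have hn4 : ‖(Φ e * Φ e) * (Φ e * Φ e)‖ = (‖Φ e‖ * ‖Φ e‖) * (‖Φ e‖ * ‖Φ e‖) := by
    have := CStarRing.norm_star_mul_self (x := Φ e * Φ e)
    rwa [star_mul, hs, hn2] at this
  have h2 : ‖ρ (c * d)‖ * ((‖Φ e‖ * ‖Φ e‖) * (‖Φ e‖ * ‖Φ e‖)) ≤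
      ‖Φ c * Φ d‖ * (‖Φ e‖ * ‖Φ e‖) := by
    rw [← hn4, ← norm_smul, ← h1]
    calc _ ≤ ‖Φ e‖ * ‖Φ c * Φ d‖ * ‖Φ e‖ :=
          (norm_mul_le _ _).trans (by gcongr; exact norm_mul_le _ _)
      _ = _ := by ring
  have hpos : 0 < ‖Φ e‖ := hδ₀.trans_le hδe
  rw [← mul_assoc] at h2
  have h3 := le_of_mul_le_mul_right h2 (by positivity)
  rw [inv_mul_eq_div, le_div_iff₀ (by positivity)]
  refine le_trans ?_ h3
  rw [sq]
  gcongr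

end BadEstimates

section BadBound

variable {G M : Type*} [NonUnitalCStarAlgebra G] [PartialOrder G] [StarOrderedRing G]
  [NonUnitalCStarAlgebra M] [PartialOrder M] [StarOrderedRing M]

/-- The bound for the product of the values of an approximate character at the two parts of an
orthogonal decomposition `c - d = a * z * a`. -/
noncomputable def badBound (a c d z : M) (K δ₀ θ η : ℝ) : ℝ :=
  (δ₀ ^ 2)⁻¹ * √((‖c‖ + ‖d‖ + 1) ^ 2 * √((‖c‖ + ‖d‖ + 1) ^ 2 * (2 * (‖c‖ + ‖d‖ + 1) * η))) +
    √(K * ‖c‖ * ((‖z * a * a * z‖ * ‖a‖ + K) * √θ)) * (K * ‖d‖)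

lemma IsOrderZeroLike.norm_apply_mul_apply_le {k : ℕ} {u e q : G} {K : ℝ} (hK : 0 ≤ K)
    (hu : ∀ x, u * x = x ∧ x * u = x)
    {Φ : Fin (k + 1) → (G →ₗ[ℂ] M)} (hΦ : ∀ j, IsOrderZeroLike u K (Φ j)) {Ψ : M →ₗ[ℂ] G}
    (hΨ : ∀ x, 0 ≤ x → 0 ≤ Ψ x) (hΨK : ∀ x, ‖Ψ x‖ ≤ K * ‖x‖)
    (he : IsMinimalProjection e) (hq : ∀ x, e * x * q = e * x * e)
    {ρ : G → ℂ} (hρ : ∀ x, e * x * e = ρ x • e) {δ₀ : ℝ} (hδ₀ : 0 < δ₀)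
    (hδe : ∃ j, δ₀ ≤ ‖Φ j e‖) {a z c d : M} (ha : 0 ≤ a) (hz : IsSelfAdjoint z) (hc : 0 ≤ c)
    (hd : 0 ≤ d) (hcd : c * d = 0) (h : c - d = a * z * a) {θ η : ℝ} (hη : η ≤ 1)
    (hsc : ‖(∑ j, Φ j (Ψ c)) - c‖ ≤ η) (hsd : ‖(∑ j, Φ j (Ψ d)) - d‖ ≤ η) (hθ : 0 < θ)
    (hqp : IsStarProjection q) (hqy : Commute q (Ψ a)) (hqθ : ‖Ψ a - Ψ a * q‖ ≤ θ) :
    ‖ρ (Ψ c) * ρ (Ψ d)‖ ≤ badBound a c d z K δ₀ θ η := by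
  obtain ⟨j, hj⟩ := hδe
  have hsum : ∀ x, 0 ≤ x → Φ j (Ψ x) ≤ ∑ j, Φ j (Ψ x) := fun x hx =>
    Finset.single_le_sum (f := fun j => Φ j (Ψ x)) (fun i _ => (hΦ i).nonneg _ (hΨ x hx))
      (Finset.mem_univ j)
  have h1 := (hΦ j).norm_apply_mul_le he hρ hδ₀ hj (Ψ c) (Ψ d)
  have h2 := norm_mul_le_of_le_approx ((hΦ j).nonneg _ (hΨ c hc)) (hsum c hc)
    ((hΦ j).nonneg _ (hΨ d hd)) (hsum d hd) hc hd hcd hη hsc hsd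
  have h3 := he.norm_apply_mul_sub_le hu hq hρ (Ψ c) (Ψ d)
  set g := u - q with hg
  have hup := isStarProjection_of_unit hu
  have hgs : star g = g := by
    rw [hg, star_sub, hup.isSelfAdjoint.star_eq, hqp.isSelfAdjoint.star_eq]
  have hgg : g * g = g := by
    rw [hg, mul_sub, sub_mul, sub_mul, (hu u).1, (hu q).1, (hu q).2, hqp.isIdempotentElem.eq]
    abel
  have hgn : ‖g‖ ≤ 1 := IsStarProjection.norm_le g ⟨hgg, hgs⟩
  have hgy : g * Ψ a * g = Ψ a - Ψ a * q := by
    rw [hg, sub_mul, (hu _).1, hqy.eq, mul_sub, sub_mul, sub_mul, (hu _).2,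
      mul_assoc _ q u, (hu q).2, mul_assoc _ q q, hqp.isIdempotentElem.eq]
    abel
  have hσ : 0 < √θ := Real.sqrt_pos.2 hθ
  have h4 : ‖g * Ψ c * g‖ ≤ (‖z * a * a * z‖ * ‖a‖ + K) * √θ := by
    set C := ‖z * a * a * z‖ * ‖a‖ with hC
    have hC0 : 0 ≤ C := by positivity
    have e1 : Ψ c ≤ ((√θ)⁻¹ * C) • Ψ a + Ψ (c - cutDown √θ c) := by
      have e2 := hΨ _ (sub_nonneg.2 (le_smul_add_of_orthogonal ha hz hc hd hcd h hσ))
      rw [map_sub, map_add, ← Complex.coe_smul, map_smul, Complex.coe_smul, sub_nonneg] at e2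
      exact e2
    have e3 := star_left_conjugate_le_conjugate e1 g
    rw [hgs, mul_add, add_mul, mul_smul_comm, smul_mul_assoc, hgy] at e3
    have e4 : 0 ≤ g * Ψ c * g := by
      have := star_left_conjugate_nonneg (hΨ c hc) g
      rwa [hgs] at this
    refine (CStarAlgebra.norm_le_norm_of_nonneg_of_le e4 e3).trans ((norm_add_le _ _).trans ?_)
    have e5 : ‖((√θ)⁻¹ * C) • (Ψ a - Ψ a * q)‖ ≤ C * √θ := by
      rw [norm_smul, Real.norm_of_nonneg (by positivity)]
      calc (√θ)⁻¹ * C * ‖Ψ a - Ψ a * q‖ ≤ (√θ)⁻¹ * C * (√θ * √θ) := by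
            rw [Real.mul_self_sqrt hθ.le]; gcongr
        _ = _ := by field_simp
    have e6 : ‖g * Ψ (c - cutDown √θ c) * g‖ ≤ K * √θ := by
      have e7 : ‖Ψ (c - cutDown √θ c)‖ ≤ K * √θ :=
        (hΨK _).trans (by gcongr; exact norm_sub_cutDown_le hσ.le hc)
      calc _ ≤ ‖g‖ * ‖Ψ (c - cutDown √θ c)‖ * ‖g‖ :=
            (norm_mul_le _ _).trans (by gcongr; exact norm_mul_le _ _)
        _ ≤ 1 * (K * √θ) * 1 := by gcongr
        _ = _ := by ring
    linarith
  have h5 : ‖Ψ c * g‖ ≤ √(K * ‖c‖ * ((‖z * a * a * z‖ * ‖a‖ + K) * √θ)) := by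
    refine Real.le_sqrt_of_sq_le ((norm_mul_sq_le (hΨ c hc) g).trans ?_)
    rw [hgs]
    have := hΨK c
    gcongr
  have h6 : ‖ρ (Ψ c) * ρ (Ψ d)‖ ≤ ‖ρ (Ψ c * Ψ d)‖ + ‖ρ (Ψ c * Ψ d) - ρ (Ψ c) * ρ (Ψ d)‖ := by
    rw [norm_sub_rev]
    have := norm_add_le (ρ (Ψ c * Ψ d)) (ρ (Ψ c) * ρ (Ψ d) - ρ (Ψ c * Ψ d))
    rwa [add_sub_cancel] at this
  refine h6.trans (add_le_add (h1.trans (by gcongr)) (h3.trans ?_))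
  exact mul_le_mul h5 (hΨK d) (norm_nonneg _) (Real.sqrt_nonneg _)

lemma tendsto_badBound (a c d z : M) (K δ₀ : ℝ) :
    Tendsto (fun m : ℕ => badBound a c d z K δ₀ (1 / ((m : ℝ) + 1)) ((1 / ((m : ℝ) + 1)) ^ 2)) atTop
      (𝓝 0) := by
  have h : Continuous fun θ : ℝ => badBound a c d z K δ₀ θ (θ ^ 2) := by
    unfold badBound
    fun_prop
  refine (h.tendsto' 0 0 (by simp [badBound])).comp tendsto_one_div_add_atTop_nhds_zero_nat

end BadBound

section Limit

open scoped ComplexOrder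

variable {M : Type*} [NonUnitalCStarAlgebra M] [PartialOrder M] [StarOrderedRing M]

lemma exists_functional_of_approx {a : M} {K θ₀ : ℝ} (hθ₀ : 0 < θ₀) {B : M → M → M → ℕ → ℝ}
    (hB : ∀ c d z, Tendsto (B c d z) atTop (𝓝 0))
    (h : ∀ (F : Finset M) (m : ℕ), ∃ ρ : M →ₗ[ℂ] ℂ, (∀ x, 0 ≤ x → 0 ≤ ρ x) ∧
      (∀ x, ‖ρ x‖ ≤ K * ‖x‖) ∧ θ₀ ≤ ‖ρ a‖ ∧ ∀ c ∈ F, ∀ d ∈ F, ∀ z, IsSelfAdjoint z → 0 ≤ c → 0 ≤ d →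
        c * d = 0 → c - d = a * z * a → ‖ρ c * ρ d‖ ≤ B c d z m) :
    ∃ ρ : M →ₚ[ℂ] ℂ, ρ a ≠ 0 ∧ ∀ z c d, IsSelfAdjoint z → 0 ≤ c → 0 ≤ d → c * d = 0 →
      c - d = a * z * a → ρ c * ρ d = 0 := by
  classical
  choose ρ hpos hK ha hcd using h
  let f : M → Finset M × ℕ → ℂ := fun x p => ρ p.1 p.2 x
  let U : Ultrafilter (Finset M × ℕ) := Ultrafilter.of atTop
  have hU : (U : Filter (Finset M × ℕ)) ≤ atTop := Ultrafilter.of_le _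
  have hlim : ∀ x, ∃ l : ℂ, Tendsto (f x) U (𝓝 l) := by
    intro x
    obtain ⟨l, -, hl⟩ := (isCompact_closedBall (0 : ℂ) (K * ‖x‖)).ultrafilter_le_nhds (U.map (f x))
      (by
        rw [le_principal_iff]
        refine Filter.mem_map.2 (Filter.Eventually.of_forall fun p => ?_)
        simpa [f] using hK p.1 p.2 x)
    exact ⟨l, hl⟩
  choose l hl using hlim
  let L : M →ₗ[ℂ] ℂ :=
    { toFun := l
      map_add' := fun x y => tendsto_nhds_unique (hl (x + y))
        (((hl x).add (hl y)).congr fun p => (map_add (ρ p.1 p.2) x y).symm)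
      map_smul' := fun c x => tendsto_nhds_unique (hl (c • x))
        (((hl x).const_smul c).congr fun p => (map_smul (ρ p.1 p.2) c x).symm) }
  have hL : ∀ x, L x = l x := fun _ => rfl
  refine ⟨PositiveLinearMap.mk₀ L fun x hx => ?_, ?_, ?_⟩
  · exact isClosed_Ici.mem_of_tendsto (hl x) (Eventually.of_forall fun p => hpos p.1 p.2 x hx)
  · change l a ≠ 0
    have : θ₀ ≤ ‖l a‖ := ge_of_tendsto' (hl a).norm fun p => ha p.1 p.2
    exact norm_pos_iff.1 (hθ₀.trans_le this)
  · intro z c d hz hc hd h0 hz'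
    change l c * l d = 0
    have h1 : Tendsto (fun p => ‖f c p * f d p‖) U (𝓝 ‖l c * l d‖) := ((hl c).mul (hl d)).norm
    have h2 : Tendsto (fun p : Finset M × ℕ => B c d z p.2) U (𝓝 0) :=
      ((hB c d z).comp tendsto_snd).mono_left (hU.trans (le_of_eq (by
        rw [← prod_atTop_atTop_eq])))
    have h3 : ∀ᶠ p in (U : Filter (Finset M × ℕ)), ‖f c p * f d p‖ ≤ B c d z p.2 := by
      refine hU ?_
      refine Filter.mem_of_superset (mem_atTop (({c, d} : Finset M), 0)) ?_
      intro p hp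
      refine hcd p.1 p.2 c (hp.1 (by simp)) d (hp.1 (by simp)) z hz hc hd h0 hz'
    have h4 := le_of_tendsto_of_tendsto h1 h2 h3
    exact norm_eq_zero.1 (le_antisymm h4 (norm_nonneg _))

end Limit

section Core

open scoped ComplexOrder

lemma IsMinimalProjection.exists_functional {G : Type*} [NonUnitalCStarAlgebra G] [PartialOrder G]
    [StarOrderedRing G] {e : G} (he : IsMinimalProjection e) :
    ∃ ρ : G →ₗ[ℂ] ℂ, (∀ x, e * x * e = ρ x • e) ∧ (∀ x, 0 ≤ x → 0 ≤ ρ x) ∧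
      ∀ x, ‖ρ x‖ ≤ ‖x‖ := by
  choose ρ hρ using he.2.2
  have hinj : ∀ c d : ℂ, c • e = d • e → c = d := fun c d h => smul_left_injective ℂ he.2.1 h
  refine ⟨{ toFun := ρ, map_add' := fun x y => ?_, map_smul' := fun c x => ?_ }, hρ,
    fun x hx => ?_, fun x => ?_⟩
  · exact hinj _ _ (by rw [← hρ, add_smul, ← hρ, ← hρ, mul_add, add_mul])
  · refine hinj _ _ ?_
    rw [← hρ, RingHom.id_apply, smul_assoc, ← hρ, mul_smul_comm, smul_mul_assoc]
  · refine nonneg_of_smul_nonneg he.1 he.2.1 ?_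
    change 0 ≤ ρ x • e
    rw [← hρ]
    simpa only [he.1.isSelfAdjoint.star_eq] using star_left_conjugate_nonneg hx e
  · change ‖ρ x‖ ≤ ‖x‖
    have hle : ‖e‖ ≤ 1 := he.1.norm_le
    have hpos : 0 < ‖e‖ := norm_pos_iff.2 he.2.1
    refine le_of_mul_le_mul_right ?_ hpos
    rw [← norm_smul, ← hρ]
    refine (norm_mul_le _ _).trans (mul_le_mul_of_nonneg_right ?_ (norm_nonneg _))
    exact (norm_mul_le _ _).trans (mul_le_of_le_one_left (norm_nonneg _) hle)

lemma exists_small_parameter {f : ℝ → ℝ} (hf : Continuous f) (h0 : f 0 = 0) {ε : ℝ} (hε : 0 < ε) :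
    ∃ t, 0 < t ∧ f t ≤ ε := by
  have h := (hf.tendsto' 0 0 h0).eventually_le_const hε
  have h' : ∀ᶠ t in 𝓝[>] (0 : ℝ), f t ≤ ε := h.filter_mono nhdsWithin_le_nhds
  obtain ⟨t, ht, h0⟩ := (h'.and self_mem_nhdsWithin).exists
  exact ⟨t, h0, ht⟩

variable {M : Type*} [NonUnitalCStarAlgebra M] [PartialOrder M] [StarOrderedRing M]

theorem HasOrderZeroApprox.exists_nilpotents {k : ℕ} {K : ℝ} (hM : HasOrderZeroApprox M k K)
    (hK : 0 ≤ K) {a : M} (ha : 0 ≤ a)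
    (hchar : ∀ ρ : M →ₚ[ℂ] ℂ, ρ a ≠ 0 → (∀ z c d, IsSelfAdjoint z → 0 ≤ c → 0 ≤ d → c * d = 0 →
      c - d = a * z * a → ρ c * ρ d = 0) → False) {ε : ℝ} (hε : 0 < ε) :
    ∃ w : Fin (4 * (k + 1)) → M, (∀ j, w j * w j = 0) ∧
      (∀ j, CuntzBelow (w j * star (w j) + star (w j) * w j) a) ∧
      CuntzBelow (cutDown ε a) (∑ j, w j * star (w j)) := by
  classical
  by_contra hno
  set L := K * ‖a‖ with hLdef
  have hL : 0 ≤ L := by positivity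
  obtain ⟨t, ht, htε⟩ := exists_small_parameter
    (f := fun t => ((k : ℝ) + 1) * ((t * K + L * t) + L * (4 * √(2 * t * K)))) (by fun_prop)
    (by simp) (half_pos hε)
  have hsmall : ∀ᶠ m : ℕ in atTop, 1 / ((m : ℝ) + 1) < t ∧
      (1 / ((m : ℝ) + 1)) ^ 2 + ((k : ℝ) + 1) * (K * (1 / ((m : ℝ) + 1))) < ε / 2 := by
    have hc : Continuous fun θ : ℝ => θ ^ 2 + ((k : ℝ) + 1) * (K * θ) := by fun_prop
    refine (tendsto_one_div_add_atTop_nhds_zero_nat.eventually_lt_const ht).and ?_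
    exact ((hc.tendsto' 0 0 (by simp)).comp
      tendsto_one_div_add_atTop_nhds_zero_nat).eventually_lt_const (half_pos hε)
  obtain ⟨m₀, hm₀⟩ := eventually_atTop.1 hsmall
  let T : ℕ → ℝ := fun m => 1 / (((m + m₀ : ℕ) : ℝ) + 1)
  suffices h : ∀ (F : Finset M) (m : ℕ), ∃ ρ : M →ₗ[ℂ] ℂ, (∀ x, 0 ≤ x → 0 ≤ ρ x) ∧
      (∀ x, ‖ρ x‖ ≤ K * ‖x‖) ∧ t ≤ ‖ρ a‖ ∧ ∀ c ∈ F, ∀ d ∈ F, ∀ z, IsSelfAdjoint z → 0 ≤ c → 0 ≤ d →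
        c * d = 0 → c - d = a * z * a → ‖ρ c * ρ d‖ ≤ badBound a c d z K t (T m) (T m ^ 2) by
    obtain ⟨ρ, hρa, hρ⟩ := exists_functional_of_approx ht (fun c d z =>
      (tendsto_add_atTop_iff_nat m₀).2 (tendsto_badBound a c d z K t)) h
    exact hchar ρ hρa hρ
  intro F m
  obtain ⟨hθt, hθε⟩ := hm₀ (m + m₀) (Nat.le_add_left _ _)
  set θ := T m with hθdef
  have hθ : 0 < θ := by simp only [hθdef, T]; positivity
  have hθ1 : θ ^ 2 ≤ 1 := by
    refine pow_le_one₀ hθ.le ?_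
    simp only [hθdef, T]
    rw [div_le_one (by positivity)]
    exact le_add_of_nonneg_left (Nat.cast_nonneg _)
  change θ < t at hθt
  change θ ^ 2 + ((k : ℝ) + 1) * (K * θ) < ε / 2 at hθε
  obtain ⟨G, _, _, _, _, u, Ψ, Φ, hu, hΨ, hΨK, hΦ, happ⟩ := hM (insert a F) (θ ^ 2) (by positivity)
  have hy : 0 ≤ Ψ a := hΨ a ha
  obtain ⟨q, hqp, hqy, hqθ, hq⟩ := exists_spectral_cut hy hθ
  obtain ⟨ι, _, e, l, he, horth, heq, hl⟩ := exists_minimal_decomposition hy.isSelfAdjoint hqp hqy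
  choose r hr0 hrle hr using fun i => eigenvalue_real hy (he i).1 (he i).2.1 (hl i)
  obtain ⟨I, v, hI, hvv, hvp, hvp', hqv, hvq, hsum⟩ := exists_good_partialIsometries he horth
  by_cases hbad : ∀ i ∉ I, r i ≤ t ∨ ∀ j, ‖Φ j (e i)‖ ≤ t
  · refine absurd (IsOrderZeroLike.exists_nilpotents hu hK hΦ ha hy
      (happ a (Finset.mem_insert_self _ _)) (fun i => (he i).1) horth hr
      (fun i => (hrle i).trans (hΨK a)) hL ht.le ht.le (heq ▸ hq) (heq ▸ hqθ) hθ.le I hbad hvv hvp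
      hvp' hqv hvq hsum ht ?_ ?_) hno
    · rw [sq]
      exact mul_lt_mul_of_pos_left hθt hθ
    · rw [← hLdef]
      have : θ ^ 2 + ((k : ℝ) + 1) * (K * θ + (t * K + L * t) + L * (4 * √(2 * t * K))) =
          (θ ^ 2 + ((k : ℝ) + 1) * (K * θ)) +
            ((k : ℝ) + 1) * ((t * K + L * t) + L * (4 * √(2 * t * K))) := by ring
      rw [this]
      linarith
  · push Not at hbad
    obtain ⟨i, hiI, hri, j, hj⟩ := hbad
    obtain ⟨ρ, hρ, hρpos, hρn⟩ := (he i).exists_functional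
    have heqx : ∀ x, e i * x * q = e i * x * e i := fun x => by
      rw [← heq, Finset.mul_sum]
      exact Finset.sum_eq_single i (fun j _ hji => hI i hiI j hji x) (by simp)
    refine ⟨ρ ∘ₗ Ψ, fun x hx => hρpos _ (hΨ x hx), fun x => (hρn _).trans (hΨK x), ?_, ?_⟩
    · have h1 : ρ (Ψ a) = (r i : ℂ) := by
        refine smul_left_injective ℂ (he i).2.1 ?_
        change ρ (Ψ a) • e i = (r i : ℂ) • e i
        rw [← hρ, mul_assoc, hr, mul_smul_comm, (he i).1.isIdempotentElem.eq]
        exact (Complex.coe_smul _ _).symm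
      rw [LinearMap.comp_apply, h1, Complex.norm_real, Real.norm_of_nonneg (hr0 i)]
      exact hri.le
    · intro c hc d hd z hz hc0 hd0 hcd h
      exact IsOrderZeroLike.norm_apply_mul_apply_le hK hu hΦ hΨ hΨK (he i) heqx hρ ht ⟨j, hj.le⟩ ha
        hz hc0 hd0 hcd h hθ1 (happ c (Finset.mem_insert_of_mem hc))
        (happ d (Finset.mem_insert_of_mem hd)) hθ hqp hqy hq

end Core

/-- Proposition 4.1.  For a nowhere scattered C*-algebra of nuclear
dimension at most `k`, one has `wdiv_{4(k+1)}(2(k+1)·x) ≤ 8(k+1)²` for every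
`x ∈ Cu(A)`; in particular every element of `Cu(A)` has a multiple with finite weak
divisibility. -/
theorem wdiv_bound_of_nuclearDim
    (A : Type) [NonUnitalCStarAlgebra A] (S : Type) [CuSemigroup S]
    (hS : IsCuntzSemigroupOf A S)
    (k : ℕ) (hns : NowhereScattered A) (hdim : NuclearDimLE A k) :
    (∀ x : S, CuDiv.wdiv (4 * (k + 1)) ((2 * (k + 1)) • x) ≤ (8 * (k + 1) ^ 2 : ℕ)) ∧
    (∀ x : S, ∃ m : ℕ, 1 ≤ m ∧ CuDiv.wdiv (2 * m) (m • x) < ⊤) := by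
  let _ := CStarAlgebra.spectralOrder A
  have _ := CStarAlgebra.spectralOrderedRing A
  refine hS.wdiv_bound fun x => hS.isWeaklyDivisible_two (fun n a ha ε hε => ?_) x
  exact (hdim.hasOrderZeroApprox n).exists_nilpotents (by positivity) ha
    (fun ρ hρ h => hns.not_functional ρ ha hρ h) hε
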